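/- arXiv:2605.14456 — 7 statements merged into one kernel-verified Lean document; each statement's English description precedes it below -/
import Mathlib

section
/- For every p ∈ [1,∞) there exists a constant C* > 0 such that for every f ∈ BMO(𝓛_k), every x₀ ∈ ℝ^n, and every r ≥ ρ_k(x₀), the ball B = B(x₀,r) satisfies (ω_k(B)^{-1} ∫_B |f|^p dω_k)^{1/p} ≤ C*·‖f‖_{BMO(𝓛_k)}. -/
open MeasureTheory Metric Real
open scoped ENNReal RealInnerProductSpace

set_option linter.unusedVariables false

noncomputable section

/-- `f` satisfies the defining conditions of `BMO(𝓛_k)` with constant `Cf`: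
mean oscillation over balls below the critical radius, and average of `|f|` over balls of
at least the critical radius, are bounded by `Cf`.  The `BMO(𝓛_k)` norm of `f` is the least
such `Cf`. -/
def IsBMOL {α : Type*} [MeasurableSpace α] [PseudoMetricSpace α]
    (μ : Measure α) (ρ : α → ℝ) (f : α → ℝ) (Cf : ℝ) : Prop :=
  (∀ (x : α) (s : ℝ), 0 < s → s < ρ x →
     ⨍ y in Metric.ball x s, |f y - ⨍ z in Metric.ball x s, f z ∂μ| ∂μ ≤ Cf) ∧
  (∀ (x : α) (r : ℝ), ρ x ≤ r → ⨍ y in Metric.ball x r, |f y| ∂μ ≤ Cf)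

section JohnNirenberg

open Set Filter Topology

variable {α : Type*} [MeasurableSpace α] {μ : Measure α}

lemma setAverage_le_mul_setAverage {S T : Set α} {c : ℝ} {h : α → ℝ} (hST : S ⊆ T)
    (hS : 0 < μ.real S) (hT : 0 < μ.real T) (hc : μ.real T ≤ c * μ.real S)
    (h0 : ∀ x, 0 ≤ h x) (hi : IntegrableOn h T μ) :
    ⨍ x in S, h x ∂μ ≤ c * ⨍ x in T, h x ∂μ := by
  rw [setAverage_eq, setAverage_eq, smul_eq_mul, smul_eq_mul]
  have h1 : ∫ x in S, h x ∂μ ≤ ∫ x in T, h x ∂μ :=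
    setIntegral_mono_set hi (Eventually.of_forall h0) hST.eventuallyLE
  have h2 : 0 ≤ ∫ x in T, h x ∂μ := integral_nonneg h0
  have h3 : (μ.real S)⁻¹ ≤ c * (μ.real T)⁻¹ := by
    rw [← div_eq_mul_inv, inv_eq_one_div, div_le_div_iff₀ hS hT]
    linarith
  calc (μ.real S)⁻¹ * ∫ x in S, h x ∂μ ≤ (μ.real S)⁻¹ * ∫ x in T, h x ∂μ := by gcongr
    _ ≤ (c * (μ.real T)⁻¹) * ∫ x in T, h x ∂μ := by gcongr
    _ = _ := by ring

lemma abs_setAverage_sub_le {S : Set α} {f : α → ℝ} (a : ℝ) (hS : 0 < μ.real S)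
    (hi : IntegrableOn f S μ) :
    |(⨍ x in S, f x ∂μ) - a| ≤ ⨍ x in S, |f x - a| ∂μ := by
  have hfin : μ S ≠ ⊤ := fun h => by simp [Measure.real, h] at hS
  have h1 : (⨍ x in S, f x ∂μ) - a = ⨍ x in S, (f x - a) ∂μ := by
    rw [setAverage_eq, setAverage_eq, integral_sub hi (integrableOn_const hfin)]
    simp only [smul_eq_mul, integral_const, measureReal_restrict_apply_univ]
    field_simp
  rw [h1, setAverage_eq, setAverage_eq, smul_eq_mul, smul_eq_mul, abs_mul,
    abs_of_pos (inv_pos.2 hS)]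
  gcongr
  exact abs_integral_le_integral_abs

variable [PseudoMetricSpace α] [ProperSpace α] [BorelSpace α] [IsLocallyFiniteMeasure μ]

lemma isUnifLocDoublingMeasure_of_real_le {D : ℝ}
    (hD : ∀ x r, 0 < r → μ.real (closedBall x (2 * r)) ≤ D * μ.real (closedBall x r)) :
    IsUnifLocDoublingMeasure μ := by
  refine ⟨⟨D.toNNReal, ?_⟩⟩
  filter_upwards [self_mem_nhdsWithin] with r hr x
  have h1 := ENNReal.ofReal_le_ofReal (hD x r hr)
  rwa [ENNReal.ofReal_mul' measureReal_nonneg, ofReal_measureReal measure_closedBall_lt_top.ne,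
    ofReal_measureReal measure_closedBall_lt_top.ne] at h1

/-- Calderón–Zygmund type covering of the set where `f` is far from its mean on a ball. -/
lemma exists_covering_large_oscillation {D A : ℝ} (hA : 0 < A)
    (hpos : ∀ x r, 0 < r → 0 < μ.real (closedBall (x : α) r))
    (hD : ∀ x r, 0 < r → μ.real (closedBall x (2 * r)) ≤ D * μ.real (closedBall x r))
    {f : α → ℝ} (hf : LocallyIntegrable f μ)
    (hosc : ∀ x r, 0 < r →
      ⨍ y in closedBall x r, |f y - ⨍ z in closedBall x r, f z ∂μ| ∂μ ≤ A)
    (x₀ : α) {r : ℝ} (hr : 0 < r) :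
    ∃ (u : Set α) (s : α → ℝ), u.Countable ∧ (∀ i ∈ u, 0 < s i) ∧
      (∀ i ∈ u, |(⨍ z in closedBall i (s i), f z ∂μ) - ⨍ z in closedBall x₀ r, f z ∂μ| ≤
        (2 * D ^ 3 * (1 + D) + D) * A) ∧
      (∀ᵐ x ∂μ, x ∈ closedBall x₀ r →
        (2 * D ^ 3 * (1 + D) + D) * A < |f x - ⨍ z in closedBall x₀ r, f z ∂μ| →
        ∃ i ∈ u, x ∈ closedBall i (s i)) ∧
      ∑' i : u, μ (closedBall (i : α) (s i)) ≤ 2⁻¹ * μ (closedBall x₀ r) := by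
  have hint : ∀ x r, IntegrableOn f (closedBall x r) μ := fun x r =>
    hf.integrableOn_isCompact (isCompact_closedBall x r)
  have hintabs : ∀ x r c, IntegrableOn (fun y => |f y - c|) (closedBall x r) μ := fun x r c =>
    ((hint x r).sub (integrableOn_const measure_closedBall_lt_top.ne)).abs
  have := isUnifLocDoublingMeasure_of_real_le hD
  have hD1 : 1 ≤ D := by
    have h1 := hD x₀ r hr
    have h2 : μ.real (closedBall x₀ r) ≤ μ.real (closedBall x₀ (2 * r)) :=
      measureReal_mono (closedBall_subset_closedBall (by linarith)) measure_closedBall_lt_top.ne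
    have h3 := hpos x₀ r hr
    by_contra! h
    nlinarith
  have hmean : ∀ x r, 0 < r →
      |(⨍ z in closedBall x r, f z ∂μ) - ⨍ z in closedBall x (2 * r), f z ∂μ| ≤ D * A := by
    intro x r hr
    calc _ ≤ _ := abs_setAverage_sub_le _ (hpos x r hr) (hint x r)
      _ ≤ D * _ := setAverage_le_mul_setAverage (closedBall_subset_closedBall (by linarith))
          (hpos x r hr) (hpos x (2 * r) (by linarith)) (hD x r hr) (fun _ => abs_nonneg _)
          (hintabs _ _ _)
      _ ≤ D * A := by gcongr; exact hosc x (2 * r) (by linarith)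
  set a := ⨍ z in closedBall x₀ r, f z ∂μ with ha
  set L₀ : ℝ := 2 * D ^ 3 * (1 + D) * A with hL₀
  have hL₀pos : 0 < L₀ := by positivity
  set g : α → ℝ := fun x => |f x - a| with hg
  have hg0 : ∀ x, 0 ≤ g x := fun _ => abs_nonneg _
  have hgint : ∀ x r, IntegrableOn g (closedBall x r) μ := fun x r => hintabs x r a
  have hgloc : LocallyIntegrable g μ := by
    intro x
    exact ⟨closedBall x 1, closedBall_mem_nhds x one_pos, hgint x 1⟩
  -- the average of `g` over the doubled ball
  have hg2 : ⨍ x in closedBall x₀ (2 * r), g x ∂μ ≤ (1 + D) * A := by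
    set a' := ⨍ z in closedBall x₀ (2 * r), f z ∂μ with ha'
    have hp2 := hpos x₀ (2 * r) (by linarith)
    have h1 := hosc x₀ (2 * r) (by linarith)
    have h2 := hmean x₀ r hr
    rw [← ha'] at h1 h2
    rw [setAverage_eq, smul_eq_mul] at h1 ⊢
    have hi := hintabs x₀ (2 * r) a'
    have hcst : IntegrableOn (fun _ => D * A) (closedBall x₀ (2 * r)) μ :=
      integrableOn_const measure_closedBall_lt_top.ne
    have h3 : ∫ x in closedBall x₀ (2 * r), g x ∂μ ≤
        ∫ x in closedBall x₀ (2 * r), (|f x - a'| + D * A) ∂μ := by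
      refine integral_mono (hgint _ _) (hi.add hcst) fun x => ?_
      have h4 : f x - a = (f x - a') - (a - a') := by ring
      calc g x = |(f x - a') - (a - a')| := by rw [hg, ← h4]
        _ ≤ |f x - a'| + |a - a'| := abs_sub _ _
        _ ≤ _ := by gcongr
    have h5 : ∫ x in closedBall x₀ (2 * r), (|f x - a'| + D * A) ∂μ =
        ∫ x in closedBall x₀ (2 * r), |f x - a'| ∂μ +
          μ.real (closedBall x₀ (2 * r)) * (D * A) := by
      rw [integral_add hi hcst]
      simp
    rw [h5] at h3
    rw [inv_mul_le_iff₀ hp2] at h1 ⊢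
    nlinarith
  have hstart : ∀ x ∈ closedBall x₀ r, ⨍ y in closedBall x r, g y ∂μ ≤ L₀ := by
    intro x hx
    have hdist : dist x x₀ ≤ r := hx
    have h1 : closedBall x r ⊆ closedBall x₀ (2 * r) :=
      closedBall_subset_closedBall' (by linarith)
    have h2 : closedBall x₀ (2 * r) ⊆ closedBall x (2 * (2 * r)) :=
      closedBall_subset_closedBall' (by rw [dist_comm]; linarith)
    have h3 : μ.real (closedBall x₀ (2 * r)) ≤ D ^ 2 * μ.real (closedBall x r) := by
      calc _ ≤ μ.real (closedBall x (2 * (2 * r))) :=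
            measureReal_mono h2 measure_closedBall_lt_top.ne
        _ ≤ D * (D * μ.real (closedBall x r)) :=
            (hD x (2 * r) (by linarith)).trans (by gcongr; exact hD x r hr)
        _ = _ := by ring
    calc _ ≤ D ^ 2 * ⨍ y in closedBall x₀ (2 * r), g y ∂μ :=
          setAverage_le_mul_setAverage h1 (hpos x r hr) (hpos _ _ (by linarith)) h3 hg0 (hgint _ _)
      _ ≤ D ^ 2 * ((1 + D) * A) := by gcongr
      _ ≤ (2 * D) * (D ^ 2 * ((1 + D) * A)) := le_mul_of_one_le_left (by positivity) (by linarith)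
      _ = L₀ := by rw [hL₀]; ring
  -- stopping radii
  set E : Set α := {x | x ∈ closedBall x₀ r ∧ ∃ t, 0 < t ∧ t ≤ r / 2 ∧
    L₀ < ⨍ y in closedBall x t, g y ∂μ ∧ ⨍ y in closedBall x (2 * t), g y ∂μ ≤ L₀} with hE
  have hEae : ∀ᵐ x ∂μ, x ∈ closedBall x₀ r → L₀ < g x → x ∈ E := by
    filter_upwards [IsUnifLocDoublingMeasure.ae_tendsto_average μ hgloc 1] with x hx hxB hxg
    have hlim : Tendsto (fun j : ℕ => (1 / 2 : ℝ) ^ j * r) atTop (𝓝[>] 0) := by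
      refine tendsto_nhdsWithin_iff.2 ⟨?_, Eventually.of_forall fun j => ?_⟩
      · simpa using (tendsto_pow_atTop_nhds_zero_of_lt_one (r := (1 / 2 : ℝ)) (by norm_num)
          (by norm_num)).mul_const r
      · exact mul_pos (by positivity) hr
    have ht := hx (fun _ : ℕ => x) _ hlim (Eventually.of_forall fun j =>
      mem_closedBall_self (by positivity))
    have hex : ∃ j : ℕ, L₀ < ⨍ y in closedBall x ((1 / 2 : ℝ) ^ j * r), g y ∂μ :=
      (ht.eventually (lt_mem_nhds hxg)).exists
    classical
    have hj := Nat.find_spec hex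
    obtain ⟨m, hm⟩ : ∃ m, Nat.find hex = m + 1 := by
      refine Nat.exists_eq_succ_of_ne_zero fun h0 => ?_
      rw [h0] at hj
      have := hstart x hxB
      simp only [pow_zero, one_mul] at hj
      linarith
    have hmin := Nat.find_min hex (m := m) (by omega)
    rw [hm] at hj
    refine ⟨hxB, (1 / 2 : ℝ) ^ (m + 1) * r, by positivity, ?_, hj, ?_⟩
    · have : (1 / 2 : ℝ) ^ m ≤ 1 := pow_le_one₀ (by norm_num) (by norm_num)
      rw [pow_succ]
      nlinarith
    · have h2 : 2 * ((1 / 2 : ℝ) ^ (m + 1) * r) = (1 / 2 : ℝ) ^ m * r := by ring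
      rw [h2]
      exact not_lt.1 hmin
  have hEt : ∀ x, ∃ t, x ∈ E → 0 < t ∧ t ≤ r / 2 ∧
      L₀ < ⨍ y in closedBall x t, g y ∂μ ∧ ⨍ y in closedBall x (2 * t), g y ∂μ ≤ L₀ := by
    intro x
    by_cases hx : x ∈ E
    · obtain ⟨t, ht⟩ := hx.2
      exact ⟨t, fun _ => ht⟩
    · exact ⟨0, fun h => absurd h hx⟩
  choose t ht using hEt
  obtain ⟨u, huE, hdisj, hcov⟩ := Vitali.exists_disjoint_subfamily_covering_enlargement_closedBall
    E (fun x => x) t (r / 2) (fun x hx => (ht x hx).2.1) 4 (by norm_num)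
  have hucount : u.Countable := by
    refine hdisj.countable_of_nonempty_interior fun x hx => ?_
    exact ⟨x, ball_subset_interior_closedBall (mem_ball_self (ht x (huE hx)).1)⟩
  have h4 : ∀ x, 4 * t x = 2 * (2 * t x) := fun x => by ring
  refine ⟨u, fun x => 4 * t x, hucount, fun i hi => by linarith [(ht i (huE hi)).1], ?_, ?_, ?_⟩
  · intro i hi
    obtain ⟨h1, -, -, h2⟩ := ht i (huE hi)
    have h3 := hmean i (2 * t i) (by linarith)
    have h5 := (abs_setAverage_sub_le a (hpos i (2 * t i) (by linarith)) (hint _ _)).trans h2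
    rw [abs_sub_comm] at h3
    simp only [h4]
    calc _ ≤ _ := abs_sub_le _ (⨍ z in closedBall i (2 * t i), f z ∂μ) _
      _ ≤ D * A + L₀ := add_le_add h3 h5
      _ = _ := by rw [hL₀]; ring
  · filter_upwards [hEae] with x hx hxB hxg
    have hxE : x ∈ E := hx hxB (lt_of_le_of_lt (by rw [hL₀]; gcongr; linarith) hxg)
    obtain ⟨i, hi, hsub⟩ := hcov x hxE
    exact ⟨i, hi, hsub (mem_closedBall_self (ht x hxE).1.le)⟩
  · have hball : ∀ i : u, μ (closedBall (i : α) (4 * t i)) ≤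
        ENNReal.ofReal (D ^ 2 / L₀) * ∫⁻ y in closedBall (i : α) (t i), ENNReal.ofReal (g y) ∂μ := by
      intro ⟨i, hi⟩
      obtain ⟨h1, -, h2, -⟩ := ht i (huE hi)
      simp only [h4]
      rw [← ofReal_integral_eq_lintegral_ofReal (hgint _ _) (Eventually.of_forall hg0),
        ← ENNReal.ofReal_mul (by positivity),
        ← ofReal_measureReal (μ := μ) (s := closedBall i (2 * (2 * t i)))
          measure_closedBall_lt_top.ne]
      apply ENNReal.ofReal_le_ofReal
      rw [setAverage_eq, smul_eq_mul, lt_inv_mul_iff₀ (hpos i _ h1)] at h2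
      calc _ ≤ D * (D * μ.real (closedBall i (t i))) :=
            (hD i _ (by linarith)).trans (by gcongr; exact hD i _ h1)
        _ = D ^ 2 / L₀ * (μ.real (closedBall i (t i)) * L₀) := by field_simp
        _ ≤ _ := by gcongr
    have hsub : (⋃ i ∈ u, closedBall i (t i)) ⊆ closedBall x₀ (2 * r) := by
      refine iUnion₂_subset fun i hi => closedBall_subset_closedBall' ?_
      have h1 : dist i x₀ ≤ r := (huE hi).1
      linarith [(ht i (huE hi)).2.1]
    calc ∑' i : u, μ (closedBall (i : α) (4 * t i))
        ≤ ∑' i : u, ENNReal.ofReal (D ^ 2 / L₀) *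
            ∫⁻ y in closedBall (i : α) (t i), ENNReal.ofReal (g y) ∂μ :=
          ENNReal.tsum_le_tsum hball
      _ = ENNReal.ofReal (D ^ 2 / L₀) *
            ∫⁻ y in ⋃ i ∈ u, closedBall i (t i), ENNReal.ofReal (g y) ∂μ := by
          rw [ENNReal.tsum_mul_left,
            lintegral_biUnion hucount (fun _ _ => measurableSet_closedBall) hdisj]
      _ ≤ ENNReal.ofReal (D ^ 2 / L₀) *
            ∫⁻ y in closedBall x₀ (2 * r), ENNReal.ofReal (g y) ∂μ := by
          gcongr
      _ = ENNReal.ofReal (D ^ 2 / L₀ * ∫ y in closedBall x₀ (2 * r), g y ∂μ) := by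
          rw [← ofReal_integral_eq_lintegral_ofReal (hgint _ _) (Eventually.of_forall hg0),
            ENNReal.ofReal_mul (by positivity)]
      _ ≤ ENNReal.ofReal (2⁻¹ * μ.real (closedBall x₀ r)) := by
          apply ENNReal.ofReal_le_ofReal
          rw [setAverage_eq, smul_eq_mul, inv_mul_le_iff₀ (hpos _ _ (by linarith))] at hg2
          calc _ ≤ D ^ 2 / L₀ * ((D * μ.real (closedBall x₀ r)) * ((1 + D) * A)) := by
                gcongr
                refine hg2.trans ?_
                gcongr
                exact hD x₀ r hr
            _ = _ := by rw [hL₀]; field_simp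
      _ = 2⁻¹ * μ (closedBall x₀ r) := by
          rw [ENNReal.ofReal_mul (by norm_num), ofReal_measureReal measure_closedBall_lt_top.ne,
            ENNReal.ofReal_inv_of_pos (by norm_num)]
          norm_num

/-- **John–Nirenberg inequality** for doubling measures, in geometric form. -/
lemma measure_oscillation_gt_le {D A : ℝ} (hA : 0 < A)
    (hpos : ∀ x r, 0 < r → 0 < μ.real (closedBall (x : α) r))
    (hD : ∀ x r, 0 < r → μ.real (closedBall x (2 * r)) ≤ D * μ.real (closedBall x r))
    {f : α → ℝ} (hf : LocallyIntegrable f μ)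
    (hosc : ∀ x r, 0 < r →
      ⨍ y in closedBall x r, |f y - ⨍ z in closedBall x r, f z ∂μ| ∂μ ≤ A) (m : ℕ) :
    ∀ (x₀ : α) (r : ℝ), 0 < r →
      μ {x | x ∈ closedBall x₀ r ∧ m * ((2 * D ^ 3 * (1 + D) + D) * A) <
        |f x - ⨍ z in closedBall x₀ r, f z ∂μ|} ≤ 2⁻¹ ^ m * μ (closedBall x₀ r) := by
  induction m with
  | zero =>
    intro x₀ r hr
    simpa using measure_mono fun x hx => hx.1
  | succ m ih =>
    intro x₀ r hr
    obtain ⟨u, s, hu, hs, hmean, hcov, hsum⟩ :=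
      exists_covering_large_oscillation hA hpos hD hf hosc x₀ hr
    have := hu.to_subtype
    set L := (2 * D ^ 3 * (1 + D) + D) * A with hL
    have hL0 : 0 ≤ L := by
      have h1 := hD x₀ r hr
      have h2 : 0 ≤ D := by
        by_contra! h
        nlinarith [hpos x₀ r hr, hpos x₀ (2 * r) (by linarith)]
      positivity
    calc _ ≤ μ (⋃ i : u, {x | x ∈ closedBall (i : α) (s i) ∧
          m * L < |f x - ⨍ z in closedBall (i : α) (s i), f z ∂μ|}) := by
          refine measure_mono_ae ?_
          filter_upwards [hcov] with x hx hxm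
          obtain ⟨hxB, hxL⟩ := hxm
          push_cast at hxL
          have hmL : 0 ≤ m * L := by positivity
          obtain ⟨i, hi, hxi⟩ := hx hxB (by linarith)
          refine mem_iUnion.2 ⟨⟨i, hi⟩, hxi, ?_⟩
          have h1 := hmean i hi
          have h2 := abs_sub_le (f x) (⨍ z in closedBall i (s i), f z ∂μ)
            (⨍ z in closedBall x₀ r, f z ∂μ)
          simp only
          linarith
      _ ≤ ∑' i : u, μ {x | x ∈ closedBall (i : α) (s i) ∧
          m * L < |f x - ⨍ z in closedBall (i : α) (s i), f z ∂μ|} := measure_iUnion_le _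
      _ ≤ ∑' i : u, 2⁻¹ ^ m * μ (closedBall (i : α) (s i)) :=
          ENNReal.tsum_le_tsum fun i => ih i (s i) (hs i i.2)
      _ = 2⁻¹ ^ m * ∑' i : u, μ (closedBall (i : α) (s i)) := ENNReal.tsum_mul_left
      _ ≤ 2⁻¹ ^ m * (2⁻¹ * μ (closedBall x₀ r)) := by gcongr
      _ = _ := by rw [pow_succ, mul_assoc]

end JohnNirenberg

section DistributionToMoment

open Set

lemma summable_add_one_rpow_mul_geometric (p : ℝ) :
    Summable fun m : ℕ => ((m : ℝ) + 1) ^ p * (1 / 2 : ℝ) ^ m := by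
  have h1 := (summable_nat_add_iff 1).2
    (summable_pow_mul_geometric_of_norm_lt_one (R := ℝ) ⌈p⌉₊ (r := 1 / 2) (by norm_num))
  refine Summable.of_nonneg_of_le (fun m => by positivity) (fun m => ?_) (h1.mul_left 2)
  have h2 : ((m : ℝ) + 1) ^ p ≤ ((m : ℝ) + 1) ^ ⌈p⌉₊ := by
    rw [← Real.rpow_natCast]
    exact Real.rpow_le_rpow_of_exponent_le (by linarith [(m.cast_nonneg : (0 : ℝ) ≤ m)])
      (Nat.le_ceil p)
  calc _ ≤ ((m : ℝ) + 1) ^ ⌈p⌉₊ * (1 / 2 : ℝ) ^ m := by gcongr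
    _ = _ := by push_cast; ring

variable {α : Type*} [MeasurableSpace α] {μ : Measure α}

/-- Geometric decay of the distribution function bounds the `p`-th moments. -/
lemma setAverage_rpow_le_of_geometric_decay {B : Set α} (hBm : MeasurableSet B)
    (hB : 0 < μ.real B) {h : α → ℝ} (h0 : ∀ x, 0 ≤ h x) {p L : ℝ} (hp : 0 < p) (hL : 0 < L)
    (hdecay : ∀ m : ℕ, μ {x | x ∈ B ∧ m * L < h x} ≤ 2 * 2⁻¹ ^ m * μ B) :
    ⨍ x in B, h x ^ p ∂μ ≤ L ^ p * (2 * ∑' m : ℕ, ((m : ℝ) + 1) ^ p * (1 / 2 : ℝ) ^ m) := by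
  have hfin : μ B ≠ ⊤ := fun h => by simp [Measure.real, h] at hB
  set T : ℕ → Set α := fun m => toMeasurable μ {x | x ∈ B ∧ m * L < h x} with hT
  have hTm : ∀ m, MeasurableSet (T m) := fun m => measurableSet_toMeasurable _ _
  have hpt : ∀ x ∈ B, ENNReal.ofReal (h x ^ p) ≤
      ∑' m : ℕ, (T m).indicator (fun _ => ENNReal.ofReal (((m + 1) * L) ^ p)) x := by
    intro x hxB
    rcases (h0 x).eq_or_lt with hx | hx
    · simp [← hx, Real.zero_rpow hp.ne']
    obtain ⟨m, hm⟩ : ∃ m, ⌈h x / L⌉₊ = m + 1 :=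
      Nat.exists_eq_succ_of_ne_zero (Nat.ceil_pos.2 (by positivity)).ne'
    have h1 : h x ≤ (m + 1) * L := by
      have := Nat.le_ceil (h x / L)
      rw [hm, div_le_iff₀ hL] at this
      exact_mod_cast this
    have h2 : m * L < h x := by
      rw [← lt_div_iff₀ hL]
      exact Nat.lt_ceil.1 (by omega)
    refine le_trans ?_ (ENNReal.le_tsum m)
    have h3 : x ∈ T m := subset_toMeasurable _ _ ⟨hxB, h2⟩
    rw [indicator_of_mem h3]
    exact ENNReal.ofReal_le_ofReal (Real.rpow_le_rpow hx.le h1 hp.le)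
  have hsum := summable_add_one_rpow_mul_geometric p
  set S := ∑' m : ℕ, ((m : ℝ) + 1) ^ p * (1 / 2 : ℝ) ^ m with hS
  have hlin : ∫⁻ x in B, ENNReal.ofReal (h x ^ p) ∂μ ≤
      ENNReal.ofReal (L ^ p * (2 * S) * μ.real B) := by
    calc _ ≤ ∫⁻ x in B, ∑' m : ℕ,
            (T m).indicator (fun _ => ENNReal.ofReal (((m + 1) * L) ^ p)) x ∂μ :=
          setLIntegral_mono' hBm hpt
      _ = ∑' m : ℕ, ∫⁻ x in B,
            (T m).indicator (fun _ => ENNReal.ofReal (((m + 1) * L) ^ p)) x ∂μ :=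
          lintegral_tsum fun m => (measurable_const.indicator (hTm m)).aemeasurable
      _ ≤ ∑' m : ℕ, ENNReal.ofReal
            (L ^ p * (2 * (((m : ℝ) + 1) ^ p * (1 / 2 : ℝ) ^ m)) * μ.real B) := by
          refine ENNReal.tsum_le_tsum fun m => ?_
          rw [lintegral_indicator_const (hTm m)]
          have h1 : μ.restrict B (T m) ≤ ENNReal.ofReal (2 * (1 / 2 : ℝ) ^ m * μ.real B) := by
            refine (Measure.restrict_apply_le _ _).trans ?_
            rw [measure_toMeasurable, ENNReal.ofReal_mul (by positivity),
              ofReal_measureReal hfin, ENNReal.ofReal_mul (by norm_num),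
              ENNReal.ofReal_pow (by norm_num), one_div, ENNReal.ofReal_inv_of_pos (by norm_num)]
            simpa using hdecay m
          calc _ ≤ ENNReal.ofReal (((m + 1) * L) ^ p) *
                ENNReal.ofReal (2 * (1 / 2 : ℝ) ^ m * μ.real B) := by gcongr
            _ = _ := by
              rw [← ENNReal.ofReal_mul (by positivity), Real.mul_rpow (by positivity) hL.le]
              congr 1
              ring
      _ = _ := by
          rw [← ENNReal.ofReal_tsum_of_nonneg (fun m => by positivity)
            (((hsum.mul_left 2).mul_left _).mul_right _), tsum_mul_right, tsum_mul_left,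
            tsum_mul_left]
  have hS0 : 0 ≤ S := tsum_nonneg fun m => by positivity
  rw [setAverage_eq, smul_eq_mul, inv_mul_le_iff₀ hB]
  calc ∫ x in B, h x ^ p ∂μ ≤ ‖∫ x in B, h x ^ p ∂μ‖ := le_abs_self _
    _ ≤ (∫⁻ x in B, ENNReal.ofReal ‖h x ^ p‖ ∂μ).toReal := norm_integral_le_lintegral_norm _
    _ = (∫⁻ x in B, ENNReal.ofReal (h x ^ p) ∂μ).toReal := by
        simp_rw [Real.norm_of_nonneg (Real.rpow_nonneg (h0 _) p)]
    _ ≤ L ^ p * (2 * S) * μ.real B :=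
        ENNReal.toReal_le_of_le_ofReal (by positivity) hlin
    _ = _ := by ring

end DistributionToMoment

section ProductWeight

variable {E : Type*} [NormedAddCommGroup E] [InnerProductSpace ℝ E]

/-- Every ball contains a smaller ball of comparable radius which stays away from finitely many
hyperplanes. -/
lemma exists_closedBall_far_from_hyperplanes (P : Finset E) (hnorm : ∀ ζ ∈ P, ‖ζ‖ ≤ 3 / 2)
    (b : E) (hb : ∀ ζ ∈ P, 0 < ⟪ζ, b⟫) :
    ∃ ε > 0, ∃ c > 0, ∀ (x : E) (r : ℝ), 0 < r → ∃ y₀, closedBall y₀ (ε * r) ⊆ closedBall x r ∧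
      ∀ ζ ∈ P, ∀ y ∈ closedBall y₀ (ε * r), c * (|⟪ζ, x⟫| + r) ≤ |⟪ζ, y⟫| := by
  obtain ⟨β, hβ0, hβ⟩ : ∃ β > 0, ∀ ζ ∈ P, β ≤ ⟪ζ, b⟫ := by
    rcases P.eq_empty_or_nonempty with rfl | hP
    · exact ⟨1, one_pos, by simp⟩
    · obtain ⟨ζ₀, h₀, hmin⟩ := P.exists_min_image (fun ζ => ⟪ζ, b⟫) hP
      exact ⟨⟪ζ₀, b⟫, hb ζ₀ h₀, hmin⟩
  obtain ⟨δ, hδ0, hδ⟩ : ∃ δ > 0, P.card * δ * ‖b‖ ≤ 1 / 2 := by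
    refine ⟨1 / (2 * (P.card * ‖b‖ + 1)), by positivity, ?_⟩
    rw [mul_one_div, div_mul_eq_mul_div, div_le_div_iff₀ (by positivity) (by positivity)]
    linarith
  obtain ⟨c', hc', hc0⟩ : ∃ c', c' = δ * β / 4 ∧ 0 < c' := ⟨_, rfl, by positivity⟩
  refine ⟨min (c' / 2) (1 / 2), by positivity, (1 + 3 / c')⁻¹, by positivity, fun x r hr => ?_⟩
  obtain ⟨j, hj, hgood⟩ : ∃ j ∈ Finset.range (P.card + 1),
      ∀ ζ ∈ P, 2 * c' * r ≤ |⟪ζ, x + (j * δ * r) • b⟫| := by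
    by_contra! hbad
    choose! Z hZ hZs using hbad
    obtain ⟨i, hi, j, hj, hij, hZij⟩ := Finset.exists_ne_map_eq_of_card_lt_of_maps_to
      (s := Finset.range (P.card + 1)) (t := P) (by simp) (f := Z) (fun i hi => hZ i hi)
    wlog hlt : j < i generalizing i j
    · exact this j hj i hi hij.symm hZij.symm (by omega)
    have h1 := hZs i hi
    have h2 := hZs j hj
    rw [← hZij] at h2
    have h3 := hβ _ (hZ i hi)
    simp only [inner_add_right, inner_smul_right] at h1 h2
    rw [abs_lt] at h1 h2
    have h4 : (j : ℝ) + 1 ≤ i := by exact_mod_cast hlt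
    have h5 : δ * r * β ≤ (i - j) * (δ * r * ⟪Z i, b⟫) :=
      calc δ * r * β ≤ 1 * (δ * r * ⟪Z i, b⟫) := by rw [one_mul]; gcongr
        _ ≤ _ := by
          have : 0 ≤ δ * r * ⟪Z i, b⟫ := mul_nonneg (by positivity) (hβ0.le.trans h3)
          gcongr
          linarith
    have h6 : 4 * c' * r = δ * r * β := by rw [hc']; ring
    linarith [h1.2, h2.1]
  have hjle : (j : ℝ) ≤ P.card := by
    exact_mod_cast Nat.lt_succ_iff.1 (Finset.mem_range.1 hj)
  have hsub : closedBall (x + (j * δ * r) • b) (min (c' / 2) (1 / 2) * r) ⊆ closedBall x r := by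
    refine closedBall_subset_closedBall' ?_
    rw [dist_self_add_left, norm_smul, Real.norm_of_nonneg (by positivity)]
    have h1 : min (c' / 2) (1 / 2) * r ≤ 1 / 2 * r := by gcongr; exact min_le_right _ _
    have h2 : j * δ * r * ‖b‖ ≤ 1 / 2 * r :=
      calc j * δ * r * ‖b‖ ≤ P.card * δ * r * ‖b‖ := by gcongr
        _ = (P.card * δ * ‖b‖) * r := by ring
        _ ≤ _ := by gcongr
    linarith
  refine ⟨_, hsub, fun ζ hζ y hy => ?_⟩
  have hin : ∀ (u v : E) (s : ℝ), dist u v ≤ s → |⟪ζ, u⟫| ≤ |⟪ζ, v⟫| + 3 / 2 * s := by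
    intro u v s huv
    have h1 : ⟪ζ, u⟫ = ⟪ζ, v⟫ + ⟪ζ, u - v⟫ := by rw [← inner_add_right]; simp
    rw [h1]
    refine (abs_add_le _ _).trans ?_
    gcongr
    refine (abs_real_inner_le_norm _ _).trans ?_
    rw [← dist_eq_norm]
    gcongr
    exact hnorm ζ hζ
  have h1 := hin _ y _ ((dist_comm _ _).trans_le (mem_closedBall.1 hy))
  have h2 := hgood ζ hζ
  have h3 : min (c' / 2) (1 / 2) * r ≤ c' / 2 * r := by gcongr; exact min_le_left _ _
  have h4 := hin x y r (by rw [dist_comm]; exact hsub hy)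
  have h5 : c' * r ≤ |⟪ζ, y⟫| := by nlinarith
  have h6 : r ≤ |⟪ζ, y⟫| / c' := by rw [le_div_iff₀ hc0]; linarith
  rw [inv_mul_le_iff₀ (by positivity)]
  calc |⟪ζ, x⟫| + r ≤ |⟪ζ, y⟫| + 3 * (|⟪ζ, y⟫| / c') := by linarith
    _ = _ := by ring

variable [MeasurableSpace E] [BorelSpace E] [FiniteDimensional ℝ E]

/-- Measures whose density is a product of nonnegative powers of linear functionals, all positive
at a common point, are doubling. -/
lemma exists_doubling_of_prod_rpow_inner (P : Finset E) (hnorm : ∀ ζ ∈ P, ‖ζ‖ ≤ 3 / 2)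
    (b : E) (hb : ∀ ζ ∈ P, 0 < ⟪ζ, b⟫) (κ : E → ℝ) (hκ : ∀ ζ ∈ P, 0 ≤ κ ζ)
    {ν μ : Measure E} [ν.IsAddHaarMeasure]
    (hμ : μ = ν.withDensity fun x => ENNReal.ofReal (∏ ζ ∈ P, |⟪ζ, x⟫| ^ κ ζ)) :
    (∀ x r, 0 < r → 0 < μ.real (closedBall x r)) ∧
    ∃ D : ℝ, ∀ x r, 0 < r → μ.real (closedBall x (2 * r)) ≤ D * μ.real (closedBall x r) := by
  obtain ⟨ε, hε, c, hc, hball⟩ := exists_closedBall_far_from_hyperplanes P hnorm b hb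
  set W : E → ℝ → ℝ := fun x r => ∏ ζ ∈ P, (|⟪ζ, x⟫| + r) ^ κ ζ with hW
  set C₁ : ℝ := ∏ ζ ∈ P, (3 : ℝ) ^ κ ζ with hC₁
  set C₂ : ℝ := ∏ ζ ∈ P, c ^ κ ζ with hC₂
  have hWpos : ∀ x r, 0 < r → 0 < W x r := fun x r hr =>
    Finset.prod_pos fun ζ _ => by positivity
  have hC₁pos : 0 < C₁ := Finset.prod_pos fun ζ _ => by positivity
  have hC₂pos : 0 < C₂ := Finset.prod_pos fun ζ _ => by positivity
  have hupper : ∀ x r, 0 < r → μ (closedBall x (2 * r)) ≤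
      ENNReal.ofReal (C₁ * W x r) * ν (closedBall x (2 * r)) := by
    intro x r hr
    rw [hμ, withDensity_apply _ measurableSet_closedBall, ← setLIntegral_const]
    refine setLIntegral_mono' measurableSet_closedBall fun y hy => ?_
    refine ENNReal.ofReal_le_ofReal ?_
    rw [hC₁, hW, ← Finset.prod_mul_distrib]
    refine Finset.prod_le_prod (fun ζ _ => by positivity) fun ζ hζ => ?_
    rw [← Real.mul_rpow (by norm_num) (by positivity)]
    refine Real.rpow_le_rpow (abs_nonneg _) ?_ (hκ ζ hζ)
    have h1 : ⟪ζ, y⟫ = ⟪ζ, x⟫ + ⟪ζ, y - x⟫ := by rw [← inner_add_right]; simp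
    have h2 : |⟪ζ, y - x⟫| ≤ 3 / 2 * (2 * r) := by
      refine (abs_real_inner_le_norm _ _).trans ?_
      rw [← dist_eq_norm]
      gcongr
      · exact hnorm ζ hζ
      · exact hy
    rw [h1]
    have h3 := abs_add_le ⟪ζ, x⟫ ⟪ζ, y - x⟫
    have h4 := abs_nonneg ⟪ζ, x⟫
    linarith
  have hfin : ∀ x r, 0 < r → μ (closedBall x r) ≠ ⊤ := by
    intro x r hr
    have h1 := hupper x (r / 2) (by linarith)
    rw [mul_div_cancel₀ r two_ne_zero] at h1
    exact (h1.trans_lt (ENNReal.mul_lt_top ENNReal.ofReal_lt_top measure_closedBall_lt_top)).ne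
  have hlower : ∀ x r, 0 < r → ∃ y₀, C₂ * W x r * ν.real (closedBall y₀ (ε * r)) ≤
      μ.real (closedBall x r) := by
    intro x r hr
    obtain ⟨y₀, hsub, hy₀⟩ := hball x r hr
    refine ⟨y₀, ?_⟩
    have h1 : ENNReal.ofReal (C₂ * W x r) * ν (closedBall y₀ (ε * r)) ≤ μ (closedBall x r) := by
      refine le_trans ?_ (measure_mono hsub)
      rw [hμ, withDensity_apply _ measurableSet_closedBall, ← setLIntegral_const]
      refine setLIntegral_mono' measurableSet_closedBall fun y hy => ?_
      refine ENNReal.ofReal_le_ofReal ?_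
      rw [hC₂, hW, ← Finset.prod_mul_distrib]
      refine Finset.prod_le_prod (fun ζ _ => by positivity) fun ζ hζ => ?_
      rw [← Real.mul_rpow hc.le (by positivity)]
      exact Real.rpow_le_rpow (by positivity) (hy₀ ζ hζ y hy) (hκ ζ hζ)
    have h2 := ENNReal.toReal_mono (hfin x r hr) h1
    rwa [ENNReal.toReal_mul, ENNReal.toReal_ofReal
      (mul_nonneg hC₂pos.le (hWpos x r hr).le)] at h2
  set d := Module.finrank ℝ E
  set v : ℝ := (ν (ball 0 1)).toReal with hv
  have hvpos : 0 < v := ENNReal.toReal_pos (measure_ball_pos ν 0 one_pos).ne'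
    measure_ball_lt_top.ne
  have hvol : ∀ x r, 0 < r → ν.real (closedBall x r) = r ^ d * v := by
    intro x r hr
    rw [Measure.real, Measure.addHaar_closedBall ν x hr.le, ENNReal.toReal_mul,
      ENNReal.toReal_ofReal (by positivity)]
  refine ⟨fun x r hr => ?_, C₁ * 2 ^ d / (C₂ * ε ^ d), fun x r hr => ?_⟩
  · obtain ⟨y₀, h⟩ := hlower x r hr
    rw [hvol _ _ (by positivity)] at h
    have := hWpos x r hr
    exact lt_of_lt_of_le (by positivity) h
  · obtain ⟨y₀, h⟩ := hlower x r hr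
    rw [hvol _ _ (by positivity)] at h
    have hWp := hWpos x r hr
    have h1 := ENNReal.toReal_mono
      (ENNReal.mul_ne_top ENNReal.ofReal_ne_top measure_closedBall_lt_top.ne) (hupper x r hr)
    rw [ENNReal.toReal_mul, ENNReal.toReal_ofReal (by positivity), ← measureReal_def,
      ← measureReal_def, hvol _ _ (by positivity)] at h1
    calc _ ≤ C₁ * W x r * ((2 * r) ^ d * v) := h1
      _ = C₁ * 2 ^ d / (C₂ * ε ^ d) * (C₂ * W x r * ((ε * r) ^ d * v)) := by
        rw [mul_pow, mul_pow]
        field_simp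
      _ ≤ _ := by gcongr

end ProductWeight

section LargeBalls

open Set Filter Topology

variable {α : Type*} [MeasurableSpace α] [PseudoMetricSpace α] [ProperSpace α] [BorelSpace α]
  {μ : Measure α} [IsLocallyFiniteMeasure μ]

/-- Functions in `BMO` adapted to a critical radius have mean oscillation at most twice the
constant on every ball. -/
lemma IsBMOL.setAverage_abs_sub_le {ρ f : α → ℝ} {A : ℝ} (hA : 0 ≤ A)
    (hpos : ∀ x r, 0 < r → 0 < μ.real (closedBall (x : α) r))
    (hae : ∀ (x : α) r, 0 < r → closedBall x r =ᵐ[μ] ball x r)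
    (hf : LocallyIntegrable f μ) (h : IsBMOL μ ρ f A) (x : α) (r : ℝ) (hr : 0 < r) :
    ⨍ y in closedBall x r, |f y - ⨍ z in closedBall x r, f z ∂μ| ∂μ ≤ 2 * A := by
  rcases lt_or_ge r (ρ x) with hlt | hge
  · have := h.1 x r hr hlt
    rw [setAverage_congr (hae x r hr), setAverage_congr (hae x r hr)]
    linarith
  · have h1 := h.2 x r hge
    rw [← setAverage_congr (hae x r hr)] at h1
    have hi : IntegrableOn f (closedBall x r) μ :=
      hf.integrableOn_isCompact (isCompact_closedBall x r)
    have hp := hpos x r hr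
    have h2 := abs_setAverage_sub_le 0 hp hi
    simp only [sub_zero] at h2
    set a := ⨍ z in closedBall x r, f z ∂μ
    have hcst : ∀ c : ℝ, IntegrableOn (fun _ => c) (closedBall x r) μ := fun c =>
      integrableOn_const measure_closedBall_lt_top.ne
    have h3 : ∫ y in closedBall x r, |f y - a| ∂μ ≤ ∫ y in closedBall x r, (|f y| + A) ∂μ :=
      integral_mono (hi.sub (hcst a)).abs (hi.abs.add (hcst A)) fun y =>
        (abs_sub _ _).trans (by gcongr; linarith)
    have h4 : ∫ y in closedBall x r, (|f y| + A) ∂μ =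
        ∫ y in closedBall x r, |f y| ∂μ + μ.real (closedBall x r) * A := by
      rw [integral_add hi.abs (hcst A)]
      simp
    rw [setAverage_eq, smul_eq_mul, inv_mul_le_iff₀ hp] at h1 ⊢
    linarith

/-- Uniform `L^p` averages over balls above the critical radius, for doubling measures. -/
lemma exists_Lp_bound_of_isBMOL {D : ℝ} (hpos : ∀ x r, 0 < r → 0 < μ.real (closedBall (x : α) r))
    (hD0 : 0 < D)
    (hD : ∀ x r, 0 < r → μ.real (closedBall x (2 * r)) ≤ D * μ.real (closedBall x r))
    (hae : ∀ (x : α) r, 0 < r → closedBall x r =ᵐ[μ] ball x r)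
    {ρ : α → ℝ} (hρ : ∀ x, 0 < ρ x) {p : ℝ} (hp : 0 < p) :
    ∃ C : ℝ, 0 < C ∧ ∀ f : α → ℝ, LocallyIntegrable f μ → ∀ A : ℝ, 0 ≤ A → IsBMOL μ ρ f A →
      ∀ (x₀ : α) (r : ℝ), ρ x₀ ≤ r → (⨍ y in ball x₀ r, |f y| ^ p ∂μ) ^ (1 / p) ≤ C * A := by
  set c : ℝ := (2 * D ^ 3 * (1 + D) + D) * 2 + 1 with hc
  have hc0 : 0 < c := by positivity
  set S : ℝ := 2 * ∑' m : ℕ, ((m : ℝ) + 1) ^ p * (1 / 2 : ℝ) ^ m with hS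
  have hS0 : 0 < S := by
    refine mul_pos two_pos ?_
    exact (summable_add_one_rpow_mul_geometric p).tsum_pos (fun m => by positivity) 0 (by simp)
  refine ⟨c * S ^ (1 / p), by positivity, fun f hf A hA hfA x₀ r hr => ?_⟩
  have hr0 : 0 < r := (hρ x₀).trans_le hr
  have key : ∀ A' : ℝ, A < A' →
      (⨍ y in ball x₀ r, |f y| ^ p ∂μ) ^ (1 / p) ≤ c * S ^ (1 / p) * A' := by
    intro A' hAA'
    have hA' : 0 < A' := hA.trans_lt hAA'
    have hosc : ∀ x r, 0 < r →
        ⨍ y in closedBall x r, |f y - ⨍ z in closedBall x r, f z ∂μ| ∂μ ≤ 2 * A' :=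
      fun x r hr => (hfA.setAverage_abs_sub_le hA hpos hae hf x r hr).trans (by linarith)
    have hJN := fun m : ℕ =>
      measure_oscillation_gt_le (by positivity) hpos hD hf hosc m x₀ r hr0
    have hmean : |⨍ z in closedBall x₀ r, f z ∂μ| ≤ A' := by
      have h1 := abs_setAverage_sub_le 0 (hpos x₀ r hr0)
        (hf.integrableOn_isCompact (isCompact_closedBall x₀ r))
      have h2 := hfA.2 x₀ r hr
      rw [← setAverage_congr (hae x₀ r hr0)] at h2
      simp only [sub_zero] at h1
      linarith
    have hdecay : ∀ m : ℕ, μ {x | x ∈ closedBall x₀ r ∧ m * (c * A') < |f x|} ≤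
        2 * 2⁻¹ ^ m * μ (closedBall x₀ r) := by
      intro m
      rcases m with _ | m
      · calc _ ≤ μ (closedBall x₀ r) := measure_mono fun x hx => hx.1
          _ ≤ 2 * μ (closedBall x₀ r) := le_mul_of_one_le_left (by positivity) (by norm_num)
          _ = _ := by simp
      · have h1 : (2 : ℝ≥0∞) * 2⁻¹ ^ (m + 1) = 2⁻¹ ^ m := by
          rw [pow_succ, mul_comm, mul_assoc, ENNReal.inv_mul_cancel (by norm_num) (by norm_num),
            mul_one]
        rw [h1]
        refine (measure_mono ?_).trans (hJN m)
        rintro x ⟨hxB, h2⟩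
        refine ⟨hxB, ?_⟩
        have h3 : |f x| ≤ |f x - ⨍ z in closedBall x₀ r, f z ∂μ| +
            |⨍ z in closedBall x₀ r, f z ∂μ| := by
          simpa using abs_add_le (f x - ⨍ z in closedBall x₀ r, f z ∂μ)
            (⨍ z in closedBall x₀ r, f z ∂μ)
        have h4 : ((m + 1 : ℕ) : ℝ) * (c * A') =
            m * ((2 * D ^ 3 * (1 + D) + D) * (2 * A')) + m * A' +
              (2 * D ^ 3 * (1 + D) + D) * (2 * A') + A' := by
          rw [hc]; push_cast; ring
        have h5 : 0 ≤ m * A' := by positivity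
        have h6 : 0 ≤ (2 * D ^ 3 * (1 + D) + D) * (2 * A') := by positivity
        linarith
    have h1 := setAverage_rpow_le_of_geometric_decay measurableSet_closedBall (hpos x₀ r hr0)
      (fun x => abs_nonneg (f x)) hp (mul_pos hc0 hA') hdecay
    rw [← hS, setAverage_congr (hae x₀ r hr0)] at h1
    have h0 : 0 ≤ ⨍ y in ball x₀ r, |f y| ^ p ∂μ := by
      rw [setAverage_eq, smul_eq_mul]
      exact mul_nonneg (inv_nonneg.2 measureReal_nonneg)
        (integral_nonneg fun y => Real.rpow_nonneg (abs_nonneg _) p)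
    calc _ ≤ ((c * A') ^ p * S) ^ (1 / p) := Real.rpow_le_rpow h0 h1 (by positivity)
      _ = c * A' * S ^ (1 / p) := by
        rw [Real.mul_rpow (by positivity) hS0.le, ← Real.rpow_mul (by positivity),
          mul_one_div_cancel hp.ne', Real.rpow_one]
      _ = _ := by ring
  have hlim : Tendsto (fun A' => c * S ^ (1 / p) * A') (𝓝[>] A) (𝓝 (c * S ^ (1 / p) * A)) :=
    (tendsto_id.const_mul _).mono_left nhdsWithin_le_nhds
  exact ge_of_tendsto hlim (eventually_mem_nhdsWithin.mono key)

end LargeBalls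

/-- For each `p ∈ [1, ∞)` there is `C* > 0` such that for every `f ∈ BMO(𝓛_k)` and every
ball `B = B(x₀, r)` with `r ≥ ρ_k(x₀)`, `(ω_k(B)⁻¹ ∫_B |f|^p dω_k)^(1/p) ≤ C* ‖f‖_(BMO(𝓛_k))`. -/
theorem bmoL_Lp_bound_large_balls
    (n : ℕ) (hn : 0 < n)
    (Rs Rp : Finset (EuclideanSpace ℝ (Fin n)))
    (hRs0 : (0 : EuclideanSpace ℝ (Fin n)) ∉ Rs)
    (hRsnorm : ∀ ζ ∈ Rs, ⟪ζ, ζ⟫ = (2 : ℝ))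
    (hRsrefl : ∀ ζ ∈ Rs, ∀ η ∈ Rs, η - ⟪η, ζ⟫ • ζ ∈ Rs)
    (hRsline : ∀ ζ ∈ Rs, ∀ c : ℝ, c • ζ ∈ Rs → c = 1 ∨ c = -1)
    (b : EuclideanSpace ℝ (Fin n))
    (hRpdef : ∀ ζ ∈ Rs, (ζ ∈ Rp ↔ 0 < ⟪ζ, b⟫)) (hRpsub : Rp ⊆ Rs)
    (k : EuclideanSpace ℝ (Fin n) → ℝ)
    (hk0 : ∀ ζ ∈ Rs, 0 ≤ k ζ)
    (hkinv : ∀ ζ ∈ Rs, ∀ η ∈ Rs, k (η - ⟪η, ζ⟫ • ζ) = k η)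
    (w : EuclideanSpace ℝ (Fin n) → ℝ)
    (hw : ∀ x, w x = ∏ ζ ∈ Rp, |⟪ζ, x⟫| ^ (2 * k ζ))
    (γ : ℝ) (hγ : γ = ∑ ζ ∈ Rp, k ζ)
    (μ : Measure (EuclideanSpace ℝ (Fin n)))
    (hμ : μ = volume.withDensity (fun x => ENNReal.ofReal (w x)))
    (V : EuclideanSpace ℝ (Fin n) → ℝ)
    (hV0 : ∀ x, 0 ≤ V x)
    (hVloc : LocallyIntegrable V μ)
    (hVne : ¬ (∀ᵐ x ∂μ, V x = 0))
    (q : ℝ) (hq : max 1 (((n : ℝ) + 2 * γ) / 2) < q)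
    (C_RH : ℝ) (hC_RH : 0 < C_RH)
    (hRH : ∀ (x : EuclideanSpace ℝ (Fin n)) (r : ℝ), 0 < r →
      (⨍ y in Metric.ball x r, V y ^ q ∂μ) ^ (1 / q) ≤
        C_RH * ⨍ y in Metric.ball x r, V y ∂μ)
    (ρ : EuclideanSpace ℝ (Fin n) → ℝ)
    (hρdef : ∀ x, ρ x = sSup {r : ℝ | 0 < r ∧
      r ^ 2 / (μ (Metric.ball x r)).toReal * ∫ y in Metric.ball x r, V y ∂μ ≤ 1})
    (hρpos : ∀ x, 0 < ρ x)
    (p : ℝ) (hp : 1 ≤ p) :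
    ∃ Cstar : ℝ, 0 < Cstar ∧
      ∀ f : EuclideanSpace ℝ (Fin n) → ℝ, LocallyIntegrable f μ →
      ∀ Cf : ℝ, 0 ≤ Cf → IsBMOL μ ρ f Cf →
      ∀ (x₀ : EuclideanSpace ℝ (Fin n)) (r : ℝ), ρ x₀ ≤ r →
        (⨍ y in Metric.ball x₀ r, |f y| ^ p ∂μ) ^ (1 / p) ≤ Cstar * Cf := by
  have hnorm : ∀ ζ ∈ Rp, ‖ζ‖ ≤ 3 / 2 := by
    intro ζ hζ
    have h1 := hRsnorm ζ (hRpsub hζ)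
    rw [real_inner_self_eq_norm_sq] at h1
    nlinarith [norm_nonneg ζ]
  have hb : ∀ ζ ∈ Rp, 0 < ⟪ζ, b⟫ := fun ζ hζ => (hRpdef ζ (hRpsub hζ)).1 hζ
  obtain ⟨hpos, D, hD⟩ := exists_doubling_of_prod_rpow_inner Rp hnorm b hb (fun ζ => 2 * k ζ)
    (fun ζ hζ => mul_nonneg zero_le_two (hk0 ζ (hRpsub hζ))) (ν := volume) (μ := μ)
    (by rw [hμ]; simp_rw [hw])
  have hfin : ∀ x r, 0 < r → μ (closedBall x r) < ⊤ := by
    intro x r hr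
    refine lt_top_iff_ne_top.2 fun h => ?_
    have := hpos x r hr
    simp [Measure.real, h] at this
  have : IsLocallyFiniteMeasure μ :=
    ⟨fun x => ⟨closedBall x 1, closedBall_mem_nhds x one_pos, hfin x 1 one_pos⟩⟩
  have hae : ∀ (x : EuclideanSpace ℝ (Fin n)) (r : ℝ), 0 < r →
      closedBall x r =ᵐ[μ] ball x r := by
    intro x r hr
    have hac : μ ≪ volume := hμ ▸ withDensity_absolutelyContinuous _ _
    refine hac.ae_le (ae_eq_of_subset_of_measure_ge ball_subset_closedBall ?_
      measurableSet_ball.nullMeasurableSet measure_closedBall_lt_top.ne).symm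
    have : Nonempty (Fin n) := ⟨⟨0, hn⟩⟩
    rw [Measure.addHaar_closedBall_eq_addHaar_ball]
  have hD0 : 0 < D := by
    have h1 := hD 0 1 one_pos
    by_contra! h
    nlinarith [hpos 0 1 one_pos, hpos 0 (2 * 1) (by norm_num)]
  exact exists_Lp_bound_of_isBMOL hpos hD0 hD hae hρpos (by linarith)
end
end

section
/- There exists a constant C > 0, independent of f, x, and r, such that for every f ∈ BMO(𝓛_k), every x ∈ ℝ^n, and every 0 < r ≤ ρ_k(x), one has |f_{B(x,r)}| ≤ C·log₂(1 + ρ_k(x)/r)·‖f‖_{BMO(𝓛_k)}. Consequently, defining 𝔠_{B(x,r)} = f_{B(x,r)} if r < ρ_k(x) and 𝔠_{B(x,r)} = 0 if r ≥ ρ_k(x), one has sup_{x∈ℝ^n, r>0} |𝔠_{B(x,r)}|/log₂(1 + ρ_k(x)/r) ≤ C·‖f‖_{BMO(𝓛_k)}. -/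
open MeasureTheory Metric Real
open scoped ENNReal RealInnerProductSpace

set_option linter.unusedVariables false

noncomputable section

/-- A finite family of hyperplanes is avoided, quantitatively, by a ball inside any given ball. -/
lemma exists_ball_subset_le_abs_inner {E : Type*} [NormedAddCommGroup E] [InnerProductSpace ℝ E]
    (S : Finset E) (hS : ∀ ζ ∈ S, ζ ≠ 0) :
    ∃ c : ℝ, 0 < c ∧ ∀ (x : E) (r : ℝ), 0 < r → ∃ z : E,
      ball z (c * r) ⊆ ball x r ∧ ∀ ζ ∈ S, ∀ y ∈ ball z (c * r), c * r ≤ |⟪ζ, y⟫| := by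
  classical
  induction S using Finset.induction_on with
  | empty => exact ⟨1, one_pos, fun x r hr => ⟨x, by simp, by simp⟩⟩
  | insert ζ S hζS ih =>
    obtain ⟨c, hc, h⟩ := ih fun η hη => hS η (Finset.mem_insert_of_mem hη)
    have hζ : 0 < ‖ζ‖ := norm_pos_iff.2 (hS ζ (Finset.mem_insert_self _ _))
    have hd : 0 < min (c / 4) (c * ‖ζ‖ / 4) := by positivity
    refine ⟨min (c / 4) (c * ‖ζ‖ / 4), hd, fun x r hr => ?_⟩
    set d := min (c / 4) (c * ‖ζ‖ / 4)
    have hd1 : d ≤ c / 4 := min_le_left _ _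
    have hd2 : d ≤ c * ‖ζ‖ / 4 := min_le_right _ _
    obtain ⟨z, hz, hzS⟩ := h x r hr
    obtain ⟨e, he, hez⟩ : ∃ e : ℝ, |e| = 1 ∧ |⟪ζ, z⟫| = e * ⟪ζ, z⟫ := by
      rcases le_total 0 ⟪ζ, z⟫ with h0 | h0
      · exact ⟨1, by simp, by simp [abs_of_nonneg h0]⟩
      · exact ⟨-1, by simp, by simp [abs_of_nonpos h0]⟩
    have hee : e * e = 1 := by rw [← abs_mul_abs_self, he, one_mul]
    set t : ℝ := c * r / 2 / ‖ζ‖ with ht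
    have htpos : 0 < t := by positivity
    have htζ : t * ‖ζ‖ = c * r / 2 := by rw [ht]; field_simp
    have hdr1 : d * r ≤ c / 4 * r := by gcongr
    have hdr2 : d * r ≤ c * ‖ζ‖ / 4 * r := by gcongr
    have hcr : 0 < c * r := by positivity
    have hsub : ball (z + (e * t) • ζ) (d * r) ⊆ ball z (c * r) := by
      apply ball_subset_ball'
      rw [dist_eq_norm, add_sub_cancel_left, norm_smul, Real.norm_eq_abs, abs_mul, he, one_mul,
        abs_of_pos htpos, htζ]
      nlinarith
    refine ⟨z + (e * t) • ζ, hsub.trans hz, fun η hη y hy => ?_⟩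
    rcases Finset.mem_insert.1 hη with rfl | hη
    · have h1 : |⟪η, y - (z + (e * t) • η)⟫| ≤ ‖η‖ * (c / 4 * r) := by
        refine (abs_real_inner_le_norm _ _).trans ?_
        gcongr
        rw [← dist_eq_norm]
        exact (mem_ball.1 hy).le.trans hdr1
      have h2 : e * ⟪η, y⟫ = |⟪η, z⟫| + t * ‖η‖ * ‖η‖
          + e * ⟪η, y - (z + (e * t) • η)⟫ := by
        rw [hez, inner_sub_right, inner_add_right, inner_smul_right, real_inner_self_eq_norm_mul_norm]
        linear_combination (t * ‖η‖ * ‖η‖) * hee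
      have h3 : e * ⟪η, y⟫ ≤ |⟪η, y⟫| := by
        simpa [abs_mul, he] using le_abs_self (e * ⟪η, y⟫)
      have h4 : -|⟪η, y - (z + (e * t) • η)⟫| ≤ e * ⟪η, y - (z + (e * t) • η)⟫ := by
        simpa [abs_mul, he] using neg_abs_le (e * ⟪η, y - (z + (e * t) • η)⟫)
      rw [htζ] at h2
      nlinarith [abs_nonneg ⟪η, z⟫]
    · have := hzS η hη y (hsub hy)
      nlinarith

/-- A product of powers of linear forms is comparable on `ball x (2 * r)` with its values on a
suitable ball inside `ball x r`. -/
lemma exists_ball_subset_prod_rpow_le {E : Type*} [NormedAddCommGroup E] [InnerProductSpace ℝ E]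
    (S : Finset E) (hS : ∀ ζ ∈ S, ζ ≠ 0) (p : E → ℝ) (hp : ∀ ζ ∈ S, 0 ≤ p ζ) :
    ∃ c K : ℝ, 0 < c ∧ 0 < K ∧ ∀ (x : E) (r : ℝ), 0 < r → ∃ z : E,
      ball z (c * r) ⊆ ball x r ∧ 0 < ∏ ζ ∈ S, |⟪ζ, z⟫| ^ p ζ ∧
      ∀ y ∈ ball z (c * r), ∀ y' ∈ ball x (2 * r),
        ∏ ζ ∈ S, |⟪ζ, y'⟫| ^ p ζ ≤ K * ∏ ζ ∈ S, |⟪ζ, y⟫| ^ p ζ := by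
  obtain ⟨c, hc, h⟩ := exists_ball_subset_le_abs_inner S hS
  refine ⟨c, ∏ ζ ∈ S, (1 + 3 * ‖ζ‖ / c) ^ p ζ, hc,
    Finset.prod_pos fun ζ _ => by positivity, fun x r hr => ?_⟩
  obtain ⟨z, hz, hzS⟩ := h x r hr
  have hcr : 0 < c * r := by positivity
  refine ⟨z, hz, Finset.prod_pos fun ζ hζ => ?_, fun y hy y' hy' => ?_⟩
  · exact Real.rpow_pos_of_pos (hcr.trans_le (hzS ζ hζ z (mem_ball_self hcr))) _
  · rw [← Finset.prod_mul_distrib]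
    refine Finset.prod_le_prod (fun ζ _ => by positivity) fun ζ hζ => ?_
    rw [← Real.mul_rpow (by positivity) (abs_nonneg _)]
    refine Real.rpow_le_rpow (abs_nonneg _) ?_ (hp ζ hζ)
    have h1 : |⟪ζ, y' - y⟫| ≤ ‖ζ‖ * (3 * r) := by
      refine (abs_real_inner_le_norm _ _).trans ?_
      gcongr
      rw [← dist_eq_norm]
      have hyx := mem_ball.1 (hz hy)
      have := dist_triangle_right y' y x
      linarith [mem_ball.1 hy']
    have h2 : |⟪ζ, y'⟫| ≤ |⟪ζ, y⟫| + |⟪ζ, y' - y⟫| := by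
      rw [inner_sub_right]
      have := abs_add_le ⟪ζ, y⟫ (⟪ζ, y'⟫ - ⟪ζ, y⟫)
      rwa [add_sub_cancel] at this
    have h3 : 3 * ‖ζ‖ * r ≤ 3 * ‖ζ‖ / c * |⟪ζ, y⟫| := by
      calc 3 * ‖ζ‖ * r = 3 * ‖ζ‖ / c * (c * r) := by field_simp
        _ ≤ _ := by gcongr; exact hzS ζ hζ y hy
    linarith

/-- A measure whose density is a product of powers of linear forms is doubling. -/
lemma doubling_withDensity_prod_rpow {E : Type*} [NormedAddCommGroup E] [InnerProductSpace ℝ E]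
    [FiniteDimensional ℝ E] [MeasurableSpace E] [BorelSpace E] (ν : Measure E)
    [ν.IsAddHaarMeasure] (S : Finset E) (hS : ∀ ζ ∈ S, ζ ≠ 0) (p : E → ℝ)
    (hp : ∀ ζ ∈ S, 0 ≤ p ζ) (w : E → ℝ) (hw : ∀ x, w x = ∏ ζ ∈ S, |⟪ζ, x⟫| ^ p ζ)
    (μ : Measure E) (hμ : μ = ν.withDensity fun x => ENNReal.ofReal (w x)) :
    ∃ D : ℝ, 0 < D ∧ ∀ (x : E) (r : ℝ), 0 < r → 0 < μ.real (ball x r) ∧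
      μ (ball x (2 * r)) ≠ ∞ ∧ μ.real (ball x (2 * r)) ≤ D * μ.real (ball x r) := by
  obtain ⟨c, K, hc, hK, h⟩ := exists_ball_subset_prod_rpow_le S hS p hp
  simp only [← hw] at h
  set N := Module.finrank ℝ E
  refine ⟨K * K * (2 / c) ^ N, by positivity, fun x r hr => ?_⟩
  obtain ⟨z, hz, hwz, hcomp⟩ := h x r hr
  have hcr : 0 < c * r := by positivity
  have hzx : z ∈ ball x (2 * r) :=
    ball_subset_ball (by linarith) (hz (mem_ball_self hcr))
  set v := ν.real (ball (0 : E) 1)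
  have hvol : ∀ (y : E) (s : ℝ), 0 < s → ν (ball y s) = ENNReal.ofReal (s ^ N * v) := by
    intro y s hs
    rw [Measure.addHaar_ball_of_pos _ _ hs, ENNReal.ofReal_mul (by positivity),
      ofReal_measureReal measure_ball_lt_top.ne]
  have hv : 0 < v := ENNReal.toReal_pos (measure_ball_pos _ _ one_pos).ne' measure_ball_lt_top.ne
  have hup : μ (ball x (2 * r)) ≤ ENNReal.ofReal (K * w z * ((2 * r) ^ N * v)) := by
    rw [hμ, withDensity_apply _ measurableSet_ball, ENNReal.ofReal_mul (by positivity),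
      ← hvol x (2 * r) (by positivity), ← setLIntegral_const]
    exact setLIntegral_mono measurable_const fun y hy =>
      ENNReal.ofReal_le_ofReal (hcomp z (mem_ball_self hcr) y hy)
  have hlow : ENNReal.ofReal (w z / K * ((c * r) ^ N * v)) ≤ μ (ball x r) := by
    refine le_trans ?_ (measure_mono hz)
    rw [hμ, withDensity_apply _ measurableSet_ball, ENNReal.ofReal_mul (by positivity),
      ← hvol z (c * r) hcr, ← setLIntegral_const]
    refine setLIntegral_mono' measurableSet_ball fun y hy => ENNReal.ofReal_le_ofReal ?_
    rw [div_le_iff₀ hK, mul_comm]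
    exact hcomp y hy z hzx
  have hfin : μ (ball x (2 * r)) ≠ ∞ := (hup.trans_lt ENNReal.ofReal_lt_top).ne
  have hfin' : μ (ball x r) ≠ ∞ :=
    ((measure_mono (ball_subset_ball (by linarith))).trans_lt hfin.lt_top).ne
  have hup' : μ.real (ball x (2 * r)) ≤ K * w z * ((2 * r) ^ N * v) :=
    ENNReal.toReal_le_of_le_ofReal (by positivity) hup
  have hlow' : w z / K * ((c * r) ^ N * v) ≤ μ.real (ball x r) :=
    (ENNReal.ofReal_le_iff_le_toReal hfin').1 hlow
  refine ⟨lt_of_lt_of_le (by positivity) hlow', hfin, hup'.trans ?_⟩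
  calc K * w z * ((2 * r) ^ N * v)
      = K * K * (2 / c) ^ N * (w z / K * ((c * r) ^ N * v)) := by
        rw [div_pow, mul_pow, mul_pow]; field_simp
    _ ≤ _ := by gcongr

/-- The average over a set is controlled by mean oscillation over a comparable larger set. -/
lemma abs_setAverage_sub_le_s7 {α : Type*} [MeasurableSpace α] {μ : Measure α} {s t : Set α}
    (hst : s ⊆ t) (hs : 0 < μ.real s) (ht : μ t ≠ ∞) {D : ℝ} (hD : μ.real t ≤ D * μ.real s)
    {f : α → ℝ} (hf : IntegrableOn f t μ) (a : ℝ) :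
    |⨍ y in s, f y ∂μ - a| ≤ D * ⨍ y in t, |f y - a| ∂μ := by
  have hsfin : μ s ≠ ∞ := ((measure_mono hst).trans_lt ht.lt_top).ne
  have hstreal : μ.real s ≤ μ.real t := measureReal_mono hst ht
  have hfa : IntegrableOn (fun y => f y - a) t μ := hf.sub (integrableOn_const ht)
  have hfs := hf.mono_set hst
  have h1 : ⨍ y in s, f y ∂μ - a = (μ.real s)⁻¹ * ∫ y in s, (f y - a) ∂μ := by
    rw [setAverage_eq, integral_sub hfs (integrableOn_const hsfin), setIntegral_const,
      smul_eq_mul, smul_eq_mul]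
    field_simp
  have h2 : |∫ y in s, (f y - a) ∂μ| ≤ ∫ y in t, |f y - a| ∂μ :=
    (abs_integral_le_integral_abs).trans
      (setIntegral_mono_set hfa.abs (Filter.Eventually.of_forall fun _ => abs_nonneg _)
        hst.eventuallyLE)
  have h0 : 0 ≤ ∫ y in t, |f y - a| ∂μ := integral_nonneg fun _ => abs_nonneg _
  rw [h1, abs_mul, abs_of_pos (inv_pos.2 hs), setAverage_eq, smul_eq_mul, ← mul_assoc]
  refine (mul_le_mul_of_nonneg_left h2 (inv_pos.2 hs).le).trans
    (mul_le_mul_of_nonneg_right ?_ h0)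
  rw [← div_eq_mul_inv, le_div_iff₀ (hs.trans_le hstreal), inv_mul_le_iff₀ hs]
  linarith

/-- For a doubling measure, averages of a `BMO(𝓛)` function over balls whose radius is `2 ^ m`
times smaller than the critical radius grow at most linearly in `m`. -/
lemma IsBMOL.abs_setAverage_le {α : Type*} [MeasurableSpace α] [PseudoMetricSpace α]
    {μ : Measure α} {ρ : α → ℝ} {D : ℝ} (hD : 0 < D)
    (hdoub : ∀ (x : α) (r : ℝ), 0 < r → 0 < μ.real (ball x r) ∧
      μ (ball x (2 * r)) ≠ ∞ ∧ μ.real (ball x (2 * r)) ≤ D * μ.real (ball x r))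
    {f : α → ℝ} (hf : ∀ (x : α) (r : ℝ), IntegrableOn f (ball x r) μ)
    {Cf : ℝ} (hCf : 0 ≤ Cf) (hB : IsBMOL μ ρ f Cf) (x : α) (m : ℕ) :
    ∀ r : ℝ, 0 < r → r ≤ ρ x → ρ x ≤ 2 ^ m * r →
      |⨍ y in ball x r, f y ∂μ| ≤ D * (m + 1) * Cf := by
  have hnear : ∀ r : ℝ, 0 < r → r ≤ ρ x → ρ x ≤ 2 * r →
      |⨍ y in ball x r, f y ∂μ| ≤ D * Cf := by
    intro r hr hrρ hρr
    obtain ⟨h1, h2, h3⟩ := hdoub x r hr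
    have hsub : ball x (ρ x) ⊆ ball x (2 * r) := ball_subset_ball hρr
    have h := abs_setAverage_sub_le_s7 (ball_subset_ball hrρ) h1
      ((measure_mono hsub).trans_lt h2.lt_top).ne ((measureReal_mono hsub h2).trans h3)
      (hf x (ρ x)) 0
    simp only [sub_zero] at h
    exact h.trans (mul_le_mul_of_nonneg_left (hB.2 x _ le_rfl) hD.le)
  induction m with
  | zero =>
    intro r hr hrρ hρr
    simpa using hnear r hr hrρ (by linarith)
  | succ m ih =>
    intro r hr hrρ hρr
    rcases lt_or_ge (2 * r) (ρ x) with h2r | h2r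
    · obtain ⟨h1, h2, h3⟩ := hdoub x r hr
      have hstep := (abs_setAverage_sub_le_s7 (ball_subset_ball (by linarith : r ≤ 2 * r)) h1 h2 h3
        (hf x (2 * r)) (⨍ z in ball x (2 * r), f z ∂μ)).trans
          (mul_le_mul_of_nonneg_left (hB.1 x _ (by linarith) h2r) hD.le)
      have hih := ih (2 * r) (by linarith) h2r.le (by rw [pow_succ] at hρr; linarith)
      have := abs_add_le (⨍ y in ball x r, f y ∂μ - ⨍ z in ball x (2 * r), f z ∂μ)
        (⨍ z in ball x (2 * r), f z ∂μ)
      rw [sub_add_cancel] at this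
      push_cast
      linarith
    · refine (hnear r hr hrρ h2r).trans ?_
      push_cast
      have : 0 ≤ D * Cf * (m + 1) := by positivity
      linarith

/-- There is `C > 0` such that for every `f ∈ BMO(𝓛_k)`, every `x` and `0 < r ≤ ρ_k(x)`,
`|f_(B(x,r))| ≤ C log₂(1 + ρ_k(x)/r) ‖f‖_(BMO(𝓛_k))`; consequently, with
`𝔠_(B(x,r)) = f_(B(x,r))` for `r < ρ_k(x)` and `𝔠_(B(x,r)) = 0` for `r ≥ ρ_k(x)`, one has
`|𝔠_(B(x,r))| ≤ C log₂(1 + ρ_k(x)/r) ‖f‖_(BMO(𝓛_k))` for all `x` and `r > 0`. -/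
theorem bmoL_average_log_bound
    (n : ℕ) (hn : 0 < n)
    (Rs Rp : Finset (EuclideanSpace ℝ (Fin n)))
    (hRs0 : (0 : EuclideanSpace ℝ (Fin n)) ∉ Rs)
    (hRsnorm : ∀ ζ ∈ Rs, ⟪ζ, ζ⟫ = (2 : ℝ))
    (hRsrefl : ∀ ζ ∈ Rs, ∀ η ∈ Rs, η - ⟪η, ζ⟫ • ζ ∈ Rs)
    (hRsline : ∀ ζ ∈ Rs, ∀ c : ℝ, c • ζ ∈ Rs → c = 1 ∨ c = -1)
    (b : EuclideanSpace ℝ (Fin n))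
    (hRpdef : ∀ ζ ∈ Rs, (ζ ∈ Rp ↔ 0 < ⟪ζ, b⟫)) (hRpsub : Rp ⊆ Rs)
    (k : EuclideanSpace ℝ (Fin n) → ℝ)
    (hk0 : ∀ ζ ∈ Rs, 0 ≤ k ζ)
    (hkinv : ∀ ζ ∈ Rs, ∀ η ∈ Rs, k (η - ⟪η, ζ⟫ • ζ) = k η)
    (w : EuclideanSpace ℝ (Fin n) → ℝ)
    (hw : ∀ x, w x = ∏ ζ ∈ Rp, |⟪ζ, x⟫| ^ (2 * k ζ))
    (γ : ℝ) (hγ : γ = ∑ ζ ∈ Rp, k ζ)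
    (μ : Measure (EuclideanSpace ℝ (Fin n)))
    (hμ : μ = volume.withDensity (fun x => ENNReal.ofReal (w x)))
    (V : EuclideanSpace ℝ (Fin n) → ℝ)
    (hV0 : ∀ x, 0 ≤ V x)
    (hVloc : LocallyIntegrable V μ)
    (hVne : ¬ (∀ᵐ x ∂μ, V x = 0))
    (q : ℝ) (hq : max 1 (((n : ℝ) + 2 * γ) / 2) < q)
    (C_RH : ℝ) (hC_RH : 0 < C_RH)
    (hRH : ∀ (x : EuclideanSpace ℝ (Fin n)) (r : ℝ), 0 < r →
      (⨍ y in Metric.ball x r, V y ^ q ∂μ) ^ (1 / q) ≤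
        C_RH * ⨍ y in Metric.ball x r, V y ∂μ)
    (ρ : EuclideanSpace ℝ (Fin n) → ℝ)
    (hρdef : ∀ x, ρ x = sSup {r : ℝ | 0 < r ∧
      r ^ 2 / (μ (Metric.ball x r)).toReal * ∫ y in Metric.ball x r, V y ∂μ ≤ 1})
    (hρpos : ∀ x, 0 < ρ x)
    :
    ∃ C : ℝ, 0 < C ∧
      ∀ f : EuclideanSpace ℝ (Fin n) → ℝ, LocallyIntegrable f μ →
      ∀ Cf : ℝ, 0 ≤ Cf → IsBMOL μ ρ f Cf →
      (∀ (x : EuclideanSpace ℝ (Fin n)) (r : ℝ), 0 < r → r ≤ ρ x →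
        |⨍ y in Metric.ball x r, f y ∂μ| ≤ C * Real.logb 2 (1 + ρ x / r) * Cf) ∧
      (∀ (x : EuclideanSpace ℝ (Fin n)) (r : ℝ), 0 < r →
        |if r < ρ x then ⨍ y in Metric.ball x r, f y ∂μ else 0| ≤
          C * Real.logb 2 (1 + ρ x / r) * Cf) := by
  have hS : ∀ ζ ∈ Rp, ζ ≠ 0 := fun ζ hζ h0 => hRs0 (h0 ▸ hRpsub hζ)
  obtain ⟨D, hD, hdoub⟩ := doubling_withDensity_prod_rpow volume Rp hS (fun ζ => 2 * k ζ)
    (fun ζ hζ => mul_nonneg zero_le_two (hk0 ζ (hRpsub hζ))) w hw μ hμ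
  refine ⟨3 * D, by positivity, fun f hf Cf hCf hB => ?_⟩
  have hfball : ∀ x r, IntegrableOn f (ball x r) μ := fun x r =>
    (hf.integrableOn_isCompact (isCompact_closedBall x r)).mono_set ball_subset_closedBall
  have key : ∀ (x : EuclideanSpace ℝ (Fin n)) (r : ℝ), 0 < r → r ≤ ρ x →
      |⨍ y in Metric.ball x r, f y ∂μ| ≤ 3 * D * Real.logb 2 (1 + ρ x / r) * Cf := by
    intro x r hr hrρ
    have hq1 : 1 ≤ ρ x / r := (one_le_div hr).2 hrρ
    have hlog0 : 0 ≤ Real.logb 2 (ρ x / r) := Real.logb_nonneg one_lt_two hq1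
    have hlog1 : 1 ≤ Real.logb 2 (1 + ρ x / r) := by
      rw [Real.le_logb_iff_rpow_le one_lt_two (by linarith), Real.rpow_one]
      linarith
    have hlog : Real.logb 2 (ρ x / r) ≤ Real.logb 2 (1 + ρ x / r) :=
      Real.logb_le_logb_of_le one_lt_two (by linarith) (by linarith)
    have hm := Nat.ceil_lt_add_one hlog0
    have hρm : ρ x ≤ 2 ^ ⌈Real.logb 2 (ρ x / r)⌉₊ * r := by
      rw [← div_le_iff₀ hr, ← Real.rpow_natCast, ← Real.logb_le_iff_le_rpow one_lt_two (by linarith)]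
      exact Nat.le_ceil _
    refine (hB.abs_setAverage_le hD hdoub hfball hCf x _ r hr hrρ hρm).trans ?_
    rw [mul_comm 3 D, mul_assoc D 3]
    gcongr
    linarith
  refine ⟨key, fun x r hr => ?_⟩
  split_ifs with h
  · exact key x r hr h.le
  · have : 0 ≤ Real.logb 2 (1 + ρ x / r) :=
      Real.logb_nonneg one_lt_two (by linarith [div_pos (hρpos x) hr])
    rw [abs_zero]
    positivity
end
end

section
/- Let f be locally integrable with respect to ω_k and suppose that to every Euclidean ball B = B(x,r) there is assigned a constant 𝔠_B and there exist constants C₁, C ≥ 0 such that ω_k(B)^{-1} ∫_B |f − 𝔠_B| dω_k ≤ C₁ for every ball B, and |𝔠_{B(x,r)}| ≤ C·log₂(1 + ρ_k(x)/r) for every x ∈ ℝ^n and r > 0. Then f ∈ BMO(𝓛_k) and ‖f‖_{BMO(𝓛_k)} ≤ max{2C₁, C₁ + C}. -/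
open MeasureTheory Metric Real
open scoped ENNReal RealInnerProductSpace

set_option linter.unusedVariables false

noncomputable section

/-- On a probability space, the mean oscillation around the mean is at most twice the mean
oscillation around any constant. -/
theorem integral_abs_sub_integral_le {α : Type*} [MeasurableSpace α] {ν : Measure α}
    [IsProbabilityMeasure ν] {f : α → ℝ} (hf : Integrable f ν) (c : ℝ) :
    ∫ y, |f y - ∫ z, f z ∂ν| ∂ν ≤ 2 * ∫ y, |f y - c| ∂ν := by
  have hc : Integrable (fun y => |f y - c|) ν := (hf.sub (integrable_const c)).abs
  have hmean : |c - ∫ z, f z ∂ν| ≤ ∫ y, |f y - c| ∂ν := by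
    have h := abs_integral_le_integral_abs (μ := ν) (f := fun y => f y - c)
    rw [integral_sub hf (integrable_const c), integral_const, probReal_univ, one_smul,
      abs_sub_comm] at h
    exact h
  calc ∫ y, |f y - ∫ z, f z ∂ν| ∂ν
      ≤ ∫ y, (|f y - c| + |c - ∫ z, f z ∂ν|) ∂ν :=
        integral_mono (hf.sub (integrable_const _)).abs (hc.add (integrable_const _))
          fun y => abs_sub_le _ _ _
    _ = ∫ y, |f y - c| ∂ν + |c - ∫ z, f z ∂ν| := by
        rw [integral_add hc (integrable_const _), integral_const, probReal_univ, one_smul]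
    _ ≤ 2 * ∫ y, |f y - c| ∂ν := by linarith

/-- On a probability space, the mean of `|f|` is at most the mean oscillation around `c`
plus `|c|`. -/
theorem integral_abs_le_integral_abs_sub_add {α : Type*} [MeasurableSpace α] {ν : Measure α}
    [IsProbabilityMeasure ν] {f : α → ℝ} (hf : Integrable f ν) (c : ℝ) :
    ∫ y, |f y| ∂ν ≤ ∫ y, |f y - c| ∂ν + |c| := by
  have hc : Integrable (fun y => |f y - c|) ν := (hf.sub (integrable_const c)).abs
  calc ∫ y, |f y| ∂ν ≤ ∫ y, (|f y - c| + |c|) ∂ν :=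
        integral_mono hf.abs (hc.add (integrable_const _)) fun y => by
          simpa using abs_add_le (f y - c) c
    _ = ∫ y, |f y - c| ∂ν + |c| := by
        rw [integral_add hc (integrable_const _), integral_const, probReal_univ, one_smul]

/-- The normalized restriction of a measure to a set is either zero or a probability measure. -/
theorem inv_smul_restrict_eq_zero_or_isProbabilityMeasure {α : Type*} [MeasurableSpace α]
    (μ : Measure α) (s : Set α) :
    (μ.restrict s Set.univ)⁻¹ • μ.restrict s = 0 ∨
      IsProbabilityMeasure ((μ.restrict s Set.univ)⁻¹ • μ.restrict s) := by
  by_cases h0 : μ.restrict s Set.univ = 0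
  · left
    rw [Measure.measure_univ_eq_zero.1 h0, smul_zero]
  by_cases htop : μ.restrict s Set.univ = ∞
  · left
    rw [htop, ENNReal.inv_top, zero_smul]
  · right
    exact ⟨by rw [Measure.smul_apply, smul_eq_mul, ENNReal.inv_mul_cancel h0 htop]⟩

theorem setAverage_abs_sub_setAverage_le {α : Type*} [MeasurableSpace α] {μ : Measure α}
    {s : Set α} {f : α → ℝ} (hf : IntegrableOn f s μ) (c : ℝ) :
    ⨍ y in s, |f y - ⨍ z in s, f z ∂μ| ∂μ ≤ 2 * ⨍ y in s, |f y - c| ∂μ := by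
  unfold average
  rcases inv_smul_restrict_eq_zero_or_isProbabilityMeasure μ s with h | h
  · simp only [h, integral_zero_measure]; simp
  · exact integral_abs_sub_integral_le hf.to_average c

theorem setAverage_abs_le_setAverage_abs_sub_add {α : Type*} [MeasurableSpace α] {μ : Measure α}
    {s : Set α} {f : α → ℝ} (hf : IntegrableOn f s μ) (c : ℝ) :
    ⨍ y in s, |f y| ∂μ ≤ ⨍ y in s, |f y - c| ∂μ + |c| := by
  unfold average
  rcases inv_smul_restrict_eq_zero_or_isProbabilityMeasure μ s with h | h
  · simp only [h, integral_zero_measure]; simp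
  · exact integral_abs_le_integral_abs_sub_add hf.to_average c

/-- Converse characterization of `BMO(𝓛_k)`: if to every ball `B(x,r)` a constant `𝔠_(x,r)`
is assigned with `ω_k(B)⁻¹ ∫_B |f - 𝔠_B| dω_k ≤ C₁` and
`|𝔠_(B(x,r))| ≤ C log₂(1 + ρ_k(x)/r)`, then `f ∈ BMO(𝓛_k)` with
`‖f‖_(BMO(𝓛_k)) ≤ max (2C₁) (C₁ + C)`. -/
theorem bmoL_of_ball_constants
    (n : ℕ) (hn : 0 < n)
    (Rs Rp : Finset (EuclideanSpace ℝ (Fin n)))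
    (hRs0 : (0 : EuclideanSpace ℝ (Fin n)) ∉ Rs)
    (hRsnorm : ∀ ζ ∈ Rs, ⟪ζ, ζ⟫ = (2 : ℝ))
    (hRsrefl : ∀ ζ ∈ Rs, ∀ η ∈ Rs, η - ⟪η, ζ⟫ • ζ ∈ Rs)
    (hRsline : ∀ ζ ∈ Rs, ∀ c : ℝ, c • ζ ∈ Rs → c = 1 ∨ c = -1)
    (b : EuclideanSpace ℝ (Fin n))
    (hRpdef : ∀ ζ ∈ Rs, (ζ ∈ Rp ↔ 0 < ⟪ζ, b⟫)) (hRpsub : Rp ⊆ Rs)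
    (k : EuclideanSpace ℝ (Fin n) → ℝ)
    (hk0 : ∀ ζ ∈ Rs, 0 ≤ k ζ)
    (hkinv : ∀ ζ ∈ Rs, ∀ η ∈ Rs, k (η - ⟪η, ζ⟫ • ζ) = k η)
    (w : EuclideanSpace ℝ (Fin n) → ℝ)
    (hw : ∀ x, w x = ∏ ζ ∈ Rp, |⟪ζ, x⟫| ^ (2 * k ζ))
    (γ : ℝ) (hγ : γ = ∑ ζ ∈ Rp, k ζ)
    (μ : Measure (EuclideanSpace ℝ (Fin n)))
    (hμ : μ = volume.withDensity (fun x => ENNReal.ofReal (w x)))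
    (V : EuclideanSpace ℝ (Fin n) → ℝ)
    (hV0 : ∀ x, 0 ≤ V x)
    (hVloc : LocallyIntegrable V μ)
    (hVne : ¬ (∀ᵐ x ∂μ, V x = 0))
    (q : ℝ) (hq : max 1 (((n : ℝ) + 2 * γ) / 2) < q)
    (C_RH : ℝ) (hC_RH : 0 < C_RH)
    (hRH : ∀ (x : EuclideanSpace ℝ (Fin n)) (r : ℝ), 0 < r →
      (⨍ y in Metric.ball x r, V y ^ q ∂μ) ^ (1 / q) ≤
        C_RH * ⨍ y in Metric.ball x r, V y ∂μ)
    (ρ : EuclideanSpace ℝ (Fin n) → ℝ)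
    (hρdef : ∀ x, ρ x = sSup {r : ℝ | 0 < r ∧
      r ^ 2 / (μ (Metric.ball x r)).toReal * ∫ y in Metric.ball x r, V y ∂μ ≤ 1})
    (hρpos : ∀ x, 0 < ρ x)
    (f : EuclideanSpace ℝ (Fin n) → ℝ) (hfloc : LocallyIntegrable f μ)
    (cB : EuclideanSpace ℝ (Fin n) → ℝ → ℝ)
    (C₁ C : ℝ) (hC₁ : 0 ≤ C₁) (hC : 0 ≤ C)
    (h1 : ∀ (x : EuclideanSpace ℝ (Fin n)) (r : ℝ), 0 < r → ⨍ y in Metric.ball x r, |f y - cB x r| ∂μ ≤ C₁)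
    (h2 : ∀ (x : EuclideanSpace ℝ (Fin n)) (r : ℝ), 0 < r → |cB x r| ≤ C * Real.logb 2 (1 + ρ x / r)) :
    IsBMOL μ ρ f (max (2 * C₁) (C₁ + C)) := by
  have hint (x : EuclideanSpace ℝ (Fin n)) (r : ℝ) : IntegrableOn f (Metric.ball x r) μ :=
    (hfloc.integrableOn_isCompact (isCompact_closedBall x r)).mono_set ball_subset_closedBall
  refine ⟨fun x s hs _ => ?_, fun x r hr => ?_⟩
  · have h := setAverage_abs_sub_setAverage_le (hint x s) (cB x s)
    exact le_max_of_le_left (by linarith [h1 x s hs])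
  · have hr0 : 0 < r := (hρpos x).trans_le hr
    have h := setAverage_abs_le_setAverage_abs_sub_add (hint x r) (cB x r)
    have hratio : ρ x / r ≤ 1 := (div_le_one hr0).2 hr
    have hratio0 : 0 < ρ x / r := div_pos (hρpos x) hr0
    have hlog : Real.logb 2 (1 + ρ x / r) ≤ 1 := by
      rw [Real.logb_le_iff_le_rpow one_lt_two (by linarith), Real.rpow_one]
      linarith
    have hcB : |cB x r| ≤ C :=
      (h2 x r hr0).trans (mul_le_of_le_one_right hC hlog)
    exact le_max_of_le_right (by linarith [h1 x r hr0])
end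
end

section
/- Let (h_t)_{t>0} be a family of nonnegative measurable kernels on ℝ^n × ℝ^n satisfying the Gaussian upper bound h_t(x,y) ≤ C₀·(1 + |x−y|/√t)^{−2}·G_{t/c₀}(x,y) for some constants c₀, C₀ > 0. Then there exists a constant C > 0 such that for every j ∈ ℤ, every x₀ ∈ ℝ^n, and every g ∈ L¹(ω_k) with supp(g) ⊂ B(x₀, 2^{1−j/2}), one has ∫_{ℝ^n ∖ B(x₀, 2^{3−j/2})} sup_{0<t≤2^{−j}} (∫_{ℝ^n} h_t(x,y)·|g(y)| dω_k(y)) dω_k(x) ≤ C·‖g‖_{L¹(ω_k)}. -/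
open MeasureTheory Metric Real
open scoped ENNReal RealInnerProductSpace

set_option linter.unusedVariables false

noncomputable section

theorem measurable_measure_ball {V : Type*} [PseudoMetricSpace V] [SecondCountableTopology V]
    [MeasurableSpace V] [BorelSpace V] (μ : Measure V) [SFinite μ] (a : ℝ) :
    Measurable fun x => μ (ball x a) := by
  have h : MeasurableSet {q : V × V | dist q.2 q.1 < a} :=
    (isOpen_lt (continuous_snd.dist continuous_fst) continuous_const).measurableSet
  exact measurable_measure_prodMk_left h

theorem gaussian_le_of_dist_lt {V : Type*} [NormedAddCommGroup V] {a : ℝ} (ha : 0 < a) {x p z : V} (h : dist p x < a / 2) :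
    rexp (-‖x - z‖ ^ 2 / (2 * a ^ 2)) ≤
      rexp (1 / 8 : ℝ) * rexp (-(1 / (4 * a ^ 2)) * ‖p - z‖ ^ 2) := by
  rw [← exp_add, exp_le_exp]
  have h1 : ‖p - z‖ ≤ ‖x - z‖ + a / 2 := by
    have := dist_triangle p x z
    simp only [dist_eq_norm] at this h
    linarith
  have h2 : ‖p - z‖ ^ 2 ≤ 2 * ‖x - z‖ ^ 2 + a ^ 2 / 2 := by
    nlinarith [sq_nonneg (‖x - z‖ - a / 2), norm_nonneg (p - z), norm_nonneg (x - z)]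
  have h3 : 1 / 8 + -(1 / (4 * a ^ 2)) * ‖p - z‖ ^ 2 - -‖x - z‖ ^ 2 / (2 * a ^ 2) =
      (2 * ‖x - z‖ ^ 2 + a ^ 2 / 2 - ‖p - z‖ ^ 2) / (4 * a ^ 2) := by
    field_simp
    ring
  have : 0 ≤ (2 * ‖x - z‖ ^ 2 + a ^ 2 / 2 - ‖p - z‖ ^ 2) / (4 * a ^ 2) :=
    div_nonneg (by linarith) (by positivity)
  linarith

section Gaussian

variable {V : Type*} [NormedAddCommGroup V] [InnerProductSpace ℝ V] [FiniteDimensional ℝ V]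
  [MeasurableSpace V] [BorelSpace V]

theorem lintegral_gaussian (z : V) {b : ℝ} (hb : 0 < b) :
    ∫⁻ p : V, ENNReal.ofReal (rexp (-b * ‖p - z‖ ^ 2)) =
      ENNReal.ofReal ((π / b) ^ (Module.finrank ℝ V / 2 : ℝ)) := by
  rw [lintegral_sub_right_eq_self (fun p : V => ENNReal.ofReal (rexp (-b * ‖p‖ ^ 2))) z,
    ← GaussianFourier.integral_rexp_neg_mul_sq_norm (V := V) hb, ofReal_integral_eq_lintegral_ofReal]
  · apply Integrable.of_integral_ne_zero
    rw [GaussianFourier.integral_rexp_neg_mul_sq_norm (V := V) hb]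
    positivity
  · exact Filter.Eventually.of_forall fun _ => (exp_pos _).le

theorem volume_ball_mul_lintegral_gaussian_le (μ : Measure V) [SFinite μ] {a : ℝ} (ha : 0 < a)
    (z : V) :
    volume (ball (0 : V) (a / 2)) *
      ∫⁻ x, (μ (ball x a))⁻¹ * ENNReal.ofReal (rexp (-‖x - z‖ ^ 2 / (2 * a ^ 2))) ∂μ ≤
      ENNReal.ofReal (rexp (1 / 8)) *
        ENNReal.ofReal ((π / (1 / (4 * a ^ 2))) ^ (Module.finrank ℝ V / 2 : ℝ)) := by
  set F : V → ℝ≥0∞ := fun x =>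
    (μ (ball x a))⁻¹ * ENNReal.ofReal (rexp (-‖x - z‖ ^ 2 / (2 * a ^ 2))) with hF
  have hFm : Measurable F := by
    exact (measurable_measure_ball μ a).inv.mul (by fun_prop)
  set T : Set (V × V) := {q | dist q.2 q.1 < a / 2} with hT
  have hTm : MeasurableSet T :=
    (isOpen_lt (continuous_snd.dist continuous_fst) continuous_const).measurableSet
  have hFT : Measurable (T.indicator fun q : V × V => F q.1) :=
    (hFm.comp measurable_fst).indicator hTm
  calc volume (ball (0 : V) (a / 2)) * ∫⁻ x, F x ∂μ
      = ∫⁻ x, (∫⁻ p : V, T.indicator (fun q : V × V => F q.1) (x, p)) ∂μ := by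
        rw [← lintegral_const_mul _ hFm]
        refine lintegral_congr fun x => ?_
        have : (fun p : V => T.indicator (fun q : V × V => F q.1) (x, p)) =
            (ball x (a / 2)).indicator fun _ => F x := rfl
        rw [this, lintegral_indicator_const measurableSet_ball, mul_comm,
          Measure.addHaar_ball_center volume x]
    _ = ∫⁻ p : V, ∫⁻ x, T.indicator (fun q : V × V => F q.1) (x, p) ∂μ :=
        lintegral_lintegral_swap hFT.aemeasurable
    _ ≤ ∫⁻ p : V, ENNReal.ofReal (rexp (1 / 8)) *
          ENNReal.ofReal (rexp (-(1 / (4 * a ^ 2)) * ‖p - z‖ ^ 2)) := by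
        refine lintegral_mono fun p => ?_
        set e := ENNReal.ofReal (rexp (1 / 8)) *
          ENNReal.ofReal (rexp (-(1 / (4 * a ^ 2)) * ‖p - z‖ ^ 2)) with he
        calc ∫⁻ x, T.indicator (fun q : V × V => F q.1) (x, p) ∂μ
            ≤ ∫⁻ x, (ball p (a / 2)).indicator (fun _ => (μ (ball p (a / 2)))⁻¹ * e) x ∂μ := by
              refine lintegral_mono fun x => ?_
              by_cases hx : dist p x < a / 2
              · rw [Set.indicator_of_mem (show (x, p) ∈ T from hx),
                  Set.indicator_of_mem (by rwa [mem_ball, dist_comm])]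
                refine mul_le_mul' (ENNReal.inv_le_inv.2 (measure_mono ?_)) ?_
                · refine ball_subset_ball' ?_
                  linarith
                · rw [he, ← ENNReal.ofReal_mul (exp_pos _).le]
                  exact ENNReal.ofReal_le_ofReal (gaussian_le_of_dist_lt ha hx)
              · rw [Set.indicator_of_notMem (show (x, p) ∉ T from hx)]
                exact zero_le
          _ = e * ((μ (ball p (a / 2)))⁻¹ * μ (ball p (a / 2))) := by
              rw [lintegral_indicator_const measurableSet_ball]
              ring
          _ ≤ e * 1 := by
              gcongr
              exact ENNReal.inv_mul_le_one _
          _ = e := mul_one e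
    _ = _ := by
        rw [lintegral_const_mul _ (by fun_prop), lintegral_gaussian z (by positivity)]

/-- No doubling is needed here: points of a ball of radius `a / 2` have balls of radius `a`
containing it. -/
theorem exists_lintegral_inv_measure_ball_gaussian_le (μ : Measure V) [SFinite μ] :
    ∃ A : ℝ≥0∞, A ≠ ∞ ∧ ∀ a : ℝ, 0 < a → ∀ z : V,
      ∫⁻ x, (μ (ball x a))⁻¹ * ENNReal.ofReal (rexp (-‖x - z‖ ^ 2 / (2 * a ^ 2))) ∂μ ≤ A := by
  set v := volume (ball (0 : V) 1)
  have hv0 : v ≠ 0 := (measure_ball_pos volume (0 : V) one_pos).ne'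
  have hv : v ≠ ∞ := measure_ball_lt_top.ne
  set d := Module.finrank ℝ V
  set B := ENNReal.ofReal (rexp (1 / 8)) * ENNReal.ofReal ((16 * π) ^ (d / 2 : ℝ)) with hB
  refine ⟨B / v, ENNReal.div_ne_top (by finiteness) hv0, fun a ha z => ?_⟩
  rw [ENNReal.le_div_iff_mul_le (Or.inl hv0) (Or.inl hv), mul_comm]
  have hr0 : ENNReal.ofReal ((a / 2) ^ d) ≠ 0 := by
    rw [Ne, ENNReal.ofReal_eq_zero, not_le]
    positivity
  have key := volume_ball_mul_lintegral_gaussian_le μ ha z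
  rw [Measure.addHaar_ball_of_pos _ _ (half_pos ha)] at key
  have hpow : (π / (1 / (4 * a ^ 2))) ^ (d / 2 : ℝ) =
      (a / 2) ^ d * (16 * π) ^ (d / 2 : ℝ) := by
    rw [show π / (1 / (4 * a ^ 2)) = (a / 2) ^ 2 * (16 * π) by field_simp; ring,
      mul_rpow (by positivity) (by positivity), ← rpow_natCast (a / 2) 2,
      ← rpow_mul (by positivity), ← rpow_natCast (a / 2) d]
    congr 2
    push_cast
    ring
  rw [hpow, ENNReal.ofReal_mul (by positivity), mul_left_comm, mul_assoc] at key
  exact (ENNReal.mul_le_mul_iff_right hr0 ENNReal.ofReal_ne_top).1 key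

end Gaussian

section Reflections

variable {V : Type*} [NormedAddCommGroup V] [InnerProductSpace ℝ V]

theorem mem_closure_reflections_preserves (R : Finset V) (hnorm : ∀ ζ ∈ R, ⟪ζ, ζ⟫ = (2 : ℝ))
    (hrefl : ∀ ζ ∈ R, ∀ η ∈ R, η - ⟪η, ζ⟫ • ζ ∈ R) {g : V ≃ₗᵢ[ℝ] V}
    (hg : g ∈ Subgroup.closure {g : V ≃ₗᵢ[ℝ] V | ∃ ζ ∈ R, ∀ x, g x = x - ⟪x, ζ⟫ • ζ}) :
    (∀ η, g η ∈ R ↔ η ∈ R) ∧ ∀ v, (∀ ζ ∈ R, ⟪v, ζ⟫ = (0 : ℝ)) → g v = v := by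
  induction hg using Subgroup.closure_induction with
  | mem g hg =>
    obtain ⟨ζ, hζ, h⟩ := hg
    refine ⟨fun η => ⟨fun hη => ?_, fun hη => h η ▸ hrefl ζ hζ η hη⟩, fun v hv => ?_⟩
    · have := hrefl ζ hζ _ hη
      rw [h η, inner_sub_left, inner_smul_left, hnorm ζ hζ] at this
      convert this using 1
      simp only [RCLike.conj_to_real]
      module
    · simp [h v, hv ζ hζ]
  | one => simp
  | mul g h _ _ hg hh =>
    refine ⟨fun η => ?_, fun v hv => ?_⟩
    · rw [LinearIsometryEquiv.coe_mul, Function.comp_apply, hg.1, hh.1]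
    · rw [LinearIsometryEquiv.coe_mul, Function.comp_apply, hh.2 v hv, hg.2 v hv]
  | inv g _ hg =>
    have h (v : V) : g (g⁻¹ v) = v := g.apply_symm_apply v
    refine ⟨fun η => ?_, fun v hv => ?_⟩
    · rw [← hg.1, h]
    · apply g.injective
      rw [h, hg.2 v hv]

theorem finite_closure_reflections (R : Finset V) (hnorm : ∀ ζ ∈ R, ⟪ζ, ζ⟫ = (2 : ℝ))
    (hrefl : ∀ ζ ∈ R, ∀ η ∈ R, η - ⟪η, ζ⟫ • ζ ∈ R) :
    Finite (Subgroup.closure {g : V ≃ₗᵢ[ℝ] V | ∃ ζ ∈ R, ∀ x, g x = x - ⟪x, ζ⟫ • ζ}) := by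
  set G := Subgroup.closure {g : V ≃ₗᵢ[ℝ] V | ∃ ζ ∈ R, ∀ x, g x = x - ⟪x, ζ⟫ • ζ}
  have hG (g : G) := mem_closure_reflections_preserves R hnorm hrefl g.2
  let φ : G → R → R := fun g ζ => ⟨g.1 ζ, ((hG g).1 ζ).2 ζ.2⟩
  refine Finite.of_injective φ fun g h hgh => Subtype.ext (LinearIsometryEquiv.ext fun x => ?_)
  set S : Submodule ℝ V := Submodule.span ℝ (R : Set V)
  have : FiniteDimensional ℝ S := FiniteDimensional.span_finset ℝ R
  have hS : ∀ v ∈ S, g.1 v = h.1 v := by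
    intro v hv
    induction hv using Submodule.span_induction with
    | mem ζ hζ => exact congrArg Subtype.val (congrFun hgh ⟨ζ, hζ⟩)
    | zero => simp
    | add u v _ _ hu hv => rw [map_add, map_add, hu, hv]
    | smul c v _ hv => rw [map_smul, map_smul, hv]
  obtain ⟨y, hy, z, hz, rfl⟩ := S.exists_add_mem_mem_orthogonal x
  have hz' : ∀ ζ ∈ R, ⟪z, ζ⟫ = (0 : ℝ) := fun ζ hζ =>
    (S.mem_orthogonal' z).1 hz ζ (Submodule.subset_span hζ)
  rw [map_add, map_add, hS y hy, (hG g).2 z hz', (hG h).2 z hz']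

end Reflections

theorem measure_ball_lt_top_withDensity {V : Type*} [NormedAddCommGroup V] [InnerProductSpace ℝ V]
    [FiniteDimensional ℝ V] [MeasurableSpace V] [BorelSpace V] {w : V → ℝ} (hw : Continuous w)
    (x : V) (r : ℝ) :
    (volume.withDensity fun x => ENNReal.ofReal (w x)) (ball x r) < ∞ := by
  have : IsLocallyFiniteMeasure (volume.withDensity fun x => ENNReal.ofReal (w x)) :=
    IsLocallyFiniteMeasure.withDensity_ofReal hw
  exact measure_ball_lt_top

theorem one_add_div_sqrt_rpow_neg_two_le {i : ℕ} {R t D : ℝ} (ht : 0 < t)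
    (htR : t ≤ (1 / 2) ^ i * R) (hD : 0 ≤ D) (hRD : R ≤ D ^ 2) :
    (1 + D / √t) ^ (-(2 : ℝ)) ≤ (1 / 2) ^ i := by
  have hq : 0 ≤ D / √t := by positivity
  rw [rpow_neg (by positivity), rpow_two]
  refine inv_le_of_inv_le₀ (by positivity) ?_
  have h1 : ((1 / 2 : ℝ) ^ i)⁻¹ ≤ (D / √t) ^ 2 := by
    rw [div_pow D, sq_sqrt ht.le, le_div_iff₀ ht, inv_mul_le_iff₀ (by positivity)]
    exact htR.trans (by gcongr)
  nlinarith

theorem ofReal_inv_max_le {V : Type*} [PseudoMetricSpace V] [MeasurableSpace V] (μ : Measure V)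
    (hfin : ∀ x r, μ (ball x r) < ∞) {a s : ℝ} (has : a ≤ s) (x : V) (m : ℝ) :
    ENNReal.ofReal ((max (μ (ball x s)).toReal m)⁻¹) ≤ (μ (ball x a))⁻¹ := by
  have hmono : μ (ball x a) ≤ μ (ball x s) := measure_mono (ball_subset_ball has)
  refine le_trans ?_ (ENNReal.inv_le_inv.2 hmono)
  rcases eq_or_ne (μ (ball x s)) 0 with h0 | h0
  · simp [h0]
  have hpos : 0 < (μ (ball x s)).toReal := ENNReal.toReal_pos h0 (hfin x s).ne
  refine (ENNReal.ofReal_le_ofReal (inv_anti₀ hpos (le_max_left _ _))).trans ?_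
  rw [ENNReal.ofReal_inv_of_pos hpos, ENNReal.ofReal_toReal (hfin x s).ne]

section OrbitKernel

variable {V : Type*} [NormedAddCommGroup V] [InnerProductSpace ℝ V] [MeasurableSpace V]

/-- The sum over the orbit of `y` of Gaussians of width `a`, normalized at `x` by `μ (ball x a)`. -/
def orbitKernel (μ : Measure V) (G : Subgroup (V ≃ₗᵢ[ℝ] V)) [Fintype G] (a : ℝ) (x y : V) : ℝ≥0∞ :=
  ∑ g : G, (μ (ball x a))⁻¹ * ENNReal.ofReal (rexp (-‖x - (g : V ≃ₗᵢ[ℝ] V) y‖ ^ 2 / (2 * a ^ 2)))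

variable (μ : Measure V) (G : Subgroup (V ≃ₗᵢ[ℝ] V)) [Fintype G]

theorem ofReal_gaussian_bound_le_orbitKernel (hfin : ∀ x r, μ (ball x r) < ∞) {c₀ C₀ R t m : ℝ}
    (hc₀ : 0 < c₀) (hC₀ : 0 < C₀) (hR : 0 < R) (ht : 0 < t) {i : ℕ} (hiR : (1 / 2) ^ (i + 1) * R < t)
    (htR : t ≤ (1 / 2) ^ i * R) {x y : V} (hxy : R ≤ ‖x - y‖ ^ 2) :
    ENNReal.ofReal (C₀ * (1 + ‖x - y‖ / √t) ^ (-(2 : ℝ)) *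
        ((max (μ (ball x (√(t / c₀)))).toReal m)⁻¹ *
          rexp (-(⨅ g : G, ‖x - (g : V ≃ₗᵢ[ℝ] V) y‖) ^ 2 / (t / c₀)))) ≤
      ENNReal.ofReal (C₀ * (1 / 2) ^ i) * orbitKernel μ G (√((1 / 2) ^ (i + 1) * R / c₀)) x y := by
  set a := √((1 / 2) ^ (i + 1) * R / c₀) with ha
  have ha2 : 2 * a ^ 2 = (1 / 2) ^ i * R / c₀ := by
    rw [ha, sq_sqrt (by positivity)]
    ring
  have has : a ≤ √(t / c₀) := sqrt_le_sqrt (by gcongr)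
  obtain ⟨g, hg⟩ := exists_eq_ciInf_of_finite (f := fun g : G => ‖x - (g : V ≃ₗᵢ[ℝ] V) y‖)
  rw [← hg, ENNReal.ofReal_mul (by positivity), ENNReal.ofReal_mul (p := (max _ _)⁻¹)
    (inv_nonneg.2 (le_max_of_le_left ENNReal.toReal_nonneg))]
  refine mul_le_mul' (ENNReal.ofReal_le_ofReal ?_) ?_
  · gcongr
    exact one_add_div_sqrt_rpow_neg_two_le ht htR (norm_nonneg _) hxy
  · refine le_trans (mul_le_mul' (ofReal_inv_max_le μ hfin has x m) (ENNReal.ofReal_le_ofReal ?_))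
      (Finset.single_le_sum (f := fun g : G => (μ (ball x a))⁻¹ *
        ENNReal.ofReal (rexp (-‖x - (g : V ≃ₗᵢ[ℝ] V) y‖ ^ 2 / (2 * a ^ 2))))
        (fun _ _ => zero_le) (Finset.mem_univ g))
    rw [exp_le_exp, ha2, neg_div, neg_div, neg_le_neg_iff]
    gcongr

variable [FiniteDimensional ℝ V] [BorelSpace V]

theorem measurable_orbitKernel [SFinite μ] (a : ℝ) :
    Measurable (Function.uncurry (orbitKernel μ G a)) := by
  refine Finset.measurable_sum _ fun g _ => ?_
  have hg : Measurable fun q : V × V => ‖q.1 - (g : V ≃ₗᵢ[ℝ] V) q.2‖ :=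
    (continuous_fst.sub ((g : V ≃ₗᵢ[ℝ] V).continuous.comp continuous_snd)).norm.measurable
  exact ((measurable_measure_ball μ a).comp measurable_fst).inv.mul
    (((hg.pow_const 2).neg.div_const _).exp.ennreal_ofReal)

theorem lintegral_orbitKernel_le [SFinite μ] {a : ℝ} {A : ℝ≥0∞}
    (hA : ∀ z : V, ∫⁻ x, (μ (ball x a))⁻¹ *
      ENNReal.ofReal (rexp (-‖x - z‖ ^ 2 / (2 * a ^ 2))) ∂μ ≤ A) (y : V) :
    ∫⁻ x, orbitKernel μ G a x y ∂μ ≤ Fintype.card G * A := by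
  simp only [orbitKernel]
  rw [lintegral_finsetSum]
  · exact (Finset.sum_le_sum fun g _ => hA _).trans (by simp)
  · exact fun g _ => (measurable_measure_ball μ a).inv.mul (by fun_prop)

/-- The dyadic superposition of orbit kernels has bounded mass, because of the weights `2⁻ⁱ`. -/
theorem lintegral_tsum_orbitKernel_le [SFinite μ] {C₀ : ℝ} (hC₀ : 0 < C₀) {A : ℝ≥0∞}
    (hA : ∀ a : ℝ, 0 < a → ∀ z : V, ∫⁻ x, (μ (ball x a))⁻¹ *
      ENNReal.ofReal (rexp (-‖x - z‖ ^ 2 / (2 * a ^ 2))) ∂μ ≤ A)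
    {a : ℕ → ℝ} (ha : ∀ i, 0 < a i) {f : V → ℝ≥0∞} (hf : Measurable f) :
    ∫⁻ x, ∑' i : ℕ, (∫⁻ y, ENNReal.ofReal (C₀ * (1 / 2) ^ i) * orbitKernel μ G (a i) x y * f y ∂μ) ∂μ
      ≤ ENNReal.ofReal (2 * C₀) * (Fintype.card G * A) * ∫⁻ y, f y ∂μ := by
  have hm (i : ℕ) : Measurable (Function.uncurry fun x y =>
      ENNReal.ofReal (C₀ * (1 / 2) ^ i) * orbitKernel μ G (a i) x y * f y) :=
    ((measurable_orbitKernel μ G (a i)).const_mul _).mul (hf.comp measurable_snd)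
  rw [lintegral_tsum fun i => (hm i).lintegral_prod_right.aemeasurable]
  calc _ ≤ ∑' i : ℕ, ENNReal.ofReal (C₀ * (1 / 2) ^ i) *
        (Fintype.card G * A * ∫⁻ y, f y ∂μ) := by
        refine ENNReal.tsum_le_tsum fun i => ?_
        rw [lintegral_lintegral_swap (hm i).aemeasurable, ← lintegral_const_mul _ hf,
          ← lintegral_const_mul _ (hf.const_mul _)]
        refine lintegral_mono fun y => ?_
        have hk : Measurable fun x => orbitKernel μ G (a i) x y :=
          (measurable_orbitKernel μ G (a i)).of_uncurry_right
        rw [lintegral_mul_const _ (hk.const_mul _), lintegral_const_mul _ hk, mul_assoc]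
        gcongr
        exact lintegral_orbitKernel_le μ G (hA _ (ha i)) y
    _ = _ := by
        rw [ENNReal.tsum_mul_right, ← ENNReal.ofReal_tsum_of_nonneg (fun _ => by positivity)
          (summable_geometric_two.mul_left C₀), tsum_mul_left, tsum_geometric_two, mul_comm C₀,
          ← mul_assoc]

end OrbitKernel

theorem enorm_biSup_le {ι : Type*} {s : Set ι} {f : ι → ℝ} {b : ℝ≥0∞}
    (h : ∀ i ∈ s, ‖f i‖ₑ ≤ b) (hf : ∀ i ∈ s, 0 ≤ f i) : ‖⨆ i ∈ s, f i‖ₑ ≤ b := by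
  rcases eq_or_ne b ∞ with rfl | hb
  · exact le_top
  have h0 : 0 ≤ ⨆ i ∈ s, f i := Real.iSup_nonneg fun i => Real.iSup_nonneg fun hi => hf i hi
  rw [Real.enorm_of_nonneg h0, ENNReal.ofReal_le_iff_le_toReal hb]
  refine Real.iSup_le (fun i => Real.iSup_le (fun hi => ?_) ENNReal.toReal_nonneg)
    ENNReal.toReal_nonneg
  rw [← ENNReal.ofReal_le_iff_le_toReal hb, ← Real.enorm_of_nonneg (hf i hi)]
  exact h i hi

/-- **Lemma 4.5 (first part).**  If `h_t` satisfies the Gaussian upper bound, then there is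
`C > 0` such that for every `j`, `x₀` and `g ∈ L¹(ω_k)` supported in `B(x₀, 2^(1-j/2))`,
`∫_(ℝⁿ ∖ B(x₀, 2^(3-j/2))) sup_(0<t≤2^(-j)) H_t(|g|)(x) dω_k(x) ≤ C ‖g‖_(L¹(ω_k))`. -/
theorem heat_maximal_outside_bound
    (n : ℕ) (hn : 0 < n)
    (Rs Rp : Finset (EuclideanSpace ℝ (Fin n)))
    (hRs0 : (0 : EuclideanSpace ℝ (Fin n)) ∉ Rs)
    (hRsnorm : ∀ ζ ∈ Rs, ⟪ζ, ζ⟫ = (2 : ℝ))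
    (hRsrefl : ∀ ζ ∈ Rs, ∀ η ∈ Rs, η - ⟪η, ζ⟫ • ζ ∈ Rs)
    (hRsline : ∀ ζ ∈ Rs, ∀ c : ℝ, c • ζ ∈ Rs → c = 1 ∨ c = -1)
    (b : EuclideanSpace ℝ (Fin n))
    (hRpdef : ∀ ζ ∈ Rs, (ζ ∈ Rp ↔ 0 < ⟪ζ, b⟫)) (hRpsub : Rp ⊆ Rs)
    (k : EuclideanSpace ℝ (Fin n) → ℝ)
    (hk0 : ∀ ζ ∈ Rs, 0 ≤ k ζ)
    (hkinv : ∀ ζ ∈ Rs, ∀ η ∈ Rs, k (η - ⟪η, ζ⟫ • ζ) = k η)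
    (w : EuclideanSpace ℝ (Fin n) → ℝ)
    (hw : ∀ x, w x = ∏ ζ ∈ Rp, |⟪ζ, x⟫| ^ (2 * k ζ))
    (γ : ℝ) (hγ : γ = ∑ ζ ∈ Rp, k ζ)
    (μ : Measure (EuclideanSpace ℝ (Fin n)))
    (hμ : μ = volume.withDensity (fun x => ENNReal.ofReal (w x)))
    (G : Subgroup (EuclideanSpace ℝ (Fin n) ≃ₗᵢ[ℝ] EuclideanSpace ℝ (Fin n)))
    (hG : G = Subgroup.closure {g : EuclideanSpace ℝ (Fin n) ≃ₗᵢ[ℝ] EuclideanSpace ℝ (Fin n) | ∃ ζ ∈ Rs, ∀ x, g x = x - ⟪x, ζ⟫ • ζ})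
    (dO : EuclideanSpace ℝ (Fin n) → EuclideanSpace ℝ (Fin n) → ℝ)
    (hdO : ∀ x y, dO x y = ⨅ g : G, ‖x - (g : EuclideanSpace ℝ (Fin n) ≃ₗᵢ[ℝ] EuclideanSpace ℝ (Fin n)) y‖)
    (ht : ℝ → EuclideanSpace ℝ (Fin n) → EuclideanSpace ℝ (Fin n) → ℝ)
    (hmeas : ∀ t : ℝ, 0 < t → Measurable (Function.uncurry (ht t)))
    (hnn : ∀ t : ℝ, 0 < t → ∀ x y, 0 ≤ ht t x y)
    (c₀ C₀ : ℝ) (hc₀ : 0 < c₀) (hC₀ : 0 < C₀)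
    (hGauss : ∀ t : ℝ, 0 < t → ∀ x y, ht t x y ≤
      C₀ * (1 + ‖x - y‖ / Real.sqrt t) ^ (-(2 : ℝ)) *
        ((max (μ (Metric.ball x (Real.sqrt (t / c₀)))).toReal
            (μ (Metric.ball y (Real.sqrt (t / c₀)))).toReal)⁻¹ *
          Real.exp (-dO x y ^ 2 / (t / c₀)))) :
    ∃ C : ℝ, 0 < C ∧ ∀ (j : ℤ) (x₀ : EuclideanSpace ℝ (Fin n)) (g : EuclideanSpace ℝ (Fin n) → ℝ), Integrable g μ →
      Function.support g ⊆ Metric.ball x₀ ((2 : ℝ) ^ (1 - (j : ℝ) / 2)) →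
      ∫ x in (Metric.ball x₀ ((2 : ℝ) ^ (3 - (j : ℝ) / 2)))ᶜ,
          (⨆ t ∈ Set.Ioc (0 : ℝ) ((2 : ℝ) ^ (-(j : ℝ))), ∫ y, ht t x y * |g y| ∂μ) ∂μ ≤
        C * ∫ y, |g y| ∂μ := by
  have hwc : Continuous w := by
    rw [show w = fun x => ∏ ζ ∈ Rp, |⟪ζ, x⟫| ^ (2 * k ζ) from funext hw]
    refine continuous_finsetProd _ fun ζ hζ => ?_
    exact (continuous_const.inner continuous_id).abs.rpow_const fun _ =>
      Or.inr (mul_nonneg zero_le_two (hk0 ζ (hRpsub hζ)))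
  have hfin : ∀ x r, μ (ball x r) < ∞ := fun x r =>
    hμ ▸ measure_ball_lt_top_withDensity hwc x r
  have : SFinite μ := hμ ▸ inferInstance
  have : Finite G := hG ▸ finite_closure_reflections Rs hRsnorm hRsrefl
  have := Fintype.ofFinite G
  obtain ⟨A, hAtop, hA⟩ := exists_lintegral_inv_measure_ball_gaussian_le μ
  set K := ENNReal.ofReal (2 * C₀) * (Fintype.card G * A) with hK
  have hKtop : K ≠ ∞ := by finiteness
  refine ⟨K.toReal + 1, by positivity, fun j x₀ g hg hsupp => ?_⟩
  set r : ℝ := 2 ^ (-(j : ℝ) / 2) with hr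
  have hr0 : 0 < r := by positivity
  have hR : (2 : ℝ) ^ (-(j : ℝ)) = r ^ 2 := by
    rw [hr, ← rpow_natCast, ← rpow_mul zero_le_two]
    congr 1
    push_cast
    ring
  have hr3 : (2 : ℝ) ^ (3 - (j : ℝ) / 2) = 8 * r := by
    rw [show 3 - (j : ℝ) / 2 = 3 + -(j : ℝ) / 2 by ring, rpow_add two_pos]
    norm_num [hr]
  have hr1 : (2 : ℝ) ^ (1 - (j : ℝ) / 2) = 2 * r := by
    rw [show 1 - (j : ℝ) / 2 = 1 + -(j : ℝ) / 2 by ring, rpow_add two_pos]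
    norm_num [hr]
  rw [hr1] at hsupp
  rw [hR, hr3]
  have hgm : AEMeasurable (fun y => ‖g y‖ₑ) μ := hg.1.enorm
  set f := hgm.mk with hf
  set a : ℕ → ℝ := fun i => √((1 / 2) ^ (i + 1) * r ^ 2 / c₀) with ha
  have ha0 (i : ℕ) : 0 < a i := sqrt_pos.2 (by positivity)
  have hint : ∫⁻ y, f y ∂μ = ENNReal.ofReal (∫ y, |g y| ∂μ) := by
    rw [lintegral_congr_ae hgm.ae_eq_mk.symm, ← ofReal_integral_norm_eq_lintegral_enorm hg]
    rfl
  have hpt : ∀ x ∈ (ball x₀ (8 * r))ᶜ, ∀ t ∈ Set.Ioc (0 : ℝ) (r ^ 2),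
      ‖∫ y, ht t x y * |g y| ∂μ‖ₑ ≤ ∑' i : ℕ, (∫⁻ y, ENNReal.ofReal (C₀ * (1 / 2) ^ i) *
        orbitKernel μ G (a i) x y * f y ∂μ) := by
    rintro x hx t ⟨ht0, htr⟩
    obtain ⟨i, hi1, hi2⟩ := exists_nat_pow_near_of_lt_one (x := t / r ^ 2) (y := 1 / 2)
      (by positivity) (div_le_one_of_le₀ htr (by positivity)) (by norm_num) (by norm_num)
    rw [lt_div_iff₀ (by positivity)] at hi1
    rw [div_le_iff₀ (by positivity)] at hi2
    refine (enorm_integral_le_lintegral_enorm _).trans (le_trans ?_ (ENNReal.le_tsum i))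
    refine lintegral_mono_ae ?_
    filter_upwards [hgm.ae_eq_mk] with y hy
    rw [enorm_mul, enorm_abs, hy]
    rcases eq_or_ne (g y) 0 with h0 | h0
    · simp [hf, ← hy, h0]
    refine mul_le_mul' ?_ le_rfl
    have hxy : r ^ 2 ≤ ‖x - y‖ ^ 2 := by
      have h1 : dist y x₀ < 2 * r := hsupp h0
      have h2 : 8 * r ≤ dist x x₀ := by simpa using hx
      have h3 := dist_triangle x y x₀
      rw [← dist_eq_norm]
      gcongr
      linarith
    rw [Real.enorm_of_nonneg (hnn t ht0 x y)]
    refine (ENNReal.ofReal_le_ofReal (hGauss t ht0 x y)).trans ?_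
    rw [hdO]
    exact ofReal_gaussian_bound_le_orbitKernel μ G hfin hc₀ hC₀ (by positivity) ht0 hi1 hi2 hxy
  have hbound : ‖∫ x in (ball x₀ (8 * r))ᶜ,
      (⨆ t ∈ Set.Ioc (0 : ℝ) (r ^ 2), ∫ y, ht t x y * |g y| ∂μ) ∂μ‖ₑ ≤
      K * ENNReal.ofReal (∫ y, |g y| ∂μ) := by
    rw [← hint]
    refine (enorm_integral_le_lintegral_enorm _).trans (le_trans ?_
      (lintegral_tsum_orbitKernel_le μ G hC₀ hA ha0 hgm.measurable_mk))
    refine (setLIntegral_mono' measurableSet_ball.compl fun x hx => ?_).trans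
      (setLIntegral_le_lintegral _ _)
    exact enorm_biSup_le (hpt x hx) fun t ht =>
      integral_nonneg fun y => mul_nonneg (hnn t ht.1 x y) (abs_nonneg _)
  have hg0 : 0 ≤ ∫ y, |g y| ∂μ := integral_nonneg fun _ => abs_nonneg _
  rw [← ENNReal.ofReal_toReal hKtop, ← ENNReal.ofReal_mul ENNReal.toReal_nonneg] at hbound
  refine (le_abs_self _).trans ?_
  rw [← Real.norm_eq_abs, ← ENNReal.ofReal_le_ofReal_iff (by positivity), ofReal_norm]
  exact hbound.trans (ENNReal.ofReal_le_ofReal (by gcongr; linarith))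
end
end

section
/- Let f ∈ BMO(𝓛_k) and let a be a measurable function on ℝ^n such that supp(a) ⊂ B(x₀,r₀) for some x₀ ∈ ℝ^n and r₀ > 0, ‖a‖_∞ ≤ ω_k(B(x₀,r₀))^{−1}, and ∫_{ℝ^n} a dω_k = 0 whenever r₀ < ρ_k(x₀). Then the product f·a is integrable with respect to ω_k and |∫_{ℝ^n} f(x)·a(x)·w_k(x) dx| ≤ ‖f‖_{BMO(𝓛_k)}. -/
open MeasureTheory Metric Real
open scoped ENNReal RealInnerProductSpace

set_option linter.unusedVariables false

noncomputable section

/-- Integrating against a function bounded by `μ(s)⁻¹` is controlled by the average on `s`. -/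
theorem abs_setIntegral_mul_le_setAverage {α : Type*} [MeasurableSpace α] {μ : Measure α}
    {s : Set α} {g a : α → ℝ} (hg : IntegrableOn g s μ)
    (ha : ∀ᵐ x ∂μ, |a x| ≤ (μ s).toReal⁻¹) :
    |∫ x in s, g x * a x ∂μ| ≤ ⨍ x in s, |g x| ∂μ := by
  rw [setAverage_eq, smul_eq_mul, ← integral_const_mul]
  refine norm_integral_le_of_norm_le (f := fun x => g x * a x) (hg.abs.const_mul _) ?_
  filter_upwards [ae_restrict_of_ae ha] with x hx
  rw [Real.norm_eq_abs, abs_mul, mul_comm]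
  exact mul_le_mul_of_nonneg_right hx (abs_nonneg _)

/-- If `f ∈ BMO(𝓛_k)` and `a` is an `H¹_(𝓛_k)`-atom (supported in `B(x₀,r₀)`, bounded by
`ω_k(B(x₀,r₀))⁻¹`, with vanishing integral when `r₀ < ρ_k(x₀)`), then `f·a` is integrable
and `|∫ f a dω_k| ≤ ‖f‖_(BMO(𝓛_k))`. -/
theorem bmoL_pairing_with_atom
    (n : ℕ) (hn : 0 < n)
    (Rs Rp : Finset (EuclideanSpace ℝ (Fin n)))
    (hRs0 : (0 : EuclideanSpace ℝ (Fin n)) ∉ Rs)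
    (hRsnorm : ∀ ζ ∈ Rs, ⟪ζ, ζ⟫ = (2 : ℝ))
    (hRsrefl : ∀ ζ ∈ Rs, ∀ η ∈ Rs, η - ⟪η, ζ⟫ • ζ ∈ Rs)
    (hRsline : ∀ ζ ∈ Rs, ∀ c : ℝ, c • ζ ∈ Rs → c = 1 ∨ c = -1)
    (b : EuclideanSpace ℝ (Fin n))
    (hRpdef : ∀ ζ ∈ Rs, (ζ ∈ Rp ↔ 0 < ⟪ζ, b⟫)) (hRpsub : Rp ⊆ Rs)
    (k : EuclideanSpace ℝ (Fin n) → ℝ)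
    (hk0 : ∀ ζ ∈ Rs, 0 ≤ k ζ)
    (hkinv : ∀ ζ ∈ Rs, ∀ η ∈ Rs, k (η - ⟪η, ζ⟫ • ζ) = k η)
    (w : EuclideanSpace ℝ (Fin n) → ℝ)
    (hw : ∀ x, w x = ∏ ζ ∈ Rp, |⟪ζ, x⟫| ^ (2 * k ζ))
    (γ : ℝ) (hγ : γ = ∑ ζ ∈ Rp, k ζ)
    (μ : Measure (EuclideanSpace ℝ (Fin n)))
    (hμ : μ = volume.withDensity (fun x => ENNReal.ofReal (w x)))
    (V : EuclideanSpace ℝ (Fin n) → ℝ)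
    (hV0 : ∀ x, 0 ≤ V x)
    (hVloc : LocallyIntegrable V μ)
    (hVne : ¬ (∀ᵐ x ∂μ, V x = 0))
    (q : ℝ) (hq : max 1 (((n : ℝ) + 2 * γ) / 2) < q)
    (C_RH : ℝ) (hC_RH : 0 < C_RH)
    (hRH : ∀ (x : EuclideanSpace ℝ (Fin n)) (r : ℝ), 0 < r →
      (⨍ y in Metric.ball x r, V y ^ q ∂μ) ^ (1 / q) ≤
        C_RH * ⨍ y in Metric.ball x r, V y ∂μ)
    (ρ : EuclideanSpace ℝ (Fin n) → ℝ)
    (hρdef : ∀ x, ρ x = sSup {r : ℝ | 0 < r ∧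
      r ^ 2 / (μ (Metric.ball x r)).toReal * ∫ y in Metric.ball x r, V y ∂μ ≤ 1})
    (hρpos : ∀ x, 0 < ρ x)
    (f : EuclideanSpace ℝ (Fin n) → ℝ) (hfloc : LocallyIntegrable f μ)
    (Cf : ℝ) (hCf0 : 0 ≤ Cf) (hCf : IsBMOL μ ρ f Cf)
    (a : EuclideanSpace ℝ (Fin n) → ℝ) (hameas : Measurable a)
    (x₀ : EuclideanSpace ℝ (Fin n)) (r₀ : ℝ) (hr₀ : 0 < r₀)
    (hsupp : Function.support a ⊆ Metric.ball x₀ r₀)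
    (hbound : ∀ᵐ x ∂μ, |a x| ≤ ((μ (Metric.ball x₀ r₀)).toReal)⁻¹)
    (hcancel : r₀ < ρ x₀ → ∫ x, a x ∂μ = 0) :
    Integrable (fun x => f x * a x) μ ∧ |∫ x, f x * a x ∂μ| ≤ Cf := by
  have hfB : IntegrableOn f (ball x₀ r₀) μ :=
    (hfloc.integrableOn_isCompact (isCompact_closedBall x₀ r₀)).mono_set ball_subset_closedBall
  have hbB : ∀ᵐ x ∂μ.restrict (ball x₀ r₀), ‖a x‖ ≤ ((μ (ball x₀ r₀)).toReal)⁻¹ :=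
    ae_restrict_of_ae hbound
  have hsupp_mul : Function.support (fun x => f x * a x) ⊆ ball x₀ r₀ :=
    (Function.support_mul_subset_right f a).trans hsupp
  have hfaB : IntegrableOn (fun x => f x * a x) (ball x₀ r₀) μ :=
    hfB.mul_bdd hameas.aestronglyMeasurable hbB
  refine ⟨(integrableOn_iff_integrable_of_support_subset hsupp_mul).1 hfaB, ?_⟩
  rw [← setIntegral_eq_integral_of_forall_compl_eq_zero (s := ball x₀ r₀)
    fun x hx => Function.notMem_support.1 fun h => hx (hsupp_mul h)]
  rcases lt_or_ge r₀ (ρ x₀) with hlt | hge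
  · rcases eq_or_ne (μ (ball x₀ r₀)) ∞ with htop | hfin
    · have ha0 : ∀ᵐ x ∂μ.restrict (ball x₀ r₀), f x * a x = 0 := by
        filter_upwards [hbB] with x hx
        rw [htop, ENNReal.toReal_top, inv_zero] at hx
        rw [norm_le_zero_iff.1 hx, mul_zero]
      rw [integral_congr_ae ha0, integral_zero, abs_zero]
      exact hCf0
    · set c := ⨍ z in ball x₀ r₀, f z ∂μ
      have haB : IntegrableOn a (ball x₀ r₀) μ :=
        Measure.integrableOn_of_bounded hfin hameas.aestronglyMeasurable hbB
      have hcB : IntegrableOn (fun _ => c) (ball x₀ r₀) μ := integrableOn_const hfin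
      have hint : ∫ x in ball x₀ r₀, a x ∂μ = 0 := by
        rw [setIntegral_eq_integral_of_forall_compl_eq_zero
          fun x hx => Function.notMem_support.1 fun h => hx (hsupp h)]
        exact hcancel hlt
      have hsub : ∫ x in ball x₀ r₀, f x * a x ∂μ = ∫ x in ball x₀ r₀, (f x - c) * a x ∂μ := by
        simp_rw [sub_mul]
        rw [integral_sub hfaB (haB.const_mul c), integral_const_mul, hint, mul_zero, sub_zero]
      rw [hsub]
      exact (abs_setIntegral_mul_le_setAverage (g := fun x => f x - c) (hfB.sub hcB) hbound).trans
        (hCf.1 x₀ r₀ hr₀ hlt)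
  · exact (abs_setIntegral_mul_le_setAverage hfB hbound).trans (hCf.2 x₀ r₀ hge)
end
end

section
/- Let f ∈ BMO(𝓛_k), x₀ ∈ ℝ^n, and C₀ ≥ 1. Then M_k f(x) < ∞ for almost every x ∈ B(x₀, C₀·ρ_k(x₀)). -/
open MeasureTheory Metric Real
open scoped ENNReal RealInnerProductSpace

set_option linter.unusedVariables false

noncomputable section

/-- The uncentered weighted Hardy–Littlewood maximal function
`M_k f(x) = sup {ω_k(B)⁻¹ ∫_B |f| dω_k : B a ball containing x}`. -/
def maximalFn {α : Type*} [MeasurableSpace α] [PseudoMetricSpace α]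
    (μ : Measure α) (f : α → ℝ) (x : α) : ℝ≥0∞ :=
  ⨆ (y : α) (r : ℝ) (_ : x ∈ Metric.ball y r),
    (μ (Metric.ball y r))⁻¹ * ∫⁻ z in Metric.ball y r, ENNReal.ofReal |f z| ∂μ

theorem ofReal_setAverage_abs {α : Type*} [MeasurableSpace α] {μ : Measure α}
    {f : α → ℝ} {s : Set α}
    (hf : IntegrableOn f s μ) :
    (μ s)⁻¹ * ∫⁻ z in s, ENNReal.ofReal |f z| ∂μ = ENNReal.ofReal (⨍ z in s, |f z| ∂μ) := by
  rw [ofReal_setAverage hf.abs (ae_of_all _ fun z => abs_nonneg (f z)), ENNReal.div_eq_inv_mul]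

section DoublingMeasure

open Filter Topology
open scoped NNReal

variable {α : Type*} [PseudoMetricSpace α] [MeasurableSpace α] {μ : Measure α} {D : ℝ≥0}

theorem measure_ball_two_pow_mul_le
    (hD : ∀ (x : α) (r : ℝ), 0 < r → μ (ball x (2 * r)) ≤ D * μ (ball x r))
    (m : ℕ) (x : α) {r : ℝ} (hr : 0 < r) :
    μ (ball x (2 ^ m * r)) ≤ (D : ℝ≥0∞) ^ m * μ (ball x r) := by
  induction m with
  | zero => simp
  | succ m ih =>
    calc μ (ball x (2 ^ (m + 1) * r)) = μ (ball x (2 * (2 ^ m * r))) := by ring_nf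
      _ ≤ D * μ (ball x (2 ^ m * r)) := hD x _ (by positivity)
      _ ≤ D * ((D : ℝ≥0∞) ^ m * μ (ball x r)) := by gcongr
      _ = (D : ℝ≥0∞) ^ (m + 1) * μ (ball x r) := by rw [pow_succ]; ring

theorem IsUnifLocDoublingMeasure.of_ball
    (hD : ∀ (x : α) (r : ℝ), 0 < r → μ (ball x (2 * r)) ≤ D * μ (ball x r)) :
    IsUnifLocDoublingMeasure μ := by
  refine ⟨D ^ 2, ?_⟩
  filter_upwards [self_mem_nhdsWithin] with r (hr : 0 < r) x
  calc μ (closedBall x (2 * r)) ≤ μ (ball x (2 ^ 2 * r)) :=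
        measure_mono (closedBall_subset_ball (by linarith))
    _ ≤ (D : ℝ≥0∞) ^ 2 * μ (ball x r) := measure_ball_two_pow_mul_le hD 2 x hr
    _ ≤ ((D ^ 2 : ℝ≥0) : ℝ≥0∞) * μ (closedBall x r) := by
        push_cast
        gcongr
        exact ball_subset_closedBall

/-- Comparison of the average over a ball with the average over a set of comparable size. -/
theorem inv_measure_ball_mul_lintegral_le
    (hD : ∀ (x : α) (r : ℝ), 0 < r → μ (ball x (2 * r)) ≤ D * μ (ball x r))
    (hfin : ∀ (x : α) (r : ℝ), μ (ball x r) ≠ ⊤) {s t : Set α} (m : ℕ) {y : α} {r : ℝ}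
    (hr : 0 < r) (hs : ball y r ⊆ s) (ht : t ⊆ ball y (2 ^ m * r)) (ht0 : μ t ≠ 0)
    (g : α → ℝ≥0∞) :
    (μ (ball y r))⁻¹ * ∫⁻ z in ball y r, g z ∂μ ≤
      (D : ℝ≥0∞) ^ m * ((μ t)⁻¹ * ∫⁻ z in s, g z ∂μ) := by
  have htle : μ t ≤ (D : ℝ≥0∞) ^ m * μ (ball y r) :=
    (measure_mono ht).trans (measure_ball_two_pow_mul_le hD m y hr)
  have hball : μ (ball y r) ≠ 0 := by
    intro h
    rw [h, mul_zero] at htle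
    exact ht0 (le_antisymm htle zero_le)
  have htfin : μ t ≠ ⊤ := ne_top_of_le_ne_top (hfin _ _) (measure_mono ht)
  have hinv : (μ (ball y r))⁻¹ ≤ (D : ℝ≥0∞) ^ m * (μ t)⁻¹ := by
    rw [← div_eq_mul_inv, ENNReal.le_div_iff_mul_le (Or.inl ht0) (Or.inl htfin), mul_comm,
      ← div_eq_mul_inv]
    exact ENNReal.div_le_of_le_mul htle
  rw [← mul_assoc]
  exact mul_le_mul' hinv (lintegral_mono_set hs)

theorem IsUnifLocDoublingMeasure.ae_exists_setAverage_closedBall_le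
    [SecondCountableTopology α] [BorelSpace α] [IsLocallyFiniteMeasure μ]
    [IsUnifLocDoublingMeasure μ] {g : α → ℝ} (hg : LocallyIntegrable g μ) :
    ∀ᵐ x ∂μ, ∃ δ > 0, ∀ (y : α) (r : ℝ), 0 < r → r < δ → x ∈ closedBall y r →
      ⨍ z in closedBall y r, g z ∂μ ≤ g x + 1 := by
  filter_upwards [IsUnifLocDoublingMeasure.ae_tendsto_average (μ := μ) hg 1] with x hx
  have h := hx (ι := α × ℝ)
    (l := comap Prod.snd (𝓝[>] (0 : ℝ)) ⊓ 𝓟 {p | x ∈ closedBall p.1 p.2})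
    Prod.fst Prod.snd (tendsto_comap.mono_left inf_le_left)
    (by filter_upwards [mem_inf_of_right (mem_principal_self _)] with p hp; simpa using hp)
  have h2 := h.eventually (ge_mem_nhds (lt_add_one (g x)))
  rw [eventually_inf_principal, eventually_comap, eventually_nhdsWithin_iff,
    Metric.eventually_nhds_iff] at h2
  obtain ⟨δ, hδ, h3⟩ := h2
  refine ⟨δ, hδ, fun y r hr hrδ hxy => ?_⟩
  exact h3 (y := r) (by simpa [abs_of_pos hr] using hrδ) hr (y, r) rfl hxy

/-- For a doubling measure, the maximal function of a locally integrable function is finite almost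
everywhere as soon as the averages over large balls with a fixed centre are bounded. -/
theorem ae_maximalFn_lt_top [ProperSpace α] [BorelSpace α] [IsLocallyFiniteMeasure μ]
    (hD : ∀ (x : α) (r : ℝ), 0 < r → μ (ball x (2 * r)) ≤ D * μ (ball x r))
    (hpos : ∀ (x : α) (r : ℝ), 0 < r → μ (ball x r) ≠ 0)
    {f : α → ℝ} (hf : LocallyIntegrable f μ) {x₀ : α} {R C : ℝ} (hR : 0 < R)
    (hC : ∀ r, R ≤ r → ⨍ z in ball x₀ r, |f z| ∂μ ≤ C) :
    ∀ᵐ x ∂μ, maximalFn μ f x < ⊤ := by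
  have hfin (x : α) (r : ℝ) : μ (ball x r) ≠ ⊤ := measure_ball_lt_top.ne
  have hint (x : α) (r : ℝ) : IntegrableOn f (closedBall x r) μ :=
    hf.integrableOn_isCompact (isCompact_closedBall x r)
  have : IsUnifLocDoublingMeasure μ := .of_ball hD
  have habs : LocallyIntegrable (fun z => |f z|) μ := fun x =>
    let ⟨s, hs, h⟩ := hf x
    ⟨s, hs, h.abs⟩
  filter_upwards [IsUnifLocDoublingMeasure.ae_exists_setAverage_closedBall_le habs]
    with x ⟨δ, hδ, hx⟩
  set R' := max R (dist x x₀)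
  have hRR' : R ≤ R' := le_max_left _ _
  have hdist : dist x x₀ ≤ R' := le_max_right _ _
  set A := (D : ℝ≥0∞) ^ 1 * ENNReal.ofReal (|f x| + 1)
  set B := (D : ℝ≥0∞) ^ 1 * ((μ (ball x δ))⁻¹ *
    ∫⁻ z in closedBall x (2 * R'), ENNReal.ofReal |f z| ∂μ)
  set E := (D : ℝ≥0∞) ^ 3 * ENNReal.ofReal C
  have hA : A < ⊤ := ENNReal.mul_lt_top (by simp) (by simp)
  have hE : E < ⊤ := ENNReal.mul_lt_top (ENNReal.pow_lt_top ENNReal.coe_lt_top) (by simp)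
  have hB : B < ⊤ := by
    refine ENNReal.mul_lt_top (by simp) (ENNReal.mul_lt_top ?_ ?_)
    · exact ENNReal.inv_lt_top.2 (pos_iff_ne_zero.2 (hpos x δ hδ))
    · have := (hint x (2 * R')).hasFiniteIntegral
      simpa [HasFiniteIntegral, enorm_eq_ofReal_abs] using this
  refine lt_of_le_of_lt ?_ (max_lt hA (max_lt hB hE))
  refine iSup_le fun y => iSup_le fun r => iSup_le fun hxy => ?_
  have hr : 0 < r := pos_of_mem_ball hxy
  rw [mem_ball] at hxy
  rcases lt_or_ge r δ with hrδ | hδr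
  · refine le_trans ?_ (le_max_left _ _)
    have h0 : μ (closedBall y r) ≠ 0 := fun h =>
      hpos y r hr (measure_mono_null ball_subset_closedBall h)
    refine (inv_measure_ball_mul_lintegral_le hD hfin 1 hr ball_subset_closedBall
      (closedBall_subset_ball (by linarith)) h0 _).trans ?_
    rw [ofReal_setAverage_abs (hint y r)]
    exact mul_le_mul' le_rfl (ENNReal.ofReal_le_ofReal
      (hx y r hr hrδ (mem_closedBall.2 hxy.le)))
  refine le_trans ?_ (le_max_right _ _)
  rcases le_or_gt r R' with hrR | hRr
  · refine le_trans ?_ (le_max_left _ _)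
    refine inv_measure_ball_mul_lintegral_le hD hfin 1 hr ?_ ?_ (hpos x δ hδ) _
    · refine ball_subset_closedBall.trans (closedBall_subset_closedBall' ?_)
      rw [dist_comm]; linarith
    · exact ball_subset_ball' (by linarith)
  · refine le_trans ?_ (le_max_right _ _)
    have hyx₀ : dist y x₀ ≤ 2 * r := by
      have := dist_triangle_left y x₀ x
      linarith
    refine (inv_measure_ball_mul_lintegral_le hD hfin (s := ball x₀ (3 * r))
      (t := ball x₀ (3 * r)) 3 hr (ball_subset_ball' (by linarith))
      (ball_subset_ball' (by rw [dist_comm]; linarith)) (hpos _ _ (by positivity)) _).trans ?_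
    rw [ofReal_setAverage_abs ((hint x₀ (3 * r)).mono_set ball_subset_closedBall)]
    exact mul_le_mul' le_rfl (ENNReal.ofReal_le_ofReal (hC _ (by linarith)))

end DoublingMeasure

section ReflectionWeight

open scoped NNReal

variable {E : Type*} [NormedAddCommGroup E] [InnerProductSpace ℝ E]

/-- Every ball contains a point whose distance to each of finitely many hyperplanes is comparable
to the radius. -/
theorem exists_mul_le_abs_inner_of_pos (S : Finset E) (b : E)
    (hb : ∀ ζ ∈ S, 0 < (⟪ζ, b⟫ : ℝ)) :
    ∃ c > (0 : ℝ), ∀ (x : E) (r : ℝ), 0 < r →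
      ∃ y, dist y x ≤ r / 2 ∧ ∀ ζ ∈ S, c * r ≤ |(⟪ζ, y⟫ : ℝ)| := by
  obtain ⟨a, ha, hab⟩ : ∃ a > (0 : ℝ), ∀ ζ ∈ S, a ≤ ⟪ζ, b⟫ := by
    rcases S.eq_empty_or_nonempty with rfl | hS
    · exact ⟨1, one_pos, by simp⟩
    · obtain ⟨η, hη, hmin⟩ := S.exists_min_image (fun ζ => (⟪ζ, b⟫ : ℝ)) hS
      exact ⟨_, hb η hη, hmin⟩
  set σ : ℝ := 1 / (2 * (S.card + 1) * (‖b‖ + 1)) with hσ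
  have hσ0 : 0 < σ := by positivity
  refine ⟨σ * a / 3, by positivity, fun x r hr => ?_⟩
  by_contra! hcon
  have hnear : ∀ j ∈ Finset.range (S.card + 1), dist (x + ((j : ℝ) * σ * r) • b) x ≤ r / 2 := by
    intro j hj
    have hj' : (j : ℝ) ≤ S.card + 1 := by
      exact_mod_cast (Finset.mem_range.1 hj).le
    rw [dist_self_add_left, norm_smul, Real.norm_of_nonneg (by positivity)]
    calc (j : ℝ) * σ * r * ‖b‖ ≤ (S.card + 1) * σ * r * (‖b‖ + 1) := by gcongr; linarith
      _ = r / 2 := by rw [hσ]; field_simp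
  choose! g hgS hg using fun j hj => hcon _ (hnear j hj)
  obtain ⟨i, hi, j, hj, hij, hgij⟩ := Finset.exists_ne_map_eq_of_card_lt_of_maps_to
    (s := Finset.range (S.card + 1)) (t := S) (by simp) (f := g) hgS
  have h1 := hg i hi
  have h2 := hg j hj
  rw [hgij] at h1
  have hgb := hab _ (hgS j hj)
  simp only [inner_add_right, real_inner_smul_right] at h1 h2
  have h3 : |((i : ℝ) - j) * (σ * r * ⟪g j, b⟫)| < 2 * (σ * a / 3 * r) := by
    rw [abs_lt] at h1 h2 ⊢
    constructor <;> nlinarith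
  have h4 : (1 : ℝ) ≤ |(i : ℝ) - j| := by
    exact_mod_cast Int.one_le_abs (sub_ne_zero.2 (Nat.cast_injective.ne hij : (i : ℤ) ≠ j))
  have h5 : σ * a * r ≤ σ * r * ⟪g j, b⟫ := by
    calc σ * a * r = σ * r * a := by ring
      _ ≤ _ := by gcongr
  have h6 : 0 < σ * a * r := by positivity
  rw [abs_mul, abs_of_pos (h6.trans_le h5)] at h3
  nlinarith

/-- The upper bound on a doubled ball of a product of powers of linear forms is comparable to its
lower bound on a subball. -/
theorem exists_prod_abs_inner_rpow_comparable (S : Finset E) (b : E)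
    (hb : ∀ ζ ∈ S, 0 < (⟪ζ, b⟫ : ℝ)) (p : E → ℝ) (hp : ∀ ζ ∈ S, 0 ≤ p ζ) :
    ∃ ε > (0 : ℝ), ∃ K > (0 : ℝ), ∀ (x : E) (r : ℝ), 0 < r → ∃ y, ∃ M > (0 : ℝ),
      ball y (ε * r) ⊆ ball x r ∧
      (∀ z ∈ ball x (2 * r), ∏ ζ ∈ S, |(⟪ζ, z⟫ : ℝ)| ^ p ζ ≤ M) ∧
      ∀ z ∈ ball y (ε * r), M ≤ K * ∏ ζ ∈ S, |(⟪ζ, z⟫ : ℝ)| ^ p ζ := by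
  obtain ⟨c, hc, hcS⟩ := exists_mul_le_abs_inner_of_pos S b hb
  obtain ⟨L, hL, hLS⟩ : ∃ L > (0 : ℝ), ∀ ζ ∈ S, ‖ζ‖ ≤ L := by
    refine ⟨1 + ∑ ζ ∈ S, ‖ζ‖, by positivity, fun ζ hζ => ?_⟩
    have := Finset.single_le_sum (f := fun ζ : E => ‖ζ‖) (fun _ _ => norm_nonneg _) hζ
    linarith
  have hdiff : ∀ ζ ∈ S, ∀ u v : E, |(⟪ζ, u⟫ : ℝ)| ≤ |(⟪ζ, v⟫ : ℝ)| + L * dist u v := by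
    intro ζ hζ u v
    have h1 := abs_sub_abs_le_abs_sub (⟪ζ, u⟫ : ℝ) ⟪ζ, v⟫
    rw [← inner_sub_right] at h1
    have h2 := abs_real_inner_le_norm ζ (u - v)
    rw [← dist_eq_norm] at h2
    have h3 : ‖ζ‖ * dist u v ≤ L * dist u v :=
      mul_le_mul_of_nonneg_right (hLS ζ hζ) dist_nonneg
    linarith
  set ε : ℝ := min (1 / 2) (c / (2 * L))
  have hε : 0 < ε := by positivity
  have hε1 : ε ≤ 1 / 2 := min_le_left _ _
  have hε2 : L * ε ≤ c / 2 := by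
    calc L * ε ≤ L * (c / (2 * L)) := by gcongr; exact min_le_right _ _
      _ = c / 2 := by field_simp
  set κ : ℝ := 1 + 6 * L / c
  have hκ : 0 < κ := by positivity
  refine ⟨ε, hε, ∏ ζ ∈ S, κ ^ p ζ, Finset.prod_pos fun ζ _ => by positivity, fun x r hr => ?_⟩
  obtain ⟨y, hyx, hyS⟩ := hcS x r hr
  refine ⟨y, ∏ ζ ∈ S, (|(⟪ζ, x⟫ : ℝ)| + 2 * L * r) ^ p ζ,
    Finset.prod_pos fun ζ _ => by positivity, ?_, ?_, ?_⟩
  · exact ball_subset_ball' (by nlinarith)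
  · intro z hz
    rw [mem_ball] at hz
    refine Finset.prod_le_prod (fun ζ _ => by positivity) fun ζ hζ => ?_
    refine Real.rpow_le_rpow (abs_nonneg _) ?_ (hp ζ hζ)
    have := hdiff ζ hζ z x
    nlinarith
  · intro z hz
    rw [mem_ball] at hz
    rw [← Finset.prod_mul_distrib]
    refine Finset.prod_le_prod (fun ζ _ => by positivity) fun ζ hζ => ?_
    rw [← Real.mul_rpow hκ.le (abs_nonneg _)]
    refine Real.rpow_le_rpow (by positivity) ?_ (hp ζ hζ)
    have hyz := hdiff ζ hζ y z
    have hxz := hdiff ζ hζ x z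
    have hy := hyS ζ hζ
    rw [dist_comm] at hyz
    have h1 : L * dist z y ≤ c / 2 * r := by
      calc L * dist z y ≤ L * (ε * r) := by gcongr
        _ = L * ε * r := by ring
        _ ≤ c / 2 * r := by gcongr
    have h2 : dist x z ≤ r := by
      have := dist_triangle_left x z y
      rw [dist_comm y z] at this
      nlinarith
    have h3 : L * dist x z ≤ L * r := by gcongr
    have h4 : 3 * L * r ≤ 6 * L / c * |(⟪ζ, z⟫ : ℝ)| := by
      calc 3 * L * r = 6 * L / c * (c / 2 * r) := by field_simp; norm_num
        _ ≤ _ := by gcongr; linarith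
    calc |(⟪ζ, x⟫ : ℝ)| + 2 * L * r ≤ |(⟪ζ, z⟫ : ℝ)| + 6 * L / c * |(⟪ζ, z⟫ : ℝ)| := by linarith
      _ = κ * |(⟪ζ, z⟫ : ℝ)| := by ring

theorem continuous_prod_abs_inner_rpow (S : Finset E) (p : E → ℝ) (hp : ∀ ζ ∈ S, 0 ≤ p ζ) :
    Continuous fun x : E => ∏ ζ ∈ S, |(⟪ζ, x⟫ : ℝ)| ^ p ζ :=
  continuous_finsetProd _ fun ζ hζ => Continuous.rpow_const (by fun_prop) fun _ => Or.inr (hp ζ hζ)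

/-- A product of nonnegative powers of linear forms is the density of a doubling measure. -/
theorem exists_doubling_withDensity_prod_abs_inner_rpow [FiniteDimensional ℝ E]
    [MeasurableSpace E] [BorelSpace E] (ν : Measure E) [ν.IsAddHaarMeasure] (S : Finset E) (b : E)
    (hb : ∀ ζ ∈ S, 0 < (⟪ζ, b⟫ : ℝ)) (p : E → ℝ) (hp : ∀ ζ ∈ S, 0 ≤ p ζ) {μ : Measure E}
    (hμ : μ = ν.withDensity fun x => ENNReal.ofReal (∏ ζ ∈ S, |(⟪ζ, x⟫ : ℝ)| ^ p ζ)) :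
    ∃ D : ℝ≥0, ∀ (x : E) (r : ℝ), 0 < r →
      μ (ball x r) ≠ 0 ∧ μ (ball x (2 * r)) ≤ D * μ (ball x r) := by
  obtain ⟨ε, hε, K, hK, h⟩ := exists_prod_abs_inner_rpow_comparable S b hb p hp
  set d := Module.finrank ℝ E
  refine ⟨((2 / ε) ^ d * K).toNNReal, fun x r hr => ?_⟩
  obtain ⟨y, M, hM, hsub, hupper, hlower⟩ := h x r hr
  have hball : ν (ball x (2 * r)) = ENNReal.ofReal ((2 / ε) ^ d) * ν (ball y (ε * r)) := by
    rw [Measure.addHaar_ball_of_pos ν x (by positivity : 0 < 2 * r),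
      Measure.addHaar_ball_of_pos ν y (by positivity : 0 < ε * r), ← mul_assoc,
      ← ENNReal.ofReal_mul (by positivity), ← mul_pow]
    congr 3
    field_simp
  have hle : ENNReal.ofReal M * ν (ball y (ε * r)) ≤ ENNReal.ofReal K * μ (ball x r) := by
    calc ENNReal.ofReal M * ν (ball y (ε * r))
        = ∫⁻ _ in ball y (ε * r), ENNReal.ofReal M ∂ν := by rw [setLIntegral_const]
      _ ≤ ∫⁻ z in ball y (ε * r),
            ENNReal.ofReal K * ENNReal.ofReal (∏ ζ ∈ S, |(⟪ζ, z⟫ : ℝ)| ^ p ζ) ∂ν := by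
          refine setLIntegral_mono' measurableSet_ball fun z hz => ?_
          rw [← ENNReal.ofReal_mul hK.le]
          exact ENNReal.ofReal_le_ofReal (hlower z hz)
      _ = ENNReal.ofReal K * μ (ball y (ε * r)) := by
          rw [lintegral_const_mul' _ _ ENNReal.ofReal_ne_top, hμ,
            withDensity_apply _ measurableSet_ball]
      _ ≤ ENNReal.ofReal K * μ (ball x r) := by gcongr
  constructor
  · intro h0
    rw [h0, mul_zero, nonpos_iff_eq_zero, mul_eq_zero] at hle
    rcases hle with h1 | h1
    · exact (ENNReal.ofReal_pos.2 hM).ne' h1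
    · exact (measure_ball_pos ν y (by positivity : 0 < ε * r)).ne' h1
  · calc μ (ball x (2 * r)) ≤ ∫⁻ _ in ball x (2 * r), ENNReal.ofReal M ∂ν := by
          rw [hμ, withDensity_apply _ measurableSet_ball]
          exact setLIntegral_mono' measurableSet_ball fun z hz =>
            ENNReal.ofReal_le_ofReal (hupper z hz)
      _ = ENNReal.ofReal ((2 / ε) ^ d) * (ENNReal.ofReal M * ν (ball y (ε * r))) := by
          rw [setLIntegral_const, hball]; ring
      _ ≤ ENNReal.ofReal ((2 / ε) ^ d) * (ENNReal.ofReal K * μ (ball x r)) := by gcongr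
      _ = ENNReal.ofReal ((2 / ε) ^ d * K) * μ (ball x r) := by
          rw [ENNReal.ofReal_mul (by positivity), mul_assoc]

end ReflectionWeight

/-- For `f ∈ BMO(𝓛_k)`, `x₀ ∈ ℝⁿ`, `C₀ ≥ 1`, the maximal function `M_k f` is finite almost
everywhere on `B(x₀, C₀ ρ_k(x₀))`. -/
theorem maximal_ae_finite_on_critical_ball
    (n : ℕ) (hn : 0 < n)
    (Rs Rp : Finset (EuclideanSpace ℝ (Fin n)))
    (hRs0 : (0 : EuclideanSpace ℝ (Fin n)) ∉ Rs)
    (hRsnorm : ∀ ζ ∈ Rs, ⟪ζ, ζ⟫ = (2 : ℝ))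
    (hRsrefl : ∀ ζ ∈ Rs, ∀ η ∈ Rs, η - ⟪η, ζ⟫ • ζ ∈ Rs)
    (hRsline : ∀ ζ ∈ Rs, ∀ c : ℝ, c • ζ ∈ Rs → c = 1 ∨ c = -1)
    (b : EuclideanSpace ℝ (Fin n))
    (hRpdef : ∀ ζ ∈ Rs, (ζ ∈ Rp ↔ 0 < ⟪ζ, b⟫)) (hRpsub : Rp ⊆ Rs)
    (k : EuclideanSpace ℝ (Fin n) → ℝ)
    (hk0 : ∀ ζ ∈ Rs, 0 ≤ k ζ)
    (hkinv : ∀ ζ ∈ Rs, ∀ η ∈ Rs, k (η - ⟪η, ζ⟫ • ζ) = k η)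
    (w : EuclideanSpace ℝ (Fin n) → ℝ)
    (hw : ∀ x, w x = ∏ ζ ∈ Rp, |⟪ζ, x⟫| ^ (2 * k ζ))
    (γ : ℝ) (hγ : γ = ∑ ζ ∈ Rp, k ζ)
    (μ : Measure (EuclideanSpace ℝ (Fin n)))
    (hμ : μ = volume.withDensity (fun x => ENNReal.ofReal (w x)))
    (V : EuclideanSpace ℝ (Fin n) → ℝ)
    (hV0 : ∀ x, 0 ≤ V x)
    (hVloc : LocallyIntegrable V μ)
    (hVne : ¬ (∀ᵐ x ∂μ, V x = 0))
    (q : ℝ) (hq : max 1 (((n : ℝ) + 2 * γ) / 2) < q)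
    (C_RH : ℝ) (hC_RH : 0 < C_RH)
    (hRH : ∀ (x : EuclideanSpace ℝ (Fin n)) (r : ℝ), 0 < r →
      (⨍ y in Metric.ball x r, V y ^ q ∂μ) ^ (1 / q) ≤
        C_RH * ⨍ y in Metric.ball x r, V y ∂μ)
    (ρ : EuclideanSpace ℝ (Fin n) → ℝ)
    (hρdef : ∀ x, ρ x = sSup {r : ℝ | 0 < r ∧
      r ^ 2 / (μ (Metric.ball x r)).toReal * ∫ y in Metric.ball x r, V y ∂μ ≤ 1})
    (hρpos : ∀ x, 0 < ρ x)
    (f : EuclideanSpace ℝ (Fin n) → ℝ) (hfloc : LocallyIntegrable f μ)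
    (Cf : ℝ) (hCf0 : 0 ≤ Cf) (hCf : IsBMOL μ ρ f Cf)
    (x₀ : EuclideanSpace ℝ (Fin n)) (C₀ : ℝ) (hC₀ : 1 ≤ C₀) :
    ∀ᵐ x ∂μ, x ∈ Metric.ball x₀ (C₀ * ρ x₀) → maximalFn μ f x < ⊤ := by
  obtain rfl : w = fun x => ∏ ζ ∈ Rp, |⟪ζ, x⟫| ^ (2 * k ζ) := funext hw
  have hk : ∀ ζ ∈ Rp, 0 ≤ 2 * k ζ := fun ζ hζ => by
    have := hk0 ζ (hRpsub hζ)
    positivity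
  have hb : ∀ ζ ∈ Rp, (0 : ℝ) < ⟪ζ, b⟫ := fun ζ hζ => (hRpdef ζ (hRpsub hζ)).1 hζ
  obtain ⟨D, hD⟩ := exists_doubling_withDensity_prod_abs_inner_rpow volume Rp b hb
    (fun ζ => 2 * k ζ) hk hμ
  have : IsLocallyFiniteMeasure μ := by
    rw [hμ]
    exact IsLocallyFiniteMeasure.withDensity_ofReal
      (continuous_prod_abs_inner_rpow Rp (fun ζ => 2 * k ζ) hk)
  filter_upwards [ae_maximalFn_lt_top (fun x r hr => (hD x r hr).2) (fun x r hr => (hD x r hr).1)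
    hfloc (hρpos x₀) (hCf.2 x₀)] with x hx _ using hx
end
end

section
/- Let f ∈ BMO(𝓛_k). Then M_k f is locally integrable with respect to ω_k: for every ball B₀ = B(x₀,r₀) with r₀ < ∞, one has ∫_{B₀} M_k f dω_k < ∞. -/
open MeasureTheory Metric Real
open scoped ENNReal RealInnerProductSpace

set_option linter.unusedVariables false

noncomputable section

section Auxiliary

open Set
open scoped NNReal

/-- Open balls have finite positive measure, and doubling the radius multiplies the measure by at
most `D`. -/
structure IsBallDoubling {α : Type*} [MeasurableSpace α] [PseudoMetricSpace α]
    (μ : Measure α) (D : ℝ≥0) : Prop where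
  one_le : 1 ≤ D
  pos : ∀ (x : α) (r : ℝ), 0 < r → 0 < μ (ball x r)
  lt_top : ∀ (x : α) (r : ℝ), μ (ball x r) < ⊤
  double : ∀ (x : α) (r : ℝ), 0 < r → μ (ball x (2 * r)) ≤ D * μ (ball x r)

/-- The total deviation of `f` from the constant `c` on the ball `B(x, s)`. -/
def ballDev {α : Type*} [MeasurableSpace α] [PseudoMetricSpace α]
    (μ : Measure α) (f : α → ℝ) (c : ℝ) (x : α) (s : ℝ) : ℝ≥0∞ :=
  ∫⁻ y in ball x s, ‖f y - c‖ₑ ∂μ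

/-- The average of `f` on the ball `B(x, s)`. -/
def ballAvg {α : Type*} [MeasurableSpace α] [PseudoMetricSpace α]
    (μ : Measure α) (f : α → ℝ) (x : α) (s : ℝ) : ℝ :=
  ⨍ y in ball x s, f y ∂μ

/-- Points of `B(z, R)` where the centered maximal function of `f - f_{B(z, R)}`, restricted to
radii at most `R`, exceeds `t`. -/
def superlevel {α : Type*} [MeasurableSpace α] [PseudoMetricSpace α]
    (μ : Measure α) (f : α → ℝ) (z : α) (R : ℝ) (t : ℝ≥0∞) : Set α :=
  {x ∈ ball z R | ∃ s, 0 < s ∧ s ≤ R ∧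
    t * μ (ball x s) < ballDev μ f (ballAvg μ f z R) x s}

section Doubling

variable {α : Type*} [MeasurableSpace α] [PseudoMetricSpace α] {μ : Measure α} {D : ℝ≥0}

lemma IsBallDoubling.measure_ball_pow_le (h : IsBallDoubling μ D) (x : α) {r : ℝ} (hr : 0 < r)
    (m : ℕ) : μ (ball x (2 ^ m * r)) ≤ (D : ℝ≥0∞) ^ m * μ (ball x r) := by
  induction m with
  | zero => simp
  | succ m ih =>
    calc μ (ball x (2 ^ (m + 1) * r)) = μ (ball x (2 * (2 ^ m * r))) := by ring_nf
      _ ≤ D * μ (ball x (2 ^ m * r)) := h.double _ _ (by positivity)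
      _ ≤ D * ((D : ℝ≥0∞) ^ m * μ (ball x r)) := by gcongr
      _ = (D : ℝ≥0∞) ^ (m + 1) * μ (ball x r) := by ring

lemma IsBallDoubling.measure_ball_le (h : IsBallDoubling μ D) {x y : α} {r s : ℝ} (hr : 0 < r)
    (m : ℕ) (hs : s + dist y x ≤ 2 ^ m * r) :
    μ (ball y s) ≤ (D : ℝ≥0∞) ^ m * μ (ball x r) :=
  (measure_mono (ball_subset_ball' hs)).trans (h.measure_ball_pow_le x hr m)

lemma superlevel_anti (f : α → ℝ) (z : α) (R : ℝ) {t t' : ℝ≥0∞} (htt' : t ≤ t') :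
    superlevel μ f z R t' ⊆ superlevel μ f z R t := by
  rintro x ⟨hx, s, hs, hsR, hlt⟩
  exact ⟨hx, s, hs, hsR, lt_of_le_of_lt (by gcongr) hlt⟩

lemma ballDev_mono (f : α → ℝ) (c : ℝ) {x y : α} {s r : ℝ} (h : s + dist y x ≤ r) :
    ballDev μ f c y s ≤ ballDev μ f c x r :=
  lintegral_mono_set (ball_subset_ball' h)

lemma ballDev_le_add (f : α → ℝ) (c c' : ℝ) (x : α) (s : ℝ) :
    ballDev μ f c x s ≤ ballDev μ f c' x s + ‖c' - c‖ₑ * μ (ball x s) := by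
  calc ballDev μ f c x s ≤ ∫⁻ y in ball x s, (‖f y - c'‖ₑ + ‖c' - c‖ₑ) ∂μ := by
        refine lintegral_mono fun y => ?_
        rw [show f y - c = (f y - c') + (c' - c) by ring]
        exact enorm_add_le _ _
    _ = _ := by
        rw [lintegral_add_right _ measurable_const]
        simp [ballDev]

variable {f : α → ℝ}

lemma enorm_ballAvg_sub_mul_le (h : IsBallDoubling μ D)
    (hf : ∀ x r, IntegrableOn f (ball x r) μ) (c : ℝ) (x : α) {s : ℝ} (hs : 0 < s) :
    ‖ballAvg μ f x s - c‖ₑ * μ (ball x s) ≤ ballDev μ f c x s := by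
  have h0 := (h.pos x s hs).ne'
  have h1 := (h.lt_top x s).ne
  have hreal : μ.real (ball x s) ≠ 0 := by
    simp [measureReal_def, ENNReal.toReal_eq_zero_iff, h0, h1]
  have hint : ∫ y in ball x s, (f y - c) ∂μ = (ballAvg μ f x s - c) * μ.real (ball x s) := by
    rw [integral_sub (hf x s) (integrableOn_const h1), setIntegral_const, ballAvg, setAverage_eq]
    simp only [smul_eq_mul]
    field_simp
  have hm : μ (ball x s) = ‖μ.real (ball x s)‖ₑ := by
    rw [Real.enorm_eq_ofReal measureReal_nonneg, measureReal_def, ENNReal.ofReal_toReal h1]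
  rw [hm, ← enorm_mul, ← hint]
  exact enorm_integral_le_lintegral_enorm _

lemma ballDev_ne_top (h : IsBallDoubling μ D)
    (hf : ∀ x r, IntegrableOn f (ball x r) μ) (c : ℝ) (x : α) (s : ℝ) :
    ballDev μ f c x s ≠ ⊤ := by
  have : IntegrableOn (fun y => f y - c) (ball x s) μ :=
    (hf x s).sub (integrableOn_const (h.lt_top x s).ne)
  exact this.2.ne

/-- At scales comparable to the radius of the reference ball, the mean deviation is controlled by
the mean oscillation bound. -/
lemma ballDev_comparable_le (h : IsBallDoubling μ D)
    (hf : ∀ x r, IntegrableOn f (ball x r) μ) {A : ℝ≥0}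
    (hA : ∀ x r, 0 < r → ballDev μ f (ballAvg μ f x r) x r ≤ A * μ (ball x r))
    {x z : α} {R s : ℝ} (hx : x ∈ ball z R) (hRs : R ≤ s) (hs : s ≤ 8 * R) :
    ballDev μ f (ballAvg μ f z R) x s ≤
      ((1 + D ^ 4) * D ^ 5 * A : ℝ≥0) * μ (ball x s) := by
  have hxz : dist x z < R := hx
  have hR : 0 < R := pos_of_mem_ball hx
  set c := ballAvg μ f z (16 * R)
  have hbig : ballDev μ f c z (16 * R) ≤ A * μ (ball z (16 * R)) := hA _ _ (by positivity)
  have hcmp : μ (ball z (16 * R)) ≤ (D : ℝ≥0∞) ^ 4 * μ (ball z R) :=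
    h.measure_ball_le hR 4 (by simp; linarith)
  have hc : ‖c - ballAvg μ f z R‖ₑ ≤ (D : ℝ≥0∞) ^ 4 * A := by
    rw [← ENNReal.mul_le_mul_iff_left (h.pos z R hR).ne' (h.lt_top z R).ne, ← enorm_neg, neg_sub]
    calc _ ≤ ballDev μ f c z R := enorm_ballAvg_sub_mul_le h hf c z hR
      _ ≤ ballDev μ f c z (16 * R) := ballDev_mono f c (by simp; linarith)
      _ ≤ A * ((D : ℝ≥0∞) ^ 4 * μ (ball z R)) := hbig.trans (by gcongr)
      _ = _ := by ring
  calc ballDev μ f (ballAvg μ f z R) x s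
      ≤ ballDev μ f (ballAvg μ f z R) z (16 * R) := ballDev_mono f _ (by linarith)
    _ ≤ ballDev μ f c z (16 * R) + ‖c - ballAvg μ f z R‖ₑ * μ (ball z (16 * R)) :=
        ballDev_le_add _ _ _ _ _
    _ ≤ A * μ (ball z (16 * R)) + (D : ℝ≥0∞) ^ 4 * A * μ (ball z (16 * R)) := by gcongr
    _ = (1 + (D : ℝ≥0∞) ^ 4) * A * μ (ball z (16 * R)) := by ring
    _ ≤ (1 + (D : ℝ≥0∞) ^ 4) * A * ((D : ℝ≥0∞) ^ 5 * μ (ball x s)) := by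
        gcongr
        exact h.measure_ball_le (by linarith) 5 (by rw [dist_comm]; linarith)
    _ = _ := by push_cast; ring

/-- The last radius, up to a factor two, at which a bounded property holds. -/
lemma exists_radius_doubling_fails {P : ℝ → Prop} {R : ℝ} (hP : ∃ s, 0 < s ∧ s ≤ R ∧ P s) :
    ∃ s, 0 < s ∧ s ≤ R ∧ P s ∧ ∀ s', 2 * s ≤ s' → s' ≤ R → ¬ P s' := by
  set T := {s | 0 < s ∧ s ≤ R ∧ P s}
  have hbdd : BddAbove T := ⟨R, fun s hs => hs.2.1⟩
  obtain ⟨s₀, hs₀⟩ : T.Nonempty := hP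
  have hpos : 0 < sSup T := hs₀.1.trans_le (le_csSup hbdd hs₀)
  obtain ⟨s, hs, hlt⟩ := exists_lt_of_lt_csSup ⟨s₀, hs₀⟩ (half_lt_self hpos)
  refine ⟨s, hs.1, hs.2.1, hs.2.2, fun s' h2 hR hP' => ?_⟩
  have := le_csSup hbdd (show s' ∈ T from ⟨by linarith [hs.1], hR, hP'⟩)
  linarith

/-- Localization to a stopping ball: high superlevel points of `B(z, R)` that lie in the dilate
`B(p, 8 r)` of a stopping ball are superlevel points of that dilate. -/
lemma mem_superlevel_of_stopping (h : IsBallDoubling μ D)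
    (hf : ∀ x r, IntegrableOn f (ball x r) μ) {l : ℝ≥0} {z p x : α} {R r : ℝ} (hr : 0 < r)
    (hlarge : ∀ s, 2 * r ≤ s → s ≤ 8 * R →
      ballDev μ f (ballAvg μ f z R) p s ≤ l * μ (ball p s))
    (hrR : r ≤ R) {t : ℝ≥0∞} (hxp : x ∈ ball p (8 * r))
    (hx : x ∈ superlevel μ f z R (((D ^ 2 + 1) * l : ℝ≥0) + t)) :
    x ∈ superlevel μ f p (8 * r) t := by
  obtain ⟨-, s, hs, hsR, hlt⟩ := hx
  have hxp' : dist x p < 8 * r := hxp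
  have h0 := (h.pos x s hs).ne'
  have h1 := (h.lt_top x s).ne
  refine ⟨hxp, s, hs, ?_, ?_⟩
  · by_contra! hsr
    refine hlt.not_ge ?_
    calc ballDev μ f (ballAvg μ f z R) x s
        ≤ ballDev μ f (ballAvg μ f z R) p (2 * s) := ballDev_mono f _ (by linarith)
      _ ≤ l * μ (ball p (2 * s)) := hlarge _ (by linarith) (by linarith)
      _ ≤ l * ((D : ℝ≥0∞) ^ 2 * μ (ball x s)) := by
          gcongr
          exact h.measure_ball_le hs 2 (by rw [dist_comm]; linarith)
      _ = ((D ^ 2) * l : ℝ≥0) * μ (ball x s) := by push_cast; ring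
      _ ≤ (((D ^ 2 + 1) * l : ℝ≥0) + t) * μ (ball x s) := by
          gcongr
          refine le_trans ?_ le_self_add
          gcongr
          exact le_self_add
  · set c := ballAvg μ f p (8 * r)
    have hc : ‖c - ballAvg μ f z R‖ₑ ≤ l := by
      have h8 : 0 < 8 * r := by positivity
      rw [← ENNReal.mul_le_mul_iff_left (h.pos p _ h8).ne' (h.lt_top p (8 * r)).ne]
      exact (enorm_ballAvg_sub_mul_le h hf _ p h8).trans (hlarge _ (by linarith) (by linarith))
    have hle := ballDev_le_add (μ := μ) f (ballAvg μ f z R) c x s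
    by_contra! hcon
    refine hlt.not_ge (hle.trans ?_)
    calc _ ≤ t * μ (ball x s) + l * μ (ball x s) := by gcongr
      _ = (l + t) * μ (ball x s) := by ring
      _ ≤ (((D ^ 2 + 1) * l : ℝ≥0) + t) * μ (ball x s) := by
          gcongr
          exact le_mul_of_one_le_left' (le_add_self)

variable [OpensMeasurableSpace α] [SecondCountableTopology α]

/-- One John–Nirenberg step: raising the level by a fixed amount halves the relative measure of the
superlevel sets. -/
lemma measure_superlevel_add_le (h : IsBallDoubling μ D)
    (hf : ∀ x r, IntegrableOn f (ball x r) μ) {A : ℝ≥0} (hA0 : A ≠ 0)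
    (hA : ∀ x r, 0 < r → ballDev μ f (ballAvg μ f x r) x r ≤ A * μ (ball x r))
    {K l : ℝ≥0} (hK : K = (1 + D ^ 4) * D ^ 5 * A) (hl : l = 2 * D ^ 4 * K)
    {t p : ℝ≥0∞} (ht : ∀ z R, 0 < R → μ (superlevel μ f z R t) ≤ p * μ (ball z R))
    (z : α) {R : ℝ} (hR : 0 < R) :
    μ (superlevel μ f z R (((D ^ 2 + 1) * l : ℝ≥0) + t)) ≤ 2⁻¹ * p * μ (ball z R) := by
  have hD0 : D ≠ 0 := (zero_lt_one.trans_le h.one_le).ne'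
  have hK0 : K ≠ 0 := by rw [hK]; positivity
  have hKl : K ≤ l := by
    rw [hl]
    refine le_mul_of_one_le_left' ?_
    calc (1 : ℝ≥0) ≤ 2 * 1 := by norm_num
      _ ≤ 2 * D ^ 4 := by gcongr; exact one_le_pow₀ h.one_le
  set c := ballAvg μ f z R with hc
  set E := superlevel μ f z R l with hE
  have hsel : ∀ x : E, ∃ s, 0 < s ∧ s ≤ R ∧ l * μ (ball x.1 s) < ballDev μ f c x s ∧
      ∀ s', 2 * s ≤ s' → s' ≤ R → ¬ (l * μ (ball x.1 s') < ballDev μ f c x s') :=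
    fun x => exists_radius_doubling_fails x.2.2
  choose s hs0 hsR hsl hsmax using hsel
  have hlarge : ∀ (x : E) s', 2 * s x ≤ s' → s' ≤ 8 * R →
      ballDev μ f c x s' ≤ l * μ (ball x.1 s') := by
    intro x s' h2 h8
    rcases le_total s' R with hle | hle
    · exact not_lt.1 (hsmax x s' h2 hle)
    · refine (ballDev_comparable_le h hf hA x.2.1 hle h8).trans ?_
      rw [← hK]
      gcongr
  obtain ⟨u, -, hdisj, hcov⟩ := Vitali.exists_disjoint_subfamily_covering_enlargement_closedBall
    (univ : Set E) (fun x => x.1) s R (fun x _ => hsR x) 4 (by norm_num)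
  have hdisj' : u.PairwiseDisjoint fun x => ball x.1 (s x) :=
    hdisj.mono fun x => ball_subset_closedBall
  have hcount : u.Countable := hdisj'.countable_of_isOpen (fun _ _ => isOpen_ball)
    (fun x _ => ⟨x.1, mem_ball_self (hs0 x)⟩)
  have hsub : superlevel μ f z R (((D ^ 2 + 1) * l : ℝ≥0) + t) ⊆
      ⋃ x ∈ u, superlevel μ f x.1 (8 * s x) t := by
    intro x hx
    have hxE : x ∈ E := by
      refine superlevel_anti f z R ?_ hx
      refine le_trans ?_ le_self_add
      gcongr
      exact le_mul_of_one_le_left' le_add_self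
    obtain ⟨b, hbu, hb⟩ := hcov ⟨x, hxE⟩ (mem_univ _)
    have hxb : x ∈ closedBall b.1 (4 * s b) := hb (mem_closedBall_self (hs0 _).le)
    refine mem_biUnion hbu (mem_superlevel_of_stopping h hf (hs0 b) (hlarge b) (hsR b) ?_ hx)
    exact closedBall_subset_ball (by linarith [hs0 b]) hxb
  have hsum : 2 * (D : ℝ≥0∞) ^ 3 * ∑' x : u, μ (ball x.1.1 (s x)) ≤ μ (ball z R) := by
    have h1 : (l : ℝ≥0∞) * ∑' x : u, μ (ball x.1.1 (s x)) ≤ (K * D : ℝ≥0) * μ (ball z R) := by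
      calc (l : ℝ≥0∞) * ∑' x : u, μ (ball x.1.1 (s x))
          = ∑' x : u, l * μ (ball x.1.1 (s x)) := ENNReal.tsum_mul_left.symm
        _ ≤ ∑' x : u, ballDev μ f c x.1.1 (s x) := ENNReal.tsum_le_tsum fun x => (hsl x).le
        _ = ∫⁻ y in ⋃ x ∈ u, ball x.1 (s x), ‖f y - c‖ₑ ∂μ :=
            (lintegral_biUnion hcount (fun _ _ => measurableSet_ball) hdisj' _).symm
        _ ≤ ballDev μ f c z (2 * R) := by
            refine lintegral_mono_set (iUnion₂_subset fun x _ => ball_subset_ball' ?_)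
            have : dist x.1 z < R := x.2.1
            linarith [hsR x]
        _ ≤ K * μ (ball z (2 * R)) := by
            rw [hK]
            exact ballDev_comparable_le h hf hA (mem_ball_self hR) (by linarith) (by linarith)
        _ ≤ K * (D * μ (ball z R)) := by gcongr; exact h.double z R hR
        _ = _ := by push_cast; ring
    have hKD : ((K * D : ℝ≥0) : ℝ≥0∞) ≠ 0 := by
      exact_mod_cast mul_ne_zero hK0 hD0
    rw [← ENNReal.mul_le_mul_iff_right hKD ENNReal.coe_ne_top]
    refine le_trans (le_of_eq ?_) h1
    rw [hl]
    push_cast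
    ring
  calc μ (superlevel μ f z R (((D ^ 2 + 1) * l : ℝ≥0) + t))
      ≤ ∑' x : u, μ (superlevel μ f x.1.1 (8 * s x) t) :=
        (measure_mono hsub).trans (measure_biUnion_le μ hcount _)
    _ ≤ ∑' x : u, p * ((D : ℝ≥0∞) ^ 3 * μ (ball x.1.1 (s x))) := by
        refine ENNReal.tsum_le_tsum fun x => (ht _ _ (by linarith [hs0 x])).trans ?_
        gcongr
        exact h.measure_ball_le (hs0 x) 3 (by simp; norm_num)
    _ = 2⁻¹ * p * (2 * (D : ℝ≥0∞) ^ 3 * ∑' x : u, μ (ball x.1.1 (s x))) := by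
        rw [ENNReal.tsum_mul_left, ENNReal.tsum_mul_left]
        have h2 : (2⁻¹ : ℝ≥0∞) * 2 = 1 := ENNReal.inv_mul_cancel (by norm_num) (by norm_num)
        generalize ∑' x : u, μ (ball x.1.1 (s x)) = σ
        calc p * ((D : ℝ≥0∞) ^ 3 * σ) = 1 * (p * ((D : ℝ≥0∞) ^ 3 * σ)) := (one_mul _).symm
          _ = _ := by rw [← h2]; ring
    _ ≤ 2⁻¹ * p * μ (ball z R) := by gcongr

/-- John–Nirenberg decay for the restricted maximal function. -/
lemma measure_superlevel_nsmul_le (h : IsBallDoubling μ D)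
    (hf : ∀ x r, IntegrableOn f (ball x r) μ) {A : ℝ≥0} (hA0 : A ≠ 0)
    (hA : ∀ x r, 0 < r → ballDev μ f (ballAvg μ f x r) x r ≤ A * μ (ball x r)) :
    ∃ L : ℝ≥0, L ≠ 0 ∧ ∀ (m : ℕ) (z : α) (R : ℝ), 0 < R →
      μ (superlevel μ f z R (m * L)) ≤ 2⁻¹ ^ m * μ (ball z R) := by
  have hD0 : D ≠ 0 := (zero_lt_one.trans_le h.one_le).ne'
  refine ⟨(D ^ 2 + 1) * (2 * D ^ 4 * ((1 + D ^ 4) * D ^ 5 * A)), by positivity, fun m => ?_⟩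
  induction m with
  | zero => intro z R _; simpa using measure_mono fun x hx => hx.1
  | succ m ih =>
    intro z R hR
    have := measure_superlevel_add_le h hf hA0 hA rfl rfl ih z hR
    rwa [pow_succ' (2⁻¹ : ℝ≥0∞), Nat.cast_succ, add_one_mul, add_comm (_ * _)]

/-- The restricted maximal function of `f - f_{B(z, R)}` has a measurable integrable majorant. -/
lemma exists_majorant_ballDev (h : IsBallDoubling μ D)
    (hf : ∀ x r, IntegrableOn f (ball x r) μ) {A : ℝ≥0} (hA0 : A ≠ 0)
    (hA : ∀ x r, 0 < r → ballDev μ f (ballAvg μ f x r) x r ≤ A * μ (ball x r))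
    (z : α) {R : ℝ} (hR : 0 < R) :
    ∃ g : α → ℝ≥0∞, Measurable g ∧ ∫⁻ x, g x ∂μ < ⊤ ∧
      ∀ x ∈ ball z R, ∀ s, 0 < s → s ≤ R →
        ballDev μ f (ballAvg μ f z R) x s ≤ g x * μ (ball x s) := by
  obtain ⟨L, hL0, hL⟩ := measure_superlevel_nsmul_le h hf hA0 hA
  let S : ℕ → Set α := fun m => toMeasurable μ (superlevel μ f z R (m * L))
  have hS : ∀ m, MeasurableSet (S m) := fun m => measurableSet_toMeasurable _ _
  have hmeas : ∀ m, Measurable ((S m).indicator fun _ => (L : ℝ≥0∞)) :=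
    fun m => measurable_const.indicator (hS m)
  refine ⟨fun x => ∑' m, (S m).indicator (fun _ => (L : ℝ≥0∞)) x,
    Measurable.tsum hmeas, ?_, ?_⟩
  · rw [lintegral_tsum fun m => (hmeas m).aemeasurable]
    calc ∑' m, ∫⁻ x, (S m).indicator (fun _ => (L : ℝ≥0∞)) x ∂μ
        ≤ ∑' m : ℕ, 2⁻¹ ^ m * (L * μ (ball z R)) := by
          refine ENNReal.tsum_le_tsum fun m => ?_
          rw [lintegral_indicator_const (hS m), measure_toMeasurable]
          calc _ ≤ L * (2⁻¹ ^ m * μ (ball z R)) := by gcongr; exact hL m z R hR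
            _ = _ := by ring
      _ = 2 * (L * μ (ball z R)) := by
          rw [ENNReal.tsum_mul_right, ENNReal.tsum_geometric, ENNReal.one_sub_inv_two, inv_inv]
      _ < ⊤ := ENNReal.mul_lt_top (by simp) (ENNReal.mul_lt_top (by simp) (h.lt_top z R))
  · intro x hx s hs hsR
    have hb0 := (h.pos x s hs).ne'
    have hLb : (L : ℝ≥0∞) * μ (ball x s) ≠ 0 := mul_ne_zero (by exact_mod_cast hL0) hb0
    have hex : ∃ N : ℕ, ballDev μ f (ballAvg μ f z R) x s ≤ N * (L * μ (ball x s)) := by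
      obtain ⟨N, hN⟩ := ENNReal.exists_nat_mul_gt hLb
        (ballDev_ne_top h hf (ballAvg μ f z R) x s)
      exact ⟨N, hN.le⟩
    classical
    refine (Nat.find_spec hex).trans ?_
    rw [← mul_assoc]
    gcongr
    calc ((Nat.find hex : ℕ) : ℝ≥0∞) * L
        = ∑ m ∈ Finset.range (Nat.find hex), (S m).indicator (fun _ => (L : ℝ≥0∞)) x := by
          have hmem : ∀ m ∈ Finset.range (Nat.find hex), x ∈ S m := fun m hm => by
            refine subset_toMeasurable _ _ ⟨hx, s, hs, hsR, ?_⟩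
            rw [mul_assoc]
            exact not_le.1 (Nat.find_min hex (Finset.mem_range.1 hm))
          rw [Finset.sum_congr rfl fun m hm => indicator_of_mem (hmem m hm) _]
          simp
      _ ≤ _ := ENNReal.sum_le_tsum _

end Doubling

section Maximal

variable {α : Type*} [MeasurableSpace α] [PseudoMetricSpace α] {μ : Measure α} {D : ℝ≥0}
  {f : α → ℝ}

lemma lintegral_enorm_le_of_setAverage_le (h : IsBallDoubling μ D) {x : α} {s : ℝ} (hs : 0 < s)
    {g : α → ℝ} (hg : IntegrableOn g (ball x s) μ) {C : ℝ}
    (hC : ⨍ y in ball x s, |g y| ∂μ ≤ C) :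
    ∫⁻ y in ball x s, ‖g y‖ₑ ∂μ ≤ ENNReal.ofReal C * μ (ball x s) := by
  have h1 := (h.lt_top x s).ne
  have hreal : 0 < μ.real (ball x s) := ENNReal.toReal_pos (h.pos x s hs).ne' h1
  rw [setAverage_eq, smul_eq_mul, inv_mul_le_iff₀ hreal] at hC
  rw [← ofReal_integral_norm_eq_lintegral_enorm hg]
  simp only [Real.norm_eq_abs]
  calc ENNReal.ofReal (∫ y in ball x s, |g y| ∂μ)
      ≤ ENNReal.ofReal (μ.real (ball x s) * C) := ENNReal.ofReal_le_ofReal hC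
    _ = ENNReal.ofReal C * μ (ball x s) := by
        rw [ENNReal.ofReal_mul hreal.le, measureReal_def, ENNReal.ofReal_toReal h1, mul_comm]

lemma ballDev_zero_le_of_isBMOL (h : IsBallDoubling μ D)
    (hf : ∀ x r, IntegrableOn f (ball x r) μ) {ρ : α → ℝ} {C : ℝ} (hC : IsBMOL μ ρ f C)
    {x : α} {r : ℝ} (hr : 0 < r) (hρ : ρ x ≤ r) :
    ballDev μ f 0 x r ≤ ENNReal.ofReal C * μ (ball x r) := by
  simpa [ballDev] using lintegral_enorm_le_of_setAverage_le h hr (hf x r) (hC.2 x r hρ)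

lemma ballDev_ballAvg_le_of_isBMOL (h : IsBallDoubling μ D)
    (hf : ∀ x r, IntegrableOn f (ball x r) μ) {ρ : α → ℝ} {C : ℝ} (hC : IsBMOL μ ρ f C)
    (x : α) {r : ℝ} (hr : 0 < r) :
    ballDev μ f (ballAvg μ f x r) x r ≤ 2 * ENNReal.ofReal C * μ (ball x r) := by
  rcases lt_or_ge r (ρ x) with hlt | hge
  · refine (lintegral_enorm_le_of_setAverage_le h hr
      ((hf x r).sub (integrableOn_const (h.lt_top x r).ne)) (hC.1 x r hr hlt)).trans ?_
    gcongr
    exact le_mul_of_one_le_left' one_le_two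
  · have h0 := ballDev_zero_le_of_isBMOL h hf hC hr hge
    have h1 := enorm_ballAvg_sub_mul_le h hf 0 x hr
    rw [← enorm_neg, neg_sub] at h1
    calc _ ≤ ballDev μ f 0 x r + ‖0 - ballAvg μ f x r‖ₑ * μ (ball x r) := ballDev_le_add _ _ _ _ _
      _ ≤ ENNReal.ofReal C * μ (ball x r) + ENNReal.ofReal C * μ (ball x r) := by
          exact add_le_add h0 (h1.trans h0)
      _ = _ := by ring

/-- The maximal function of an `IsBMOL` function is integrable on balls, for any measure that is
doubling on all balls. -/
lemma lintegral_maximalFn_lt_top_of_isBMOL [OpensMeasurableSpace α] [SecondCountableTopology α]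
    (h : IsBallDoubling μ D)
    (hf : ∀ x r, IntegrableOn f (ball x r) μ) {ρ : α → ℝ} {C : ℝ} (hC : IsBMOL μ ρ f C)
    (x₀ : α) (r₀ : ℝ) : ∫⁻ x in ball x₀ r₀, maximalFn μ f x ∂μ < ⊤ := by
  set r₁ := max 1 (max r₀ (ρ x₀))
  have hr₁ : 0 < r₁ := zero_lt_one.trans_le (le_max_left _ _)
  have hr₀ : r₀ ≤ r₁ := (le_max_left _ _).trans (le_max_right _ _)
  have hρ : ρ x₀ ≤ r₁ := (le_max_right _ _).trans (le_max_right _ _)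
  obtain ⟨g, hgm, hgi, hg⟩ := exists_majorant_ballDev h hf (A := 2 * C.toNNReal + 1)
    (by positivity)
    (fun x r hr => (ballDev_ballAvg_le_of_isBMOL h hf hC x hr).trans (by
      push_cast
      gcongr
      exact le_self_add)) x₀ (R := 2 * r₁) (by positivity)
  set c := ballAvg μ f x₀ (2 * r₁)
  have hbound : ∀ x ∈ ball x₀ r₀, maximalFn μ f x ≤
      (D : ℝ≥0∞) ^ 3 * ENNReal.ofReal C + (D : ℝ≥0∞) ^ 2 * (g x + ‖c‖ₑ) := by
    intro x hx
    have hx' : dist x x₀ < r₀ := hx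
    refine iSup_le fun y => iSup_le fun r => iSup_le fun hxy => ?_
    have hxy' : dist x y < r := hxy
    have hr : 0 < r := pos_of_mem_ball hxy
    have h0 := (h.pos y r hr).ne'
    have h1 := (h.lt_top y r).ne
    rw [mul_comm, ← div_eq_mul_inv, ENNReal.div_le_iff h0 h1]
    have hdev : ∫⁻ z in ball y r, ENNReal.ofReal |f z| ∂μ = ballDev μ f 0 y r := by
      simp [ballDev, Real.enorm_eq_ofReal_abs]
    rw [hdev]
    rcases le_total r₁ r with hle | hle
    · have hyx : dist y x₀ ≤ dist x y + dist x x₀ := by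
        rw [dist_comm x y]; exact dist_triangle _ _ _
      calc ballDev μ f 0 y r ≤ ballDev μ f 0 x₀ (3 * r) := ballDev_mono f 0 (by linarith)
        _ ≤ ENNReal.ofReal C * μ (ball x₀ (3 * r)) :=
            ballDev_zero_le_of_isBMOL h hf hC (by positivity) (by linarith)
        _ ≤ ENNReal.ofReal C * ((D : ℝ≥0∞) ^ 3 * μ (ball y r)) := by
            gcongr
            exact h.measure_ball_le hr 3 (by rw [dist_comm]; linarith)
        _ = (D : ℝ≥0∞) ^ 3 * ENNReal.ofReal C * μ (ball y r) := by ring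
        _ ≤ _ := by gcongr; exact le_self_add
    · calc ballDev μ f 0 y r ≤ ballDev μ f 0 x (2 * r) :=
            ballDev_mono f 0 (by rw [dist_comm]; linarith)
        _ ≤ ballDev μ f c x (2 * r) + ‖c - 0‖ₑ * μ (ball x (2 * r)) := ballDev_le_add _ _ _ _ _
        _ ≤ g x * μ (ball x (2 * r)) + ‖c‖ₑ * μ (ball x (2 * r)) := by
            rw [sub_zero]
            gcongr
            exact hg x (ball_subset_ball (by linarith) hx) _ (by positivity) (by linarith)
        _ = (g x + ‖c‖ₑ) * μ (ball x (2 * r)) := by ring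
        _ ≤ (g x + ‖c‖ₑ) * ((D : ℝ≥0∞) ^ 2 * μ (ball y r)) := by
            gcongr
            exact h.measure_ball_le hr 2 (by linarith)
        _ = (D : ℝ≥0∞) ^ 2 * (g x + ‖c‖ₑ) * μ (ball y r) := by ring
        _ ≤ _ := by gcongr; exact le_add_self
  calc ∫⁻ x in ball x₀ r₀, maximalFn μ f x ∂μ
      ≤ ∫⁻ x in ball x₀ r₀, ((D : ℝ≥0∞) ^ 3 * ENNReal.ofReal C +
          (D : ℝ≥0∞) ^ 2 * (g x + ‖c‖ₑ)) ∂μ := setLIntegral_mono' measurableSet_ball hbound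
    _ = (D : ℝ≥0∞) ^ 3 * ENNReal.ofReal C * μ (ball x₀ r₀) +
          (D : ℝ≥0∞) ^ 2 * (∫⁻ x in ball x₀ r₀, g x ∂μ + ‖c‖ₑ * μ (ball x₀ r₀)) := by
        rw [lintegral_add_left measurable_const, lintegral_const_mul _ (by fun_prop : Measurable fun x => g x + ‖c‖ₑ),
          lintegral_add_left hgm]
        simp
    _ < ⊤ := by
        have hb := h.lt_top x₀ r₀
        have hg' : ∫⁻ x in ball x₀ r₀, g x ∂μ < ⊤ := (setLIntegral_le_lintegral _ _).trans_lt hgi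
        have hc : ‖c‖ₑ < ⊤ := enorm_lt_top
        have hD : (D : ℝ≥0∞) < ⊤ := ENNReal.coe_lt_top
        finiteness

end Maximal

section Weight

variable {E : Type*} [NormedAddCommGroup E] [InnerProductSpace ℝ E]

/-- Every point has nearby points that stay away from finitely many hyperplanes, at a distance
proportional to the scale. -/
lemma exists_inner_separated (S : Finset E) (b : E) (hb : ∀ ζ ∈ S, 0 < ⟪ζ, b⟫) :
    ∃ δ : ℝ, 0 < δ ∧ ∀ (x : E) (r : ℝ), 0 < r →
      ∃ y, dist y x ≤ r / 2 ∧ ∀ ζ ∈ S, δ * r ≤ |⟪ζ, y⟫| := by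
  obtain ⟨β, hβ, hβS⟩ : ∃ β : ℝ, 0 < β ∧ ∀ ζ ∈ S, β ≤ ⟪ζ, b⟫ := by
    rcases S.eq_empty_or_nonempty with rfl | hS
    · exact ⟨1, one_pos, by simp⟩
    · obtain ⟨ζ₀, h₀, hmin⟩ := S.exists_min_image (fun ζ => ⟪ζ, b⟫) hS
      exact ⟨_, hb ζ₀ h₀, hmin⟩
  set τ : ℝ := 1 / (2 * (S.card + 1) * (‖b‖ + 1)) with hτ
  have hτ0 : 0 < τ := by positivity
  refine ⟨τ * β / 4, by positivity, fun x r hr => ?_⟩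
  by_contra! hcon
  have hnear : ∀ i ∈ Finset.range (S.card + 1), dist (x + ((i : ℝ) * τ * r) • b) x ≤ r / 2 := by
    intro i hi
    have hi' : (i : ℝ) ≤ S.card + 1 := by exact_mod_cast (Finset.mem_range.1 hi).le
    rw [dist_self_add_left, norm_smul, Real.norm_of_nonneg (by positivity)]
    calc (i : ℝ) * τ * r * ‖b‖ ≤ (S.card + 1) * τ * r * (‖b‖ + 1) := by gcongr; linarith
      _ = r / 2 := by rw [hτ]; field_simp
  have hbad : ∀ i ∈ Finset.range (S.card + 1), ∃ ζ ∈ S,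
      |⟪ζ, x + ((i : ℝ) * τ * r) • b⟫| < τ * β / 4 * r := fun i hi => hcon _ (hnear i hi)
  choose! Z hZS hZ using hbad
  obtain ⟨i, hi, j, hj, hij, heq⟩ := Finset.exists_ne_map_eq_of_card_lt_of_maps_to
    (s := Finset.range (S.card + 1)) (t := S) (by simp) (f := Z) (fun i hi => hZS i hi)
  have h1 := hZ i hi
  have h2 := hZ j hj
  rw [← heq] at h2
  have h3 := (abs_sub _ _).trans_lt (add_lt_add h1 h2)
  rw [← inner_sub_right, add_sub_add_left_eq_sub, ← sub_smul, inner_smul_right, abs_mul,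
    ← sub_mul, ← sub_mul, abs_mul, abs_mul, abs_of_pos hτ0, abs_of_pos hr] at h3
  have hij' : (1 : ℝ) ≤ |(i : ℝ) - j| := by
    have : (1 : ℤ) ≤ |(i : ℤ) - j| := Int.one_le_abs (by omega)
    exact_mod_cast this
  have hζ : β ≤ |⟪Z i, b⟫| := (hβS _ (hZS i hi)).trans (le_abs_self _)
  have h4 : 1 * τ * r * β ≤ |(i : ℝ) - j| * τ * r * |⟪Z i, b⟫| := by gcongr
  have h5 : 0 < τ * r * β := by positivity
  linarith

/-- The values of a product of powers of linear forms on `B(x, 2r)` are controlled by its values on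
some ball of comparable radius inside `B(x, r)`. -/
lemma exists_ball_prod_inner_rpow_le (S : Finset E) (b : E) (hb : ∀ ζ ∈ S, 0 < ⟪ζ, b⟫)
    (e : E → ℝ) (he : ∀ ζ ∈ S, 0 ≤ e ζ) :
    ∃ ε C : ℝ, 0 < ε ∧ 0 ≤ C ∧ ∀ (x : E) (r : ℝ), 0 < r → ∃ (y : E) (m : ℝ), 0 < m ∧
      ball y (ε * r) ⊆ ball x r ∧
      (∀ z ∈ ball y (ε * r), m ≤ ∏ ζ ∈ S, |⟪ζ, z⟫| ^ e ζ) ∧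
      ∀ z ∈ ball x (2 * r), ∏ ζ ∈ S, |⟪ζ, z⟫| ^ e ζ ≤ C * m := by
  obtain ⟨δ, hδ, hsep⟩ := exists_inner_separated S b hb
  set M : ℝ := ∑ ζ ∈ S, ‖ζ‖
  have hM0 : 0 ≤ M := Finset.sum_nonneg fun _ _ => norm_nonneg _
  have hM : ∀ ζ ∈ S, ‖ζ‖ ≤ M := fun ζ hζ =>
    Finset.single_le_sum (f := fun ζ : E => ‖ζ‖) (fun _ _ => norm_nonneg _) hζ
  set Q : ℝ := 2 + 6 * M / δ with hQ
  have hQ0 : 0 ≤ Q := by positivity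
  have hinner : ∀ ζ ∈ S, ∀ (z y : E) (s : ℝ), dist z y ≤ s → |⟪ζ, z⟫ - ⟪ζ, y⟫| ≤ M * s := by
    intro ζ hζ z y s hs
    rw [← inner_sub_right]
    rw [dist_eq_norm] at hs
    exact (abs_real_inner_le_norm _ _).trans
      (mul_le_mul (hM ζ hζ) hs (norm_nonneg _) hM0)
  set ε : ℝ := min (1 / 2) (δ / (2 * (M + 1)))
  have hε : 0 < ε := by positivity
  have hεM : M * ε ≤ δ / 2 := by
    calc M * ε ≤ (M + 1) * (δ / (2 * (M + 1))) := by
          gcongr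
          · linarith
          · exact min_le_right _ _
      _ = δ / 2 := by field_simp
  refine ⟨ε, ∏ ζ ∈ S, Q ^ e ζ, hε, Finset.prod_nonneg fun _ _ => by positivity,
    fun x r hr => ?_⟩
  obtain ⟨y, hyx, hy⟩ := hsep x r hr
  have hypos : ∀ ζ ∈ S, 0 < |⟪ζ, y⟫| := fun ζ hζ => (by positivity : 0 < δ * r).trans_le (hy ζ hζ)
  refine ⟨y, ∏ ζ ∈ S, (|⟪ζ, y⟫| / 2) ^ e ζ, ?_, ?_, ?_, ?_⟩
  · exact Finset.prod_pos fun ζ hζ => Real.rpow_pos_of_pos (half_pos (hypos ζ hζ)) _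
  · refine ball_subset_ball' ?_
    have : ε * r ≤ 1 / 2 * r := by gcongr; exact min_le_left _ _
    linarith
  · intro z hz
    refine Finset.prod_le_prod (fun ζ _ => by positivity) fun ζ hζ => ?_
    refine Real.rpow_le_rpow (by positivity) ?_ (he ζ hζ)
    have h1 := hinner ζ hζ y z (ε * r) (by rw [dist_comm]; exact (mem_ball.1 hz).le)
    have h2 := abs_sub_abs_le_abs_sub ⟪ζ, y⟫ ⟪ζ, z⟫
    have h3 : M * (ε * r) ≤ δ / 2 * r := by rw [← mul_assoc]; gcongr
    linarith [hy ζ hζ]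
  · intro z hz
    rw [← Finset.prod_mul_distrib]
    refine Finset.prod_le_prod (fun ζ _ => by positivity) fun ζ hζ => ?_
    rw [← Real.mul_rpow hQ0 (by positivity)]
    refine Real.rpow_le_rpow (by positivity) ?_ (he ζ hζ)
    have hzy : dist z y ≤ 3 * r := by
      have := dist_triangle_right z y x
      linarith [mem_ball.1 hz]
    have h1 := hinner ζ hζ z y _ hzy
    have h2 := abs_sub_abs_le_abs_sub ⟪ζ, z⟫ ⟪ζ, y⟫
    have h3 : M * (3 * r) ≤ 3 * M / δ * |⟪ζ, y⟫| := by
      calc M * (3 * r) = 3 * M / δ * (δ * r) := by field_simp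
        _ ≤ _ := by gcongr; exact hy ζ hζ
    calc |⟪ζ, z⟫| ≤ |⟪ζ, y⟫| + 3 * M / δ * |⟪ζ, y⟫| := by linarith
      _ = Q * (|⟪ζ, y⟫| / 2) := by rw [hQ]; ring

lemma continuous_prod_inner_rpow (S : Finset E) (e : E → ℝ) (he : ∀ ζ ∈ S, 0 ≤ e ζ) :
    Continuous fun z => ∏ ζ ∈ S, |⟪ζ, z⟫| ^ e ζ :=
  continuous_finsetProd _ fun ζ hζ =>
    (by fun_prop : Continuous fun z : E => |⟪ζ, z⟫|).rpow_const fun _ => Or.inr (he ζ hζ)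

/-- A product of powers of linear forms that are positive on a common vector is a doubling
weight. -/
lemma exists_isBallDoubling_prod_inner_rpow [FiniteDimensional ℝ E] [MeasurableSpace E]
    [BorelSpace E] (ν : Measure E) [ν.IsAddHaarMeasure]
    (S : Finset E) (b : E) (hb : ∀ ζ ∈ S, 0 < ⟪ζ, b⟫) (e : E → ℝ) (he : ∀ ζ ∈ S, 0 ≤ e ζ) :
    ∃ D, IsBallDoubling
      (ν.withDensity fun z => ENNReal.ofReal (∏ ζ ∈ S, |⟪ζ, z⟫| ^ e ζ)) D := by
  obtain ⟨ε, C, hε, hC, hw⟩ := exists_ball_prod_inner_rpow_le S b hb e he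
  set w : E → ℝ := fun z => ∏ ζ ∈ S, |⟪ζ, z⟫| ^ e ζ
  set d := Module.finrank ℝ E
  have hball : ∀ x r, ν.withDensity (fun z => ENNReal.ofReal (w z)) (ball x r) =
      ∫⁻ z in ball x r, ENNReal.ofReal (w z) ∂ν := fun x r => withDensity_apply _ measurableSet_ball
  have hlow : ∀ {y : E} {s m : ℝ}, (∀ z ∈ ball y s, m ≤ w z) →
      ENNReal.ofReal m * ν (ball y s) ≤ ∫⁻ z in ball y s, ENNReal.ofReal (w z) ∂ν := by
    intro y s m hm
    rw [← setLIntegral_const]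
    exact setLIntegral_mono' measurableSet_ball fun z hz => ENNReal.ofReal_le_ofReal (hm z hz)
  have hup : ∀ {y : E} {s m : ℝ}, (∀ z ∈ ball y s, w z ≤ m) →
      ∫⁻ z in ball y s, ENNReal.ofReal (w z) ∂ν ≤ ENNReal.ofReal m * ν (ball y s) := by
    intro y s m hm
    rw [← setLIntegral_const]
    exact setLIntegral_mono' measurableSet_ball fun z hz => ENNReal.ofReal_le_ofReal (hm z hz)
  have hscale : ∀ (x y : E) (r : ℝ), 0 < r → ν (ball x (2 * r)) =
      ENNReal.ofReal ((2 / ε) ^ d) * ν (ball y (ε * r)) := by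
    intro x y r hr
    rw [show 2 * r = 2 / ε * (ε * r) by field_simp,
      Measure.addHaar_ball_mul_of_pos ν x (by positivity), Measure.addHaar_ball_center ν y]
  refine ⟨1 + C.toNNReal * ((2 / ε) ^ d).toNNReal, ⟨le_self_add, ?_, ?_, ?_⟩⟩
  · intro x r hr
    obtain ⟨y, m, hm, hsub, hlo, -⟩ := hw x r hr
    calc (0 : ℝ≥0∞) < ENNReal.ofReal m * ν (ball y (ε * r)) :=
          ENNReal.mul_pos (ENNReal.ofReal_pos.2 hm).ne'
            (measure_ball_pos ν y (by positivity)).ne'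
      _ ≤ _ := by rw [hball]; exact (hlow hlo).trans (lintegral_mono_set hsub)
  · intro x r
    have : IsLocallyFiniteMeasure (ν.withDensity fun z => ENNReal.ofReal (w z)) :=
      IsLocallyFiniteMeasure.withDensity_ofReal (continuous_prod_inner_rpow S e he)
    exact measure_ball_lt_top
  · intro x r hr
    obtain ⟨y, m, hm, hsub, hlo, hhi⟩ := hw x r hr
    rw [hball, hball]
    calc ∫⁻ z in ball x (2 * r), ENNReal.ofReal (w z) ∂ν
        ≤ ENNReal.ofReal (C * m) * ν (ball x (2 * r)) := hup hhi
      _ = ENNReal.ofReal C * ENNReal.ofReal ((2 / ε) ^ d) *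
          (ENNReal.ofReal m * ν (ball y (ε * r))) := by
          rw [hscale x y r hr, ENNReal.ofReal_mul hC]; ring
      _ ≤ ENNReal.ofReal C * ENNReal.ofReal ((2 / ε) ^ d) *
          ∫⁻ z in ball x r, ENNReal.ofReal (w z) ∂ν := by
          gcongr
          exact (hlow hlo).trans (lintegral_mono_set hsub)
      _ ≤ _ := by
          gcongr
          push_cast
          exact le_add_self

end Weight

end Auxiliary

/-- For `f ∈ BMO(𝓛_k)`, the maximal function `M_k f` is locally integrable with respect to
`ω_k`. -/
theorem maximal_locally_integrable
    (n : ℕ) (hn : 0 < n)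
    (Rs Rp : Finset (EuclideanSpace ℝ (Fin n)))
    (hRs0 : (0 : EuclideanSpace ℝ (Fin n)) ∉ Rs)
    (hRsnorm : ∀ ζ ∈ Rs, ⟪ζ, ζ⟫ = (2 : ℝ))
    (hRsrefl : ∀ ζ ∈ Rs, ∀ η ∈ Rs, η - ⟪η, ζ⟫ • ζ ∈ Rs)
    (hRsline : ∀ ζ ∈ Rs, ∀ c : ℝ, c • ζ ∈ Rs → c = 1 ∨ c = -1)
    (b : EuclideanSpace ℝ (Fin n))
    (hRpdef : ∀ ζ ∈ Rs, (ζ ∈ Rp ↔ 0 < ⟪ζ, b⟫)) (hRpsub : Rp ⊆ Rs)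
    (k : EuclideanSpace ℝ (Fin n) → ℝ)
    (hk0 : ∀ ζ ∈ Rs, 0 ≤ k ζ)
    (hkinv : ∀ ζ ∈ Rs, ∀ η ∈ Rs, k (η - ⟪η, ζ⟫ • ζ) = k η)
    (w : EuclideanSpace ℝ (Fin n) → ℝ)
    (hw : ∀ x, w x = ∏ ζ ∈ Rp, |⟪ζ, x⟫| ^ (2 * k ζ))
    (γ : ℝ) (hγ : γ = ∑ ζ ∈ Rp, k ζ)
    (μ : Measure (EuclideanSpace ℝ (Fin n)))
    (hμ : μ = volume.withDensity (fun x => ENNReal.ofReal (w x)))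
    (V : EuclideanSpace ℝ (Fin n) → ℝ)
    (hV0 : ∀ x, 0 ≤ V x)
    (hVloc : LocallyIntegrable V μ)
    (hVne : ¬ (∀ᵐ x ∂μ, V x = 0))
    (q : ℝ) (hq : max 1 (((n : ℝ) + 2 * γ) / 2) < q)
    (C_RH : ℝ) (hC_RH : 0 < C_RH)
    (hRH : ∀ (x : EuclideanSpace ℝ (Fin n)) (r : ℝ), 0 < r →
      (⨍ y in Metric.ball x r, V y ^ q ∂μ) ^ (1 / q) ≤
        C_RH * ⨍ y in Metric.ball x r, V y ∂μ)
    (ρ : EuclideanSpace ℝ (Fin n) → ℝ)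
    (hρdef : ∀ x, ρ x = sSup {r : ℝ | 0 < r ∧
      r ^ 2 / (μ (Metric.ball x r)).toReal * ∫ y in Metric.ball x r, V y ∂μ ≤ 1})
    (hρpos : ∀ x, 0 < ρ x)
    (f : EuclideanSpace ℝ (Fin n) → ℝ) (hfloc : LocallyIntegrable f μ)
    (Cf : ℝ) (hCf0 : 0 ≤ Cf) (hCf : IsBMOL μ ρ f Cf)
    :
    ∀ (x₀ : EuclideanSpace ℝ (Fin n)) (r₀ : ℝ),
      ∫⁻ x in Metric.ball x₀ r₀, maximalFn μ f x ∂μ < ⊤ := by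
  have hpos : ∀ ζ ∈ Rp, 0 < ⟪ζ, b⟫ := fun ζ hζ => (hRpdef ζ (hRpsub hζ)).1 hζ
  obtain ⟨D, hD⟩ := exists_isBallDoubling_prod_inner_rpow volume Rp b hpos (fun ζ => 2 * k ζ)
    (fun ζ hζ => mul_nonneg zero_le_two (hk0 ζ (hRpsub hζ)))
  obtain rfl : w = fun x => ∏ ζ ∈ Rp, |⟪ζ, x⟫| ^ (2 * k ζ) := funext hw
  rw [← hμ] at hD
  have hf : ∀ x r, IntegrableOn f (ball x r) μ := fun x r =>
    (hfloc.integrableOn_isCompact (isCompact_closedBall x r)).mono_set ball_subset_closedBall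
  exact lintegral_maximalFn_lt_top_of_isBMOL hD hf hCf
end
end
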